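/- For every d ∈ ℕ there exists a constant C_d > 0, depending only on d, with the following property: let Λ₁, …, Λ_d be Littlewood–Paley sequences on ℝ with σ_{Λ_n} < ∞ for all n = 1,…,d. Then for every p with 1 < p < 2 and every Schwartz function f on ℝ^d whose Fourier transform is supported in [0,∞)^d (such functions are dense in the analytic Hardy space H^p_A(ℝ^d)), one has ‖S_{ℝ^d}^{(Λ₁,…,Λ_d)}(f)‖_{L^p(ℝ^d)} ≤ C_d (p−1)^{-d} (Π_{n=1}^d σ_{Λ_n}^{1/2}) ‖f‖_{L^p(ℝ^d)}. -/

import Mathlib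

open MeasureTheory Real Complex Filter
open scoped ENNReal BigOperators Topology

noncomputable section

/-- The Fourier transform `f̂(ξ) = ∫ f(x) e^{-i x·ξ} dx` on `ℝ^d`. -/
def FTd {d : ℕ} (f : (Fin d → ℝ) → ℂ) (ξ : Fin d → ℝ) : ℂ :=
  ∫ x : Fin d → ℝ, Complex.exp (-(Complex.I * ((∑ k, x k * ξ k : ℝ) : ℂ))) * f x

/-- The symbol `χ_{[Λ(j-1), Λ j) ∪ (-Λ j, -Λ(j-1)]}` of the rough projection `P_j^{(Λ)}`. -/
def symInd (Λ : ℤ → ℝ) (j : ℤ) (ξ : ℝ) : ℝ :=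
  if (Λ (j - 1) ≤ ξ ∧ ξ < Λ j) ∨ (-(Λ j) < ξ ∧ ξ ≤ -(Λ (j - 1))) then 1 else 0

/-- The `d`-parameter rough Littlewood–Paley piece `(P_{j₁}⊗⋯⊗P_{j_d}) f`, i.e. the
inverse Fourier transform of `f̂` multiplied by the product of the one-variable rough
symbols. -/
def PpiecePi {d : ℕ} (Λs : Fin d → ℤ → ℝ) (j : Fin d → ℤ) (f : (Fin d → ℝ) → ℂ)
    (x : Fin d → ℝ) : ℂ :=
  (((2 * π) ^ d)⁻¹ : ℝ) • ∫ ξ : Fin d → ℝ,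
    ((∏ k, symInd (Λs k) (j k) (ξ k) : ℝ) : ℂ) * FTd f ξ *
      Complex.exp (Complex.I * ((∑ k, x k * ξ k : ℝ) : ℂ))

/-- The `d`-parameter rough Littlewood–Paley square function on `ℝ^d`. -/
def LPsqE {d : ℕ} (Λs : Fin d → ℤ → ℝ) (f : (Fin d → ℝ) → ℂ) (x : Fin d → ℝ) : ℝ :=
  Real.sqrt (∑' j : Fin d → ℤ, ‖PpiecePi Λs j f x‖ ^ 2)

/-- `σ_Λ = sup_{j∈ℤ} #(Λ ∩ [2^{j-1}, 2^j))`, where `Λ` is identified with its range. -/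
def sigmaE (Λ : ℤ → ℝ) : ℕ :=
  sSup {m : ℕ | ∃ j : ℤ, m = (Set.range Λ ∩ Set.Ico ((2:ℝ) ^ (j - 1)) ((2:ℝ) ^ j)).ncard}

/-- A function on the half plane together with candidate first and pure second partial
derivatives. -/
structure PlaneJet where
  f : ℝ → ℝ → ℝ
  fx : ℝ → ℝ → ℝ
  fy : ℝ → ℝ → ℝ
  fxx : ℝ → ℝ → ℝ
  fyy : ℝ → ℝ → ℝ

/-- Boundedness on every half plane `y ≥ y₀ > 0`, relative to the weight `w x`. -/
def DecayBy (w : ℝ → ℝ) (f : ℝ → ℝ → ℝ) : Prop :=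
  ∀ y₀ : ℝ, 0 < y₀ → ∃ C : ℝ, 0 ≤ C ∧ ∀ x y, y₀ ≤ y → |f x y| ≤ C * w x

def wOne : ℝ → ℝ := fun _ => 1
def wAbs : ℝ → ℝ := fun x => (1 + |x|)⁻¹
def wSq : ℝ → ℝ := fun x => (1 + x ^ 2)⁻¹

lemma wSq_pos (x : ℝ) : 0 < wSq x := by unfold wSq; positivity
lemma wAbs_mul_le (x : ℝ) : wAbs x * wAbs x ≤ wSq x := by
  unfold wAbs wSq
  rw [← mul_inv]
  apply inv_anti₀ (by positivity)
  nlinarith [abs_nonneg x, sq_abs x]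
lemma wSq_le_one (x : ℝ) : wSq x ≤ 1 := by
  unfold wSq
  exact inv_le_one_of_one_le₀ (by nlinarith [sq_nonneg x])
lemma integrable_wSq : Integrable wSq := integrable_inv_one_add_sq

lemma DecayBy.add {w f g} (hf : DecayBy w f) (hg : DecayBy w g) :
    DecayBy w (fun x y => f x y + g x y) := by
  intro y₀ h0
  obtain ⟨C, hC, h1⟩ := hf y₀ h0
  obtain ⟨D, hD, h2⟩ := hg y₀ h0
  refine ⟨C + D, by positivity, fun x y hy => (abs_add_le _ _).trans ?_⟩
  have := h1 x y hy
  have := h2 x y hy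
  linarith

lemma DecayBy.mono {w w' f} (hf : DecayBy w f) (h : ∀ x, w x ≤ w' x) : DecayBy w' f := by
  intro y₀ h0
  obtain ⟨C, hC, h1⟩ := hf y₀ h0
  exact ⟨C, hC, fun x y hy => (h1 x y hy).trans (mul_le_mul_of_nonneg_left (h x) hC)⟩

lemma DecayBy.mul {w₁ w₂ w f g} (hf : DecayBy w₁ f) (hg : DecayBy w₂ g)
    (h : ∀ x, w₁ x * w₂ x ≤ w x) : DecayBy w (fun x y => f x y * g x y) := by
  intro y₀ h0
  obtain ⟨C, hC, h1⟩ := hf y₀ h0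
  obtain ⟨D, hD, h2⟩ := hg y₀ h0
  refine ⟨C * D, by positivity, fun x y hy => ?_⟩
  rw [abs_mul]
  calc |f x y| * |g x y| ≤ (C * w₁ x) * (D * w₂ x) :=
        mul_le_mul (h1 x y hy) (h2 x y hy) (abs_nonneg _) ((abs_nonneg _).trans (h1 x y hy))
    _ = C * D * (w₁ x * w₂ x) := by ring
    _ ≤ _ := mul_le_mul_of_nonneg_left (h x) (by positivity)

lemma DecayBy.bdd_of_sq {f} (hf : DecayBy wSq f) : DecayBy wOne f := hf.mono wSq_le_one

lemma DecayBy.bd_mul {w f g} (hf : DecayBy wOne f) (hg : DecayBy w g) :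
    DecayBy w (fun x y => f x y * g x y) := hf.mul hg (fun x => by simp [wOne])

lemma DecayBy.const (c : ℝ) : DecayBy wOne (fun _ _ => c) := fun _ _ =>
  ⟨|c|, abs_nonneg _, fun _ _ _ => by simp [wOne]⟩

lemma DecayBy.zero {w : ℝ → ℝ} (hw : ∀ x, 0 ≤ w x) : DecayBy w (fun _ _ => 0) := fun _ _ =>
  ⟨0, le_rfl, fun _ _ _ => by simp⟩

lemma DecayBy.neg {w f} (hf : DecayBy w f) : DecayBy w (fun x y => - f x y) := by
  intro y₀ h0
  obtain ⟨C, hC, h1⟩ := hf y₀ h0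
  exact ⟨C, hC, fun x y hy => by rw [abs_neg]; exact h1 x y hy⟩

lemma DecayBy.sum {ι : Type*} {w : ℝ → ℝ} (hw : ∀ x, 0 ≤ w x) {f : ι → ℝ → ℝ → ℝ}
    (s : Finset ι) (hf : ∀ i, DecayBy w (f i)) : DecayBy w (fun x y => ∑ i ∈ s, f i x y) := by
  classical
  induction s using Finset.induction_on with
  | empty => simpa using DecayBy.zero hw
  | insert a s ha ih => simpa [Finset.sum_insert ha] using (hf a).add ih

lemma DecayBy.rpow {f} (hf : DecayBy wOne f) {c : ℝ} (hc : 0 < c) (h : ∀ x y, 0 < y → c ≤ f x y)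
    (s : ℝ) : DecayBy wOne (fun x y => f x y ^ s) := by
  intro y₀ h0
  obtain ⟨C, hC, h1⟩ := hf y₀ h0
  refine ⟨C ^ s + c ^ s, by positivity, fun x y hy => ?_⟩
  have h2 := h x y (h0.trans_le hy)
  have h3 : f x y ≤ C := by simpa [wOne] using (le_abs_self _).trans (h1 x y hy)
  have h4 : 0 < f x y := hc.trans_le h2
  rw [abs_of_nonneg (by positivity)]
  simp only [wOne, mul_one]
  rcases le_total 0 s with hs | hs
  · have := Real.rpow_le_rpow h4.le h3 hs
    have : 0 ≤ c ^ s := by positivity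
    linarith
  · have := Real.rpow_le_rpow_of_nonpos hc h2 hs
    have : 0 ≤ C ^ s := by positivity
    linarith

namespace PlaneJet

def lap (J : PlaneJet) (x y : ℝ) : ℝ := J.fxx x y + J.fyy x y
def gradSq (J : PlaneJet) (x y : ℝ) : ℝ := J.fx x y ^ 2 + J.fy x y ^ 2

/-- The candidate derivatives are the derivatives on the upper half plane, and they are
continuous along horizontal lines. -/
structure IsJet (J : PlaneJet) : Prop where
  hx : ∀ x y, 0 < y → HasDerivAt (fun t => J.f t y) (J.fx x y) x
  hy : ∀ x y, 0 < y → HasDerivAt (fun t => J.f x t) (J.fy x y) y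
  hxx : ∀ x y, 0 < y → HasDerivAt (fun t => J.fx t y) (J.fxx x y) x
  hyy : ∀ x y, 0 < y → HasDerivAt (fun t => J.fy x t) (J.fyy x y) y
  cy : ∀ y, 0 < y → Continuous (fun x => J.fy x y)
  cxx : ∀ y, 0 < y → Continuous (fun x => J.fxx x y)
  cyy : ∀ y, 0 < y → Continuous (fun x => J.fyy x y)

/-- A jet which decays with weight `w`, with derivatives decaying with weight `w'`. -/
structure Decays (w w' : ℝ → ℝ) (J : PlaneJet) : Prop extends IsJet J where
  df : DecayBy w J.f
  dx : DecayBy w' J.fx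
  dy : DecayBy w' J.fy
  dxx : DecayBy w' J.fxx
  dyy : DecayBy w' J.fyy

lemma IsJet.cf {J : PlaneJet} (h : J.IsJet) (y : ℝ) (hy : 0 < y) : Continuous (fun x => J.f x y) :=
  continuous_iff_continuousAt.2 fun x => (h.hx x y hy).continuousAt

lemma IsJet.cx {J : PlaneJet} (h : J.IsJet) (y : ℝ) (hy : 0 < y) : Continuous (fun x => J.fx x y) :=
  continuous_iff_continuousAt.2 fun x => (h.hxx x y hy).continuousAt

protected def const (c : ℝ) : PlaneJet := ⟨fun _ _ => c, fun _ _ => 0, fun _ _ => 0, fun _ _ => 0, fun _ _ => 0⟩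

lemma decays_const (c : ℝ) : Decays wOne wSq (PlaneJet.const c) where
  hx _ _ _ := hasDerivAt_const _ _
  hy _ _ _ := hasDerivAt_const _ _
  hxx _ _ _ := hasDerivAt_const _ _
  hyy _ _ _ := hasDerivAt_const _ _
  cy _ _ := continuous_const
  cxx _ _ := continuous_const
  cyy _ _ := continuous_const
  df := DecayBy.const c
  dx := DecayBy.zero fun x => (wSq_pos x).le
  dy := DecayBy.zero fun x => (wSq_pos x).le
  dxx := DecayBy.zero fun x => (wSq_pos x).le
  dyy := DecayBy.zero fun x => (wSq_pos x).le

protected def add (J K : PlaneJet) : PlaneJet :=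
  ⟨fun x y => J.f x y + K.f x y, fun x y => J.fx x y + K.fx x y, fun x y => J.fy x y + K.fy x y,
   fun x y => J.fxx x y + K.fxx x y, fun x y => J.fyy x y + K.fyy x y⟩

lemma IsJet.add {J K : PlaneJet} (hJ : J.IsJet) (hK : K.IsJet) : (J.add K).IsJet where
  hx x y h := (hJ.hx x y h).add (hK.hx x y h)
  hy x y h := (hJ.hy x y h).add (hK.hy x y h)
  hxx x y h := (hJ.hxx x y h).add (hK.hxx x y h)
  hyy x y h := (hJ.hyy x y h).add (hK.hyy x y h)
  cy y h := (hJ.cy y h).add (hK.cy y h)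
  cxx y h := (hJ.cxx y h).add (hK.cxx y h)
  cyy y h := (hJ.cyy y h).add (hK.cyy y h)

lemma Decays.add {w w'} {J K : PlaneJet} (hJ : Decays w w' J) (hK : Decays w w' K) :
    Decays w w' (J.add K) where
  toIsJet := hJ.toIsJet.add hK.toIsJet
  df := hJ.df.add hK.df
  dx := hJ.dx.add hK.dx
  dy := hJ.dy.add hK.dy
  dxx := hJ.dxx.add hK.dxx
  dyy := hJ.dyy.add hK.dyy

protected def sum {ι : Type*} [Fintype ι] (J : ι → PlaneJet) : PlaneJet :=
  ⟨fun x y => ∑ i, (J i).f x y, fun x y => ∑ i, (J i).fx x y, fun x y => ∑ i, (J i).fy x y,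
   fun x y => ∑ i, (J i).fxx x y, fun x y => ∑ i, (J i).fyy x y⟩

lemma IsJet.sum {ι : Type*} [Fintype ι] {J : ι → PlaneJet} (hJ : ∀ i, (J i).IsJet) :
    (PlaneJet.sum J).IsJet where
  hx x y h := HasDerivAt.fun_sum fun i _ => (hJ i).hx x y h
  hy x y h := HasDerivAt.fun_sum fun i _ => (hJ i).hy x y h
  hxx x y h := HasDerivAt.fun_sum fun i _ => (hJ i).hxx x y h
  hyy x y h := HasDerivAt.fun_sum fun i _ => (hJ i).hyy x y h
  cy y h := continuous_finsetSum _ fun i _ => (hJ i).cy y h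
  cxx y h := continuous_finsetSum _ fun i _ => (hJ i).cxx y h
  cyy y h := continuous_finsetSum _ fun i _ => (hJ i).cyy y h

lemma Decays.sum {ι : Type*} [Fintype ι] {w w' : ℝ → ℝ} (hw : ∀ x, 0 ≤ w x) (hw' : ∀ x, 0 ≤ w' x)
    {J : ι → PlaneJet} (hJ : ∀ i, Decays w w' (J i)) : Decays w w' (PlaneJet.sum J) where
  toIsJet := IsJet.sum fun i => (hJ i).toIsJet
  df := DecayBy.sum hw _ fun i => (hJ i).df
  dx := DecayBy.sum hw' _ fun i => (hJ i).dx
  dy := DecayBy.sum hw' _ fun i => (hJ i).dy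
  dxx := DecayBy.sum hw' _ fun i => (hJ i).dxx
  dyy := DecayBy.sum hw' _ fun i => (hJ i).dyy

protected def mul (J K : PlaneJet) : PlaneJet :=
  ⟨fun x y => J.f x y * K.f x y, fun x y => J.fx x y * K.f x y + J.f x y * K.fx x y,
   fun x y => J.fy x y * K.f x y + J.f x y * K.fy x y,
   fun x y => J.fxx x y * K.f x y + J.fx x y * K.fx x y
      + (J.fx x y * K.fx x y + J.f x y * K.fxx x y),
   fun x y => J.fyy x y * K.f x y + J.fy x y * K.fy x y
      + (J.fy x y * K.fy x y + J.f x y * K.fyy x y)⟩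

lemma IsJet.mul {J K : PlaneJet} (hJ : J.IsJet) (hK : K.IsJet) : (J.mul K).IsJet where
  hx x y h := (hJ.hx x y h).mul (hK.hx x y h)
  hy x y h := (hJ.hy x y h).mul (hK.hy x y h)
  hxx x y h := ((hJ.hxx x y h).mul (hK.hx x y h)).add ((hJ.hx x y h).mul (hK.hxx x y h))
  hyy x y h := ((hJ.hyy x y h).mul (hK.hy x y h)).add ((hJ.hy x y h).mul (hK.hyy x y h))
  cy y h := ((hJ.cy y h).mul (hK.cf y h)).add ((hJ.cf y h).mul (hK.cy y h))
  cxx y h := (((hJ.cxx y h).mul (hK.cf y h)).add ((hJ.cx y h).mul (hK.cx y h))).add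
    (((hJ.cx y h).mul (hK.cx y h)).add ((hJ.cf y h).mul (hK.cxx y h)))
  cyy y h := (((hJ.cyy y h).mul (hK.cf y h)).add ((hJ.cy y h).mul (hK.cy y h))).add
    (((hJ.cy y h).mul (hK.cy y h)).add ((hJ.cf y h).mul (hK.cyy y h)))

lemma Decays.mul {u u' v v' w w' : ℝ → ℝ} {J K : PlaneJet} (hJ : Decays u u' J)
    (hK : Decays v v' K) (h1 : ∀ x, u x * v x ≤ w x) (h2 : ∀ x, u' x * v x ≤ w' x)
    (h3 : ∀ x, u x * v' x ≤ w' x) (h4 : ∀ x, u' x * v' x ≤ w' x) :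
    Decays w w' (J.mul K) where
  toIsJet := hJ.toIsJet.mul hK.toIsJet
  df := hJ.df.mul hK.df h1
  dx := (hJ.dx.mul hK.df h2).add (hJ.df.mul hK.dx h3)
  dy := (hJ.dy.mul hK.df h2).add (hJ.df.mul hK.dy h3)
  dxx := ((hJ.dxx.mul hK.df h2).add (hJ.dx.mul hK.dx h4)).add
    ((hJ.dx.mul hK.dx h4).add (hJ.df.mul hK.dxx h3))
  dyy := ((hJ.dyy.mul hK.df h2).add (hJ.dy.mul hK.dy h4)).add
    ((hJ.dy.mul hK.dy h4).add (hJ.df.mul hK.dyy h3))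

lemma Decays.mul_one_sq {J K : PlaneJet} (hJ : Decays wOne wSq J) (hK : Decays wOne wSq K) :
    Decays wOne wSq (J.mul K) :=
  hJ.mul hK (fun _ => by simp [wOne]) (fun _ => by simp [wOne]) (fun _ => by simp [wOne])
    (fun x => mul_le_of_le_one_left (wSq_pos x).le (wSq_le_one x))

lemma Decays.mul_abs {J K : PlaneJet} (hJ : Decays wAbs wAbs J) (hK : Decays wAbs wAbs K) :
    Decays wSq wSq (J.mul K) :=
  hJ.mul hK wAbs_mul_le wAbs_mul_le wAbs_mul_le wAbs_mul_le

lemma Decays.one_of_sq {J : PlaneJet} (hJ : Decays wSq wSq J) : Decays wOne wSq J where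
  toIsJet := hJ.toIsJet
  df := hJ.df.bdd_of_sq
  dx := hJ.dx
  dy := hJ.dy
  dxx := hJ.dxx
  dyy := hJ.dyy

protected def rpow (J : PlaneJet) (s : ℝ) : PlaneJet :=
  ⟨fun x y => J.f x y ^ s, fun x y => J.fx x y * s * J.f x y ^ (s - 1),
   fun x y => J.fy x y * s * J.f x y ^ (s - 1),
   fun x y => J.fxx x y * s * J.f x y ^ (s - 1)
      + J.fx x y * s * (J.fx x y * (s - 1) * J.f x y ^ (s - 1 - 1)),
   fun x y => J.fyy x y * s * J.f x y ^ (s - 1)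
      + J.fy x y * s * (J.fy x y * (s - 1) * J.f x y ^ (s - 1 - 1))⟩

lemma Decays.rpow {J : PlaneJet} (hJ : Decays wOne wSq J) {c : ℝ} (hc : 0 < c)
    (h : ∀ x y, 0 < y → c ≤ J.f x y) (s : ℝ) : Decays wOne wSq (J.rpow s) where
  hx x y hy := (hJ.hx x y hy).rpow_const (Or.inl (hc.trans_le (h x y hy)).ne')
  hy x y hy := (hJ.hy x y hy).rpow_const (Or.inl (hc.trans_le (h x y hy)).ne')
  hxx x y hy := ((hJ.hxx x y hy).mul_const s).mul
    ((hJ.hx x y hy).rpow_const (Or.inl (hc.trans_le (h x y hy)).ne'))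
  hyy x y hy := ((hJ.hyy x y hy).mul_const s).mul
    ((hJ.hy x y hy).rpow_const (Or.inl (hc.trans_le (h x y hy)).ne'))
  cy y hy := ((hJ.cy y hy).mul_const s).mul
    ((hJ.cf y hy).rpow_const fun x => Or.inl (hc.trans_le (h x y hy)).ne')
  cxx y hy := (((hJ.cxx y hy).mul_const s).mul
    ((hJ.cf y hy).rpow_const fun x => Or.inl (hc.trans_le (h x y hy)).ne')).add
    (((hJ.cx y hy).mul_const s).mul (((hJ.cx y hy).mul_const _).mul
      ((hJ.cf y hy).rpow_const fun x => Or.inl (hc.trans_le (h x y hy)).ne')))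
  cyy y hy := (((hJ.cyy y hy).mul_const s).mul
    ((hJ.cf y hy).rpow_const fun x => Or.inl (hc.trans_le (h x y hy)).ne')).add
    (((hJ.cy y hy).mul_const s).mul (((hJ.cy y hy).mul_const _).mul
      ((hJ.cf y hy).rpow_const fun x => Or.inl (hc.trans_le (h x y hy)).ne')))
  df := hJ.df.rpow hc h s
  dx := (hJ.dx.mul (DecayBy.const s) (w := wSq) (fun _ => by simp [wOne])).mul
    (hJ.df.rpow hc h (s - 1)) (fun _ => by simp [wOne])
  dy := (hJ.dy.mul (DecayBy.const s) (w := wSq) (fun _ => by simp [wOne])).mul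
    (hJ.df.rpow hc h (s - 1)) (fun _ => by simp [wOne])
  dxx := ((hJ.dxx.mul (DecayBy.const s) (w := wSq) (fun _ => by simp [wOne])).mul
    (hJ.df.rpow hc h (s - 1)) (fun _ => by simp [wOne])).add
    ((hJ.dx.bdd_of_sq.bd_mul (DecayBy.const s)).bd_mul
      ((hJ.dx.mul (DecayBy.const (s - 1)) (w := wSq) (fun _ => by simp [wOne])).mul
        (hJ.df.rpow hc h (s - 1 - 1)) (fun _ => by simp [wOne])))
  dyy := ((hJ.dyy.mul (DecayBy.const s) (w := wSq) (fun _ => by simp [wOne])).mul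
    (hJ.df.rpow hc h (s - 1)) (fun _ => by simp [wOne])).add
    ((hJ.dy.bdd_of_sq.bd_mul (DecayBy.const s)).bd_mul
      ((hJ.dy.mul (DecayBy.const (s - 1)) (w := wSq) (fun _ => by simp [wOne])).mul
        (hJ.df.rpow hc h (s - 1 - 1)) (fun _ => by simp [wOne])))

lemma DecayBy.integrable {f : ℝ → ℝ → ℝ} (hf : DecayBy wSq f) {y : ℝ} (hy : 0 < y)
    (hc : Continuous fun x => f x y) : Integrable (fun x => f x y) := by
  obtain ⟨C, _, h⟩ := hf y hy
  exact (integrable_wSq.const_mul C).mono' hc.aestronglyMeasurable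
    (Eventually.of_forall fun x => h x y le_rfl)

lemma hasDerivAt_integral_of_decayBy {f f' : ℝ → ℝ → ℝ} (hf : DecayBy wSq f)
    (hf' : DecayBy wSq f') (hc : ∀ y, 0 < y → Continuous fun x => f x y)
    (hc' : ∀ y, 0 < y → Continuous fun x => f' x y)
    (hd : ∀ x y, 0 < y → HasDerivAt (fun t => f x t) (f' x y) y) {y : ℝ} (hy : 0 < y) :
    HasDerivAt (fun t => ∫ x, f x t) (∫ x, f' x y) y := by
  obtain ⟨C, _, h⟩ := hf' (y / 2) (by positivity)
  have hs : Set.Ioi (y / 2) ∈ 𝓝 y := Ioi_mem_nhds (by linarith)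
  refine (hasDerivAt_integral_of_dominated_loc_of_deriv_le (F := fun t x => f x t)
    (F' := fun t x => f' x t) (bound := fun x => C * wSq x) hs ?_ (DecayBy.integrable hf hy (hc y hy))
    (hc' y hy).aestronglyMeasurable ?_ (integrable_wSq.const_mul C) ?_).2
  · filter_upwards [hs] with t ht
    exact (hc t (by have : y / 2 < t := ht
                    linarith)).aestronglyMeasurable
  · exact Eventually.of_forall fun x t ht => h x t (le_of_lt ht)
  · exact Eventually.of_forall fun x t ht => hd x t (by have : y / 2 < t := ht
                                                        linarith)

/-- Data common to both forms of Green's formula for a decaying subharmonic jet. -/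
lemma Decays.green_aux {B : PlaneJet} (hB : Decays wSq wSq B)
    (hlap : ∀ x y, 0 < y → 0 ≤ B.lap x y) :
    (∀ y, 0 < y → HasDerivAt (fun t => ∫ x, B.f x t) (∫ x, B.fy x y) y) ∧
    (∀ y, 0 < y → HasDerivAt (fun t => ∫ x, B.fy x t) (∫ x, B.lap x y) y) ∧
    (∀ y, 0 < y → Integrable (fun x => B.lap x y)) ∧
    (∀ y, 0 < y → ∫ x, B.fy x y ≤ 0) := by
  have h1 : ∀ y, 0 < y → HasDerivAt (fun t => ∫ x, B.f x t) (∫ x, B.fy x y) y := fun y hy =>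
    hasDerivAt_integral_of_decayBy hB.df hB.dy hB.cf hB.cy hB.hy hy
  have hixx : ∀ y, 0 < y → Integrable (fun x => B.fxx x y) := fun y hy =>
    DecayBy.integrable hB.dxx hy (hB.cxx y hy)
  have hiyy : ∀ y, 0 < y → Integrable (fun x => B.fyy x y) := fun y hy =>
    DecayBy.integrable hB.dyy hy (hB.cyy y hy)
  have hxx0 : ∀ y, 0 < y → ∫ x, B.fxx x y = 0 := fun y hy =>
    integral_eq_zero_of_hasDerivAt_of_integrable (f := fun x => B.fx x y) (fun x => hB.hxx x y hy)
      (hixx y hy) (DecayBy.integrable hB.dx hy (hB.cx y hy))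
  have h2 : ∀ y, 0 < y → HasDerivAt (fun t => ∫ x, B.fy x t) (∫ x, B.lap x y) y := fun y hy => by
    have : ∫ x, B.lap x y = ∫ x, B.fyy x y := by
      unfold lap
      rw [integral_add (hixx y hy) (hiyy y hy), hxx0 y hy, zero_add]
    rw [this]
    exact hasDerivAt_integral_of_decayBy hB.dy hB.dyy hB.cy hB.cyy hB.hyy hy
  refine ⟨h1, h2, fun y hy => (hixx y hy).add (hiyy y hy), fun a ha => ?_⟩
  by_contra hcon
  push Not at hcon
  set φ := fun t => ∫ x, B.f x t
  set φ' := fun t => ∫ x, B.fy x t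
  have hmono : MonotoneOn φ' (Set.Ici a) := by
    refine monotoneOn_of_deriv_nonneg (convex_Ici a) ?_ ?_ ?_
    · exact fun y hy => (h2 y (ha.trans_le hy)).continuousAt.continuousWithinAt
    · intro y hy
      rw [interior_Ici] at hy
      exact (h2 y (ha.trans hy)).differentiableAt.differentiableWithinAt
    · intro y hy
      rw [interior_Ici] at hy
      rw [(h2 y (ha.trans hy)).deriv]
      exact integral_nonneg fun x => hlap x y (ha.trans hy)
  obtain ⟨C, hC, hb⟩ := hB.df a ha
  have hbd : ∀ y, a ≤ y → φ y ≤ C * ∫ x, wSq x := by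
    intro y hy
    rw [← integral_const_mul]
    exact integral_mono (DecayBy.integrable hB.df (ha.trans_le hy) (hB.cf y (ha.trans_le hy)))
      (integrable_wSq.const_mul C) fun x => (le_abs_self _).trans (hb x y hy)
  have hgrow : ∀ y, a ≤ y → φ' a * (y - a) ≤ φ y - φ a := by
    intro y hy
    refine (convex_Icc a y).mul_sub_le_image_sub_of_le_deriv ?_ ?_ ?_ a ⟨le_rfl, hy⟩ y ⟨hy, le_rfl⟩ hy
    · exact fun t ht => (h1 t (ha.trans_le ht.1)).continuousAt.continuousWithinAt
    · intro t ht
      rw [interior_Icc] at ht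
      exact (h1 t (ha.trans ht.1)).differentiableAt.differentiableWithinAt
    · intro t ht
      rw [interior_Icc] at ht
      rw [(h1 t (ha.trans ht.1)).deriv]
      exact hmono Set.self_mem_Ici ht.1.le ht.1.le
  have hD := hgrow (a + (|C * ∫ x, wSq x| + |φ a| + 1) / φ' a)
    (by have : 0 ≤ (|C * ∫ x, wSq x| + |φ a| + 1) / φ' a := div_nonneg (by positivity) hcon.le
        linarith)
  have hE := hbd (a + (|C * ∫ x, wSq x| + |φ a| + 1) / φ' a)
    (by have : 0 ≤ (|C * ∫ x, wSq x| + |φ a| + 1) / φ' a := div_nonneg (by positivity) hcon.le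
        linarith)
  rw [add_sub_cancel_left, mul_div_cancel₀ _ hcon.ne'] at hD
  have := le_abs_self (C * ∫ x, wSq x)
  have := neg_abs_le (φ a)
  linarith

lemma Decays.integral_nonneg_of_tendsto {B : PlaneJet} (hB : Decays wSq wSq B)
    (hlap : ∀ x y, 0 < y → 0 ≤ B.lap x y)
    (hlim : Tendsto (fun y => ∫ x, B.f x y) atTop (𝓝 0)) {a : ℝ} (ha : 0 < a) :
    0 ≤ ∫ x, B.f x a := by
  obtain ⟨h1, -, -, h4⟩ := hB.green_aux hlap
  have hanti : AntitoneOn (fun y => ∫ x, B.f x y) (Set.Ici a) := by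
    refine antitoneOn_of_deriv_nonpos (convex_Ici a) ?_ ?_ ?_
    · exact fun y hy => (h1 y (ha.trans_le hy)).continuousAt.continuousWithinAt
    · intro y hy
      rw [interior_Ici] at hy
      exact (h1 y (ha.trans hy)).differentiableAt.differentiableWithinAt
    · intro y hy
      rw [interior_Ici] at hy
      rw [(h1 y (ha.trans hy)).deriv]
      exact h4 y (ha.trans hy)
  refine le_of_tendsto hlim ?_
  filter_upwards [eventually_ge_atTop a] with y hy
  exact hanti Set.self_mem_Ici hy hy

lemma Decays.green {B : PlaneJet} (hB : Decays wSq wSq B)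
    (hlap : ∀ x y, 0 < y → 0 ≤ B.lap x y) (hpos : ∀ x y, 0 < y → 0 ≤ B.f x y)
    {a : ℝ} (ha : 0 < a) :
    ∫⁻ y in Set.Ioi a, ENNReal.ofReal (y - a) * ∫⁻ x, ENNReal.ofReal (B.lap x y)
      ≤ ENNReal.ofReal (∫ x, B.f x a) := by
  obtain ⟨h1, h2, h3, h4⟩ := hB.green_aux hlap
  set φ := fun t => ∫ x, B.f x t with hφ
  set φ' := fun t => ∫ x, B.fy x t with hφ'
  set ψ := fun t => φ t - (t - a) * φ' t with hψ
  have hψd : ∀ y, 0 < y → HasDerivAt ψ (-((y - a) * ∫ x, B.lap x y)) y := by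
    intro y hy
    have := (h1 y hy).sub (((hasDerivAt_id y).sub_const a).mul (h2 y hy))
    refine this.congr_deriv ?_
    simp only [hφ', id]
    ring
  have hlap0 : ∀ y, 0 < y → 0 ≤ ∫ x, B.lap x y := fun y hy =>
    integral_nonneg fun x => hlap x y hy
  have hψ0 : ∀ y, a ≤ y → 0 ≤ ψ y := by
    intro y hy
    have : 0 ≤ φ y := integral_nonneg fun x => hpos x y (ha.trans_le hy)
    have := h4 y (ha.trans_le hy)
    simp only [hψ, hφ']
    nlinarith
  have hanti : AntitoneOn ψ (Set.Ici a) := by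
    refine antitoneOn_of_deriv_nonpos (convex_Ici a) ?_ ?_ ?_
    · exact fun y hy => (hψd y (ha.trans_le hy)).continuousAt.continuousWithinAt
    · intro y hy
      rw [interior_Ici] at hy
      exact (hψd y (ha.trans hy)).differentiableAt.differentiableWithinAt
    · intro y hy
      rw [interior_Ici] at hy
      rw [(hψd y (ha.trans hy)).deriv]
      have := hlap0 y (ha.trans hy)
      have : a < y := hy
      nlinarith
  have hlim : ∃ m, Tendsto ψ atTop (𝓝 m) ∧ 0 ≤ m := by
    have hanti' : Antitone (fun y => ψ (max a y)) := fun x y hxy =>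
      hanti (Set.mem_Ici.2 (le_max_left _ _)) (Set.mem_Ici.2 (le_max_left _ _)) (max_le_max le_rfl hxy)
    have hb : BddBelow (Set.range fun y => ψ (max a y)) :=
      ⟨0, by rintro _ ⟨y, rfl⟩; exact hψ0 _ (le_max_left _ _)⟩
    refine ⟨_, (tendsto_atTop_ciInf hanti' hb).congr' ?_, le_ciInf fun y => hψ0 _ (le_max_left _ _)⟩
    filter_upwards [eventually_ge_atTop a] with y hy
    rw [max_eq_right hy]
  obtain ⟨m, hm, hm0⟩ := hlim
  have hneg : ∀ y ∈ Set.Ioi a, -((y - a) * ∫ x, B.lap x y) ≤ 0 := by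
    intro y hy
    have hy' : a < y := hy
    have := hlap0 y (ha.trans hy)
    nlinarith
  have hI := integrableOn_Ioi_deriv_of_nonpos' (fun y hy => hψd y (ha.trans_le hy)) hneg hm
  have hE := integral_Ioi_of_hasDerivAt_of_nonpos' (fun y hy => hψd y (ha.trans_le hy)) hneg hm
  have hstep : ∫⁻ y in Set.Ioi a, ENNReal.ofReal (y - a) * ∫⁻ x, ENNReal.ofReal (B.lap x y)
      = ∫⁻ y in Set.Ioi a, ENNReal.ofReal ((y - a) * ∫ x, B.lap x y) := by
    refine setLIntegral_congr_fun measurableSet_Ioi fun y hy => ?_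
    have hy' : a < y := hy
    rw [ENNReal.ofReal_mul (by linarith), ofReal_integral_eq_lintegral_ofReal (h3 y (ha.trans hy))
      (Eventually.of_forall fun x => hlap x y (ha.trans hy))]
  rw [hstep, ← ofReal_integral_eq_lintegral_ofReal (by simpa using hI.neg.integrable)]
  · apply ENNReal.ofReal_le_ofReal
    rw [integral_neg] at hE
    have : ψ a = φ a := by simp [hψ]
    have : φ a = ∫ x, B.f x a := rfl
    linarith
  · refine (ae_restrict_iff' measurableSet_Ioi).2 (Eventually.of_forall fun y hy => ?_)
    have hy' : a < y := hy
    have := hlap0 y (ha.trans hy)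
    exact mul_nonneg (by linarith) this

end PlaneJet

/-- Holomorphic functions on the upper half plane which are `O(1 / (1 + |z|))` on every smaller
half plane. -/
def UHPDecay (A : ℂ → ℂ) : Prop :=
  DifferentiableOn ℂ A {z | 0 < z.im} ∧
    ∀ y₀ : ℝ, 0 < y₀ → ∃ C : ℝ, 0 ≤ C ∧ ∀ z : ℂ, y₀ ≤ z.im → ‖A z‖ ≤ C / (1 + ‖z‖)

lemma isOpen_uhp : IsOpen {z : ℂ | 0 < z.im} := isOpen_lt continuous_const Complex.continuous_im

lemma UHPDecay.zero : UHPDecay (fun _ => 0) :=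
  ⟨differentiableOn_const 0, fun _ _ => ⟨0, le_rfl, fun _ _ => by simp⟩⟩

lemma UHPDecay.hasDerivAt {A : ℂ → ℂ} (hA : UHPDecay A) {z : ℂ} (hz : 0 < z.im) :
    HasDerivAt A (deriv A z) z :=
  (hA.1.differentiableAt (isOpen_uhp.mem_nhds hz)).hasDerivAt

lemma UHPDecay.deriv {A : ℂ → ℂ} (hA : UHPDecay A) : UHPDecay (deriv A) := by
  refine ⟨hA.1.deriv isOpen_uhp, fun y₀ h0 => ?_⟩
  obtain ⟨C, hC, hb⟩ := hA.2 (y₀ / 2) (by positivity)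
  refine ⟨C * (1 + y₀ / 2) / (y₀ / 2), by positivity, fun z hz => ?_⟩
  have him : ∀ w ∈ Metric.closedBall z (y₀ / 2), y₀ / 2 ≤ w.im := by
    intro w hw
    have h1 : |(w - z).im| ≤ y₀ / 2 :=
      (Complex.abs_im_le_norm _).trans (by simpa [dist_eq_norm] using hw)
    rw [Complex.sub_im, abs_le] at h1
    linarith [h1.1]
  have hd : DiffContOnCl ℂ A (Metric.ball z (y₀ / 2)) := by
    refine DifferentiableOn.diffContOnCl ?_
    refine hA.1.mono fun w hw => ?_
    have := him w (Metric.closure_ball_subset_closedBall hw)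
    exact lt_of_lt_of_le (by positivity) this
  have := Complex.norm_deriv_le_of_forall_mem_sphere_norm_le (C := C * (1 + y₀ / 2) / (1 + ‖z‖))
    (by positivity : 0 < y₀ / 2) hd ?_
  · refine this.trans (le_of_eq ?_)
    field_simp
  · intro w hw
    refine (hb w (him w (Metric.sphere_subset_closedBall hw))).trans ?_
    rw [div_le_div_iff₀ (by positivity) (by positivity), mul_assoc]
    refine mul_le_mul_of_nonneg_left ?_ hC
    have h2 : ‖w - z‖ = y₀ / 2 := by simpa [dist_eq_norm] using hw
    have h3 : ‖z‖ ≤ ‖w‖ + y₀ / 2 := by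
      have := norm_sub_norm_le z w
      rw [norm_sub_rev, h2] at this
      linarith
    nlinarith [norm_nonneg w]

lemma one_add_abs_re_le (z : ℂ) : 1 + |z.re| ≤ 1 + ‖z‖ := by
  linarith [Complex.abs_re_le_norm z]

/-- The point `x + i y`. -/
def upt (x y : ℝ) : ℂ := x + y * Complex.I

@[simp] lemma upt_im (x y : ℝ) : (upt x y).im = y := by simp [upt]
@[simp] lemma upt_re (x y : ℝ) : (upt x y).re = x := by simp [upt]

lemma hasDerivAt_upt_left (x y : ℝ) : HasDerivAt (fun t : ℝ => upt t y) 1 x := by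
  simpa [upt] using (Complex.ofRealCLM.hasDerivAt (x := x)).add_const ((y : ℂ) * Complex.I)

lemma hasDerivAt_upt_right (x y : ℝ) : HasDerivAt (fun t : ℝ => upt x t) Complex.I y := by
  simpa [upt] using ((Complex.ofRealCLM.hasDerivAt (x := y)).mul_const Complex.I).const_add (x : ℂ)

lemma UHPDecay.hasDerivAt_left {A : ℂ → ℂ} (hA : UHPDecay A) {x y : ℝ} (hy : 0 < y) :
    HasDerivAt (fun t : ℝ => A (upt t y)) (_root_.deriv A (upt x y)) x := by
  have h := (hA.hasDerivAt (z := upt x y) (by simpa using hy)).comp x (hasDerivAt_upt_left x y)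
  simpa [Function.comp_def] using h

lemma UHPDecay.hasDerivAt_right {A : ℂ → ℂ} (hA : UHPDecay A) {x y : ℝ} (hy : 0 < y) :
    HasDerivAt (fun t : ℝ => A (upt x t)) (Complex.I * _root_.deriv A (upt x y)) y := by
  have h := (hA.hasDerivAt (z := upt x y) (by simpa using hy)).comp y (hasDerivAt_upt_right x y)
  simpa [Function.comp_def, mul_comm] using h

lemma UHPDecay.continuous {A : ℂ → ℂ} (hA : UHPDecay A) {y : ℝ} (hy : 0 < y) :
    Continuous (fun t : ℝ => A (upt t y)) :=
  continuous_iff_continuousAt.2 fun _ => (hA.hasDerivAt_left hy).continuousAt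

lemma UHPDecay.decayBy_norm {A : ℂ → ℂ} (hA : UHPDecay A) :
    DecayBy wAbs (fun x y => ‖A (upt x y)‖) := by
  intro y₀ h0
  obtain ⟨C, hC, hb⟩ := hA.2 y₀ h0
  refine ⟨C, hC, fun x y hy => ?_⟩
  rw [abs_norm]
  refine (hb _ (by simpa using hy)).trans ?_
  rw [div_eq_mul_inv]
  refine mul_le_mul_of_nonneg_left (inv_anti₀ (by positivity) ?_) hC
  simpa using one_add_abs_re_le (upt x y)

lemma UHPDecay.decayBy_clm {A : ℂ → ℂ} (hA : UHPDecay A) (L : ℂ →L[ℝ] ℝ) :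
    DecayBy wAbs (fun x y => L (A (upt x y))) := by
  intro y₀ h0
  obtain ⟨C, hC, hb⟩ := hA.decayBy_norm y₀ h0
  refine ⟨‖L‖ * C, by positivity, fun x y hy => ?_⟩
  rw [← Real.norm_eq_abs, mul_assoc]
  refine (L.le_opNorm _).trans (mul_le_mul_of_nonneg_left ?_ (norm_nonneg _))
  simpa using hb x y hy

lemma UHPDecay.const_mul {A : ℂ → ℂ} (hA : UHPDecay A) (c : ℂ) : UHPDecay (fun z => c * A z) := by
  refine ⟨hA.1.const_mul c, fun y₀ h0 => ?_⟩
  obtain ⟨C, hC, hb⟩ := hA.2 y₀ h0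
  refine ⟨‖c‖ * C, by positivity, fun z hz => ?_⟩
  rw [norm_mul, mul_div_assoc]
  exact mul_le_mul_of_nonneg_left (hb z hz) (norm_nonneg _)

namespace PlaneJet

/-- The harmonic jet `L ∘ A`. -/
def harm (L : ℂ →L[ℝ] ℝ) (A : ℂ → ℂ) : PlaneJet :=
  ⟨fun x y => L (A (upt x y)), fun x y => L (deriv A (upt x y)),
   fun x y => L (Complex.I * deriv A (upt x y)),
   fun x y => L (deriv (deriv A) (upt x y)),
   fun x y => L (Complex.I * (Complex.I * deriv (deriv A) (upt x y)))⟩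

lemma decays_harm (L : ℂ →L[ℝ] ℝ) {A : ℂ → ℂ} (hA : UHPDecay A) :
    Decays wAbs wAbs (harm L A) where
  hx x y hy := (L.hasFDerivAt.comp_hasDerivAt x (hA.hasDerivAt_left hy))
  hy x y hy := (L.hasFDerivAt.comp_hasDerivAt y (hA.hasDerivAt_right hy))
  hxx x y hy := (L.hasFDerivAt.comp_hasDerivAt x (hA.deriv.hasDerivAt_left hy))
  hyy x y hy := (L.hasFDerivAt.comp_hasDerivAt y
    ((hA.deriv.hasDerivAt_right hy).const_mul Complex.I))
  cy y hy := L.continuous.comp (continuous_const.mul (hA.deriv.continuous hy))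
  cxx y hy := L.continuous.comp (hA.deriv.deriv.continuous hy)
  cyy y hy := L.continuous.comp (continuous_const.mul (continuous_const.mul
    (hA.deriv.deriv.continuous hy)))
  df := hA.decayBy_clm L
  dx := hA.deriv.decayBy_clm L
  dy := (hA.deriv.const_mul Complex.I).decayBy_clm L
  dxx := hA.deriv.deriv.decayBy_clm L
  dyy := ((hA.deriv.deriv.const_mul Complex.I).const_mul Complex.I).decayBy_clm L

lemma lap_harm (L : ℂ →L[ℝ] ℝ) (A : ℂ → ℂ) (x y : ℝ) : (harm L A).lap x y = 0 := by
  simp only [lap, harm, ← mul_assoc, Complex.I_mul_I]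
  simp

variable {ι : Type*} [Fintype ι]

/-- Real and imaginary part of `A₁ + conj A₂`. -/
def part (A₁ A₂ : ι → ℂ → ℂ) (k : ι × Bool) : PlaneJet :=
  if k.2 then (harm Complex.reCLM (A₁ k.1)).add (harm Complex.reCLM (A₂ k.1))
  else (harm Complex.imCLM (A₁ k.1)).add (harm (-Complex.imCLM) (A₂ k.1))

/-- The jet of `∑ i, |A₁ i + conj (A₂ i)|²`. -/
def normSq (A₁ A₂ : ι → ℂ → ℂ) : PlaneJet :=
  PlaneJet.sum fun k : ι × Bool => (part A₁ A₂ k).mul (part A₁ A₂ k)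

lemma decays_part {A₁ A₂ : ι → ℂ → ℂ} (h₁ : ∀ i, UHPDecay (A₁ i)) (h₂ : ∀ i, UHPDecay (A₂ i))
    (k : ι × Bool) : Decays wAbs wAbs (part A₁ A₂ k) := by
  unfold part
  split_ifs
  · exact (decays_harm _ (h₁ _)).add (decays_harm _ (h₂ _))
  · exact (decays_harm _ (h₁ _)).add (decays_harm _ (h₂ _))

lemma lap_part (A₁ A₂ : ι → ℂ → ℂ) (k : ι × Bool) (x y : ℝ) : (part A₁ A₂ k).lap x y = 0 := by
  have h : ∀ J K : PlaneJet, (J.add K).lap x y = J.lap x y + K.lap x y := by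
    intro J K
    simp only [lap, PlaneJet.add]
    ring
  unfold part
  split_ifs <;> simp [h, lap_harm]

lemma decays_normSq {A₁ A₂ : ι → ℂ → ℂ} (h₁ : ∀ i, UHPDecay (A₁ i)) (h₂ : ∀ i, UHPDecay (A₂ i)) :
    Decays wSq wSq (normSq A₁ A₂) :=
  Decays.sum (fun x => (wSq_pos x).le) (fun x => (wSq_pos x).le) fun k =>
    (decays_part h₁ h₂ k).mul_abs (decays_part h₁ h₂ k)

lemma normSq_f (A₁ A₂ : ι → ℂ → ℂ) (x y : ℝ) :
    (normSq A₁ A₂).f x y = ∑ i, ‖A₁ i (upt x y) + starRingEnd ℂ (A₂ i (upt x y))‖ ^ 2 := by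
  simp only [normSq, PlaneJet.sum, PlaneJet.mul, Fintype.sum_prod_type, Fintype.sum_bool]
  refine Finset.sum_congr rfl fun i _ => ?_
  rw [← Complex.normSq_eq_norm_sq, Complex.normSq_apply]
  simp [part, PlaneJet.add, harm]

lemma normSq_f_nonneg (A₁ A₂ : ι → ℂ → ℂ) (x y : ℝ) : 0 ≤ (normSq A₁ A₂).f x y := by
  rw [normSq_f]; positivity

lemma lap_normSq (A₁ A₂ : ι → ℂ → ℂ) (x y : ℝ) :
    (normSq A₁ A₂).lap x y =
      4 * ∑ i, (‖deriv (A₁ i) (upt x y)‖ ^ 2 + ‖deriv (A₂ i) (upt x y)‖ ^ 2) := by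
  have h : (normSq A₁ A₂).lap x y = ∑ k, 2 * (part A₁ A₂ k).gradSq x y := by
    simp only [lap, normSq, PlaneJet.sum, ← Finset.sum_add_distrib]
    refine Finset.sum_congr rfl fun k _ => ?_
    have := lap_part A₁ A₂ k x y
    simp only [lap] at this
    simp only [PlaneJet.mul, gradSq]
    linear_combination (2 * (part A₁ A₂ k).f x y) * this
  rw [h, Fintype.sum_prod_type, Finset.mul_sum]
  refine Finset.sum_congr rfl fun i _ => ?_
  rw [Fintype.sum_bool]
  simp only [← Complex.normSq_eq_norm_sq, Complex.normSq_apply]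
  simp [part, PlaneJet.add, harm, gradSq]
  ring

lemma gradSq_normSq_le (A₁ A₂ : ι → ℂ → ℂ) (x y : ℝ) :
    (normSq A₁ A₂).gradSq x y ≤ 2 * (normSq A₁ A₂).f x y * (normSq A₁ A₂).lap x y := by
  have h : (normSq A₁ A₂).lap x y = ∑ k, 2 * (part A₁ A₂ k).gradSq x y := by
    simp only [lap, normSq, PlaneJet.sum, ← Finset.sum_add_distrib]
    refine Finset.sum_congr rfl fun k _ => ?_
    have := lap_part A₁ A₂ k x y
    simp only [lap] at this
    simp only [PlaneJet.mul, gradSq]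
    linear_combination (2 * (part A₁ A₂ k).f x y) * this
  rw [h]
  have h1 := Finset.sum_mul_sq_le_sq_mul_sq Finset.univ (fun k => (part A₁ A₂ k).f x y)
    (fun k => (part A₁ A₂ k).fx x y)
  have h2 := Finset.sum_mul_sq_le_sq_mul_sq Finset.univ (fun k => (part A₁ A₂ k).f x y)
    (fun k => (part A₁ A₂ k).fy x y)
  have e1 : (normSq A₁ A₂).fx x y = 2 * ∑ k, (part A₁ A₂ k).f x y * (part A₁ A₂ k).fx x y := by
    simp only [normSq, PlaneJet.sum, PlaneJet.mul, Finset.mul_sum]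
    exact Finset.sum_congr rfl fun k _ => by ring
  have e2 : (normSq A₁ A₂).fy x y = 2 * ∑ k, (part A₁ A₂ k).f x y * (part A₁ A₂ k).fy x y := by
    simp only [normSq, PlaneJet.sum, PlaneJet.mul, Finset.mul_sum]
    exact Finset.sum_congr rfl fun k _ => by ring
  have e3 : (normSq A₁ A₂).f x y = ∑ k, (part A₁ A₂ k).f x y ^ 2 := by
    simp only [normSq, PlaneJet.sum, PlaneJet.mul, sq]
  have e4 : ∑ k, 2 * (part A₁ A₂ k).gradSq x y =
      2 * (∑ k, (part A₁ A₂ k).fx x y ^ 2 + ∑ k, (part A₁ A₂ k).fy x y ^ 2) := by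
    rw [← Finset.mul_sum, ← Finset.sum_add_distrib]; rfl
  rw [e4, e3, gradSq, e1, e2]
  nlinarith

lemma gradSq_normSq_le_of_analytic (A : ι → ℂ → ℂ) (x y : ℝ) :
    (normSq A fun _ _ => 0).gradSq x y ≤
      (normSq A fun _ _ => 0).f x y * (normSq A fun _ _ => 0).lap x y := by
  rw [lap_normSq, normSq_f]
  set c : ℂ := ∑ i, starRingEnd ℂ (A i (upt x y)) * deriv (A i) (upt x y) with hc
  have e1 : (normSq A fun _ _ => 0).fx x y = 2 * c.re := by
    simp only [normSq, PlaneJet.sum, PlaneJet.mul, Fintype.sum_prod_type, Fintype.sum_bool, hc,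
      Complex.re_sum, Finset.mul_sum]
    refine Finset.sum_congr rfl fun i _ => ?_
    simp [part, PlaneJet.add, harm]
    ring
  have e2 : (normSq A fun _ _ => 0).fy x y = -2 * c.im := by
    simp only [normSq, PlaneJet.sum, PlaneJet.mul, Fintype.sum_prod_type, Fintype.sum_bool, hc,
      Complex.im_sum, Finset.mul_sum]
    refine Finset.sum_congr rfl fun i _ => ?_
    simp [part, PlaneJet.add, harm]
    ring
  have e3 : ‖c‖ ^ 2 = c.re ^ 2 + c.im ^ 2 := by
    rw [← Complex.normSq_eq_norm_sq, Complex.normSq_apply]; ring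
  have e4 : ‖c‖ ≤ ∑ i, ‖A i (upt x y)‖ * ‖deriv (A i) (upt x y)‖ := by
    refine (norm_sum_le _ _).trans (le_of_eq ?_)
    simp
  have e5 := Finset.sum_mul_sq_le_sq_mul_sq Finset.univ (fun i => ‖A i (upt x y)‖)
    (fun i => ‖deriv (A i) (upt x y)‖)
  have e6 : ‖c‖ ^ 2 ≤ (∑ i, ‖A i (upt x y)‖ * ‖deriv (A i) (upt x y)‖) ^ 2 :=
    pow_le_pow_left₀ (norm_nonneg _) e4 2
  rw [gradSq, e1, e2]
  simp
  nlinarith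

end PlaneJet

namespace PlaneJet

lemma lap_add (J K : PlaneJet) (x y : ℝ) : (J.add K).lap x y = J.lap x y + K.lap x y := by
  simp only [lap, PlaneJet.add]; ring

lemma lap_const (c x y : ℝ) : (PlaneJet.const c).lap x y = 0 := by
  simp [lap, PlaneJet.const]

lemma lap_const_mul (c : ℝ) (J : PlaneJet) (x y : ℝ) :
    ((PlaneJet.const c).mul J).lap x y = c * J.lap x y := by
  simp only [lap, PlaneJet.mul, PlaneJet.const]; ring

lemma gradSq_nonneg (J : PlaneJet) (x y : ℝ) : 0 ≤ J.gradSq x y := by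
  unfold gradSq; positivity

lemma gradSq_add_const (J : PlaneJet) (c x y : ℝ) :
    (J.add (PlaneJet.const c)).gradSq x y = J.gradSq x y := by
  simp [gradSq, PlaneJet.add, PlaneJet.const]

lemma lap_rpow (J : PlaneJet) (s x y : ℝ) : (J.rpow s).lap x y =
    s * J.f x y ^ (s - 1) * J.lap x y + s * (s - 1) * J.f x y ^ (s - 1 - 1) * J.gradSq x y := by
  simp only [lap, PlaneJet.rpow, gradSq]; ring

lemma gradSq_rpow (J : PlaneJet) (s x y : ℝ) : (J.rpow s).gradSq x y =
    s ^ 2 * (J.f x y ^ (s - 1)) ^ 2 * J.gradSq x y := by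
  simp only [PlaneJet.rpow, gradSq]; ring

lemma gradSq_add_le (J K : PlaneJet) (x y : ℝ) :
    (J.add K).gradSq x y ≤ 2 * J.gradSq x y + 2 * K.gradSq x y := by
  simp only [PlaneJet.add, gradSq]
  nlinarith [sq_nonneg (J.fx x y - K.fx x y), sq_nonneg (J.fy x y - K.fy x y)]

lemma lap_rpow_ge_of_le_one {J : PlaneJet} {x y s : ℝ} (hf : 0 < J.f x y)
    (hg : J.gradSq x y ≤ J.f x y * J.lap x y) (hs0 : 0 ≤ s) (hs1 : s ≤ 1) :
    s ^ 2 * (J.f x y ^ (s - 1) * J.lap x y) ≤ (J.rpow s).lap x y ∧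
      (J.rpow s).gradSq x y ≤ J.f x y ^ s * (J.rpow s).lap x y := by
  set t := J.f x y ^ (s - 1 - 1) with ht
  have ht0 : 0 < t := by positivity
  have e1 : J.f x y ^ (s - 1) = J.f x y * t := by
    rw [ht, Real.rpow_sub_one hf.ne' (s - 1)]; field_simp
  have e2 : J.f x y ^ s = J.f x y * (J.f x y * t) := by
    rw [← e1, Real.rpow_sub_one hf.ne' s]; field_simp
  have key : s ^ 2 * (J.f x y ^ (s - 1) * J.lap x y) ≤ (J.rpow s).lap x y := by
    rw [lap_rpow, e1, ← ht]
    have h1 : s * (1 - s) * t * J.gradSq x y ≤ s * (1 - s) * t * (J.f x y * J.lap x y) :=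
      mul_le_mul_of_nonneg_left hg (by have : 0 ≤ 1 - s := by linarith
                                       positivity)
    nlinarith
  refine ⟨key, ?_⟩
  rw [gradSq_rpow]
  calc s ^ 2 * (J.f x y ^ (s - 1)) ^ 2 * J.gradSq x y
      ≤ s ^ 2 * (J.f x y ^ (s - 1)) ^ 2 * (J.f x y * J.lap x y) :=
        mul_le_mul_of_nonneg_left hg (by positivity)
    _ = J.f x y ^ s * (s ^ 2 * (J.f x y ^ (s - 1) * J.lap x y)) := by rw [e1, e2]; ring
    _ ≤ _ := mul_le_mul_of_nonneg_left key (by positivity)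

lemma lap_rpow_nonneg_of_one_le {J : PlaneJet} {x y s : ℝ} (hf : 0 < J.f x y)
    (hg : J.gradSq x y ≤ 2 * J.f x y * J.lap x y) (hs1 : 1 ≤ s) :
    0 ≤ (J.rpow s).lap x y ∧
      (J.rpow s).gradSq x y ≤ 2 * J.f x y ^ s * (J.rpow s).lap x y := by
  set t := J.f x y ^ (s - 1 - 1) with ht
  have ht0 : 0 < t := by positivity
  have e1 : J.f x y ^ (s - 1) = J.f x y * t := by
    rw [ht, Real.rpow_sub_one hf.ne' (s - 1)]; field_simp
  have e2 : J.f x y ^ s = J.f x y * (J.f x y * t) := by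
    rw [← e1, Real.rpow_sub_one hf.ne' s]; field_simp
  have hG := J.gradSq_nonneg x y
  have h1 : s * t * J.gradSq x y ≤ s * t * (2 * J.f x y * J.lap x y) :=
    mul_le_mul_of_nonneg_left hg (by positivity)
  have h2 : 0 ≤ s * (s - 1) * t * J.gradSq x y := by
    have : 0 ≤ s - 1 := by linarith
    positivity
  have h3 : 0 ≤ s * t * J.gradSq x y := by positivity
  have key : s ^ 2 * t * J.gradSq x y ≤ 2 * (J.rpow s).lap x y := by
    rw [lap_rpow, e1, ← ht]
    nlinarith
  refine ⟨by have : 0 ≤ s ^ 2 * t * J.gradSq x y := by positivity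
             linarith, ?_⟩
  rw [gradSq_rpow]
  calc s ^ 2 * (J.f x y ^ (s - 1)) ^ 2 * J.gradSq x y
      = J.f x y ^ s * (s ^ 2 * t * J.gradSq x y) := by rw [e1, e2]; ring
    _ ≤ J.f x y ^ s * (2 * (J.rpow s).lap x y) := mul_le_mul_of_nonneg_left key (by positivity)
    _ = _ := by ring

lemma lap_mul_rpow_ge {V U : PlaneJet} {x y γ : ℝ} (hγ0 : 0 ≤ γ) (hγ1 : γ ≤ 1)
    (hv : 0 ≤ V.f x y) (hu : 0 < U.f x y) (hlv : 0 ≤ V.lap x y) (hlu : 0 ≤ U.lap x y)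
    (hgv : V.gradSq x y ≤ 2 * V.f x y * V.lap x y) (hgu : U.gradSq x y ≤ 4 * U.f x y * U.lap x y)
    (hvu : V.f x y * U.f x y ^ (γ - 1) ≤ 1) :
    U.f x y ^ γ * V.lap x y / 2 - 17 * U.lap x y ≤ (V.mul (U.rpow γ)).lap x y := by
  set t := U.f x y ^ (γ - 1 - 1) with ht
  have ht0 : 0 < t := by positivity
  have e1 : U.f x y ^ (γ - 1) = U.f x y * t := by
    rw [ht, Real.rpow_sub_one hu.ne' (γ - 1)]; field_simp
  have e2 : U.f x y ^ γ = U.f x y * (U.f x y * t) := by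
    rw [← e1, Real.rpow_sub_one hu.ne' γ]; field_simp
  have hexp : (V.mul (U.rpow γ)).lap x y = U.f x y ^ γ * V.lap x y
      + 2 * γ * U.f x y ^ (γ - 1) * (V.fx x y * U.fx x y + V.fy x y * U.fy x y)
      + V.f x y * (γ * U.f x y ^ (γ - 1) * U.lap x y
        + γ * (γ - 1) * t * U.gradSq x y) := by
    rw [ht]
    simp only [lap, PlaneJet.mul, PlaneJet.rpow, gradSq]; ring
  rw [hexp]
  rw [e1] at hvu ⊢
  rw [e2]
  set u := U.f x y
  set v := V.f x y
  set Lu := U.lap x y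
  set Lv := V.lap x y
  set D := V.fx x y * U.fx x y + V.fy x y * U.fy x y with hD
  have hDsq : D ^ 2 ≤ V.gradSq x y * U.gradSq x y := by
    simp only [gradSq, hD]
    nlinarith [sq_nonneg (V.fx x y * U.fy x y - V.fy x y * U.fx x y)]
  have hDsq2 : D ^ 2 ≤ (2 * v * Lv) * (4 * u * Lu) :=
    hDsq.trans (mul_le_mul hgv hgu (U.gradSq_nonneg x y) ((V.gradSq_nonneg x y).trans hgv))
  have hDabs : 2 * |D| ≤ u * Lv / 2 + 16 * v * Lu := by
    have h0 : 0 ≤ u * Lv / 2 + 16 * v * Lu := by positivity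
    refine abs_le_of_sq_le_sq' ?_ h0 |>.2
    rw [mul_pow, sq_abs]
    nlinarith [sq_nonneg (u * Lv / 2 - 16 * v * Lu)]
  have h2 : -(u * t * (u * Lv / 2 + 16 * v * Lu)) ≤ 2 * γ * (u * t) * D := by
    have h3 : -|D| ≤ D := neg_abs_le D
    have h4 : γ * (u * t) * (2 * |D|) ≤ 1 * (u * t) * (u * Lv / 2 + 16 * v * Lu) :=
      mul_le_mul (mul_le_mul_of_nonneg_right hγ1 (by positivity)) hDabs (by positivity)
        (by positivity)
    have h5 : 2 * γ * (u * t) * (-|D|) ≤ 2 * γ * (u * t) * D :=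
      mul_le_mul_of_nonneg_left h3 (by positivity)
    linarith
  have h6 : -(v * (u * t) * Lu) ≤ v * (γ * (γ - 1) * t * U.gradSq x y) := by
    have h7 : γ * (1 - γ) ≤ 1 / 4 := by nlinarith [sq_nonneg (γ - 1 / 2)]
    have h8 : γ * (1 - γ) * (v * t * U.gradSq x y) ≤ 1 / 4 * (v * t * (4 * u * Lu)) :=
      mul_le_mul h7 (mul_le_mul_of_nonneg_left hgu (by positivity))
        (mul_nonneg (by positivity) (U.gradSq_nonneg x y)) (by norm_num)
    linarith
  have h9 : v * (u * t) * Lu ≤ 1 * Lu := mul_le_mul_of_nonneg_right hvu hlu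
  have h10 : 0 ≤ v * (γ * (u * t) * Lu) := by positivity
  nlinarith

lemma Decays.upgrade {J : PlaneJet} (h : Decays wOne wSq J) (hf : DecayBy wSq J.f) :
    Decays wSq wSq J where
  toIsJet := h.toIsJet
  df := hf
  dx := h.dx
  dy := h.dy
  dxx := h.dxx
  dyy := h.dyy

end PlaneJet

lemma exists_abs_rpow_sub_rpow_le {e : ℝ} (he : 0 < e) (M s : ℝ) :
    ∃ K : ℝ, 0 ≤ K ∧ ∀ t, e ≤ t → t ≤ M → |t ^ s - e ^ s| ≤ K * (t - e) := by
  have hc : ContinuousOn (fun t : ℝ => s * t ^ (s - 1)) (Set.Icc e M) := by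
    refine continuousOn_const.mul (continuousOn_id.rpow_const fun t ht => Or.inl ?_)
    exact (he.trans_le ht.1).ne'
  obtain ⟨K, hK⟩ := isCompact_Icc.exists_bound_of_continuousOn hc
  refine ⟨max K 0, le_max_right _ _, fun t h1 h2 => ?_⟩
  have := (convex_Icc e M).norm_image_sub_le_of_norm_hasDerivWithin_le (f := fun t : ℝ => t ^ s)
    (f' := fun t => s * t ^ (s - 1)) (C := max K 0) (x := e) (y := t)
    (fun z hz => (Real.hasDerivAt_rpow_const (Or.inl (he.trans_le hz.1).ne')).hasDerivWithinAt)
    (fun z hz => (hK z hz).trans (le_max_left _ _)) ⟨le_rfl, h1.trans h2⟩ ⟨h1, h2⟩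
  rwa [Real.norm_eq_abs, Real.norm_eq_abs, abs_of_nonneg (sub_nonneg.2 h1)] at this

lemma DecayBy.add_const_rpow_sub {f : ℝ → ℝ → ℝ} (hf : DecayBy wSq f)
    (h0 : ∀ x y, 0 < y → 0 ≤ f x y) {e : ℝ} (he : 0 < e) (s : ℝ) :
    DecayBy wSq (fun x y => (f x y + e) ^ s - e ^ s) := by
  intro y₀ hy₀
  obtain ⟨C, hC, hb⟩ := hf y₀ hy₀
  obtain ⟨K, hK, hb'⟩ := exists_abs_rpow_sub_rpow_le he (C + e) s
  refine ⟨K * C, by positivity, fun x y hy => ?_⟩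
  have h1 := (le_abs_self _).trans (hb x y hy)
  have h2 : C * wSq x ≤ C := mul_le_of_le_one_right hC (wSq_le_one x)
  refine (hb' _ (by linarith [h0 x y (hy₀.trans_le hy)]) (by linarith)).trans ?_
  rw [add_sub_cancel_right, mul_assoc]
  exact mul_le_mul_of_nonneg_left h1 hK

lemma lintegral_le_of_tendsto {α : Type*} [MeasurableSpace α] {μ : Measure α}
    {f : ℕ → α → ℝ≥0∞} {g : α → ℝ≥0∞} {C : ℝ≥0∞} (hm : ∀ n, AEMeasurable (f n) μ)
    (hb : ∀ n, ∫⁻ x, f n x ∂μ ≤ C) (hl : ∀ x, Tendsto (fun n => f n x) atTop (𝓝 (g x))) :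
    ∫⁻ x, g x ∂μ ≤ C := by
  calc ∫⁻ x, g x ∂μ = ∫⁻ x, liminf (fun n => f n x) atTop ∂μ :=
        lintegral_congr fun x => (hl x).liminf_eq.symm
    _ ≤ liminf (fun n => ∫⁻ x, f n x ∂μ) atTop := lintegral_liminf_le' hm
    _ ≤ C := by
        refine liminf_le_of_frequently_le' (Frequently.of_forall fun n => hb n)

def epsSeq (n : ℕ) : ℝ := 1 / ((n : ℝ) + 1)
lemma epsSeq_pos (n : ℕ) : 0 < epsSeq n := by unfold epsSeq; positivity
lemma epsSeq_le_one (n : ℕ) : epsSeq n ≤ 1 := by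
  unfold epsSeq
  rw [div_le_one (by positivity)]
  linarith [Nat.cast_nonneg (α := ℝ) n]
lemma tendsto_epsSeq : Tendsto epsSeq atTop (𝓝 0) := tendsto_one_div_add_atTop_nhds_zero_nat

lemma tendsto_add_epsSeq (a : ℝ) : Tendsto (fun n => a + epsSeq n) atTop (𝓝 a) := by
  simpa using tendsto_epsSeq.const_add a

lemma tendsto_add_epsSeq_rpow (a : ℝ) {s : ℝ} (hs : 0 ≤ s) :
    Tendsto (fun n => (a + epsSeq n) ^ s) atTop (𝓝 (a ^ s)) :=
  (tendsto_add_epsSeq a).rpow_const (Or.inr hs)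

lemma tendsto_epsSeq_rpow {s : ℝ} (hs : 0 < s) :
    Tendsto (fun n => (epsSeq n) ^ s) atTop (𝓝 0) := by
  have := tendsto_epsSeq.rpow_const (p := s) (Or.inr hs.le)
  rwa [Real.zero_rpow hs.ne'] at this

section Riesz

variable {ι : Type*} [Fintype ι]

lemma UHPDecay.tendsto_zero {A : ℂ → ℂ} (hA : UHPDecay A) (x : ℝ) :
    Tendsto (fun y : ℝ => A (upt x y)) atTop (𝓝 0) := by
  obtain ⟨C, hC, hb⟩ := hA.2 1 one_pos
  rw [tendsto_zero_iff_norm_tendsto_zero]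
  have h1 : Tendsto (fun y : ℝ => C / (1 + y)) atTop (𝓝 0) :=
    tendsto_const_nhds.div_atTop (tendsto_atTop_add_const_left _ _ tendsto_id)
  refine squeeze_zero' (Eventually.of_forall fun _ => norm_nonneg _) ?_ h1
  filter_upwards [eventually_ge_atTop 1] with y hy
  refine (hb _ (by simpa using hy)).trans ?_
  gcongr
  have := Complex.im_le_norm (upt x y)
  simpa using this

open PlaneJet

lemma normSq_tendsto_zero {A₁ A₂ : ι → ℂ → ℂ} (h₁ : ∀ i, UHPDecay (A₁ i))
    (h₂ : ∀ i, UHPDecay (A₂ i)) (x : ℝ) :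
    Tendsto (fun y => (normSq A₁ A₂).f x y) atTop (𝓝 0) := by
  simp only [normSq_f]
  have : Tendsto (fun y => ∑ i, ‖A₁ i (upt x y) + starRingEnd ℂ (A₂ i (upt x y))‖ ^ 2) atTop
      (𝓝 (∑ i : ι, ‖(0 : ℂ) + starRingEnd ℂ 0‖ ^ 2)) := by
    refine tendsto_finsetSum _ fun i _ => Tendsto.pow (Tendsto.norm ?_) 2
    exact ((h₁ i).tendsto_zero x).add
      ((Complex.continuous_conj.tendsto _).comp ((h₂ i).tendsto_zero x))
  simpa using this

/-- The M. Riesz inequality on a horizontal line, with constant `2 / (p - 1)`. -/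
lemma riesz_upper {A₁ A₂ : ι → ℂ → ℂ} (h₁ : ∀ i, UHPDecay (A₁ i)) (h₂ : ∀ i, UHPDecay (A₂ i))
    {p : ℝ} (hp1 : 1 < p) (hp2 : p < 2) {y : ℝ} (hy : 0 < y) :
    ∫⁻ x, ENNReal.ofReal ((∑ i, (‖A₁ i (upt x y)‖ ^ 2 + ‖A₂ i (upt x y)‖ ^ 2)) ^ (p / 2)) ≤
      ENNReal.ofReal (2 / (p - 1)) * ∫⁻ x, ENNReal.ofReal
        ((∑ i, ‖A₁ i (upt x y) + starRingEnd ℂ (A₂ i (upt x y))‖ ^ 2) ^ (p / 2)) := by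
  set AA : ι ⊕ ι → ℂ → ℂ := Sum.elim A₁ A₂ with hAA
  have hAAd : ∀ k, UHPDecay (AA k) := by rintro (i | i) <;> simp [hAA, h₁, h₂]
  set a₀ := normSq AA (fun _ _ => 0) with ha₀
  set g₀ := normSq A₁ A₂ with hg₀
  have hda : Decays wSq wSq a₀ := decays_normSq hAAd fun _ => UHPDecay.zero
  have hdg : Decays wSq wSq g₀ := decays_normSq h₁ h₂
  have haf : ∀ x y, a₀.f x y = ∑ i, (‖A₁ i (upt x y)‖ ^ 2 + ‖A₂ i (upt x y)‖ ^ 2) := by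
    intro x y
    rw [ha₀, normSq_f]
    simp [hAA, Finset.sum_add_distrib]
  have hlap : ∀ x y, a₀.lap x y = g₀.lap x y := by
    intro x y
    rw [ha₀, hg₀, lap_normSq, lap_normSq]
    simp [hAA, Finset.sum_add_distrib]
  have hle : ∀ x y, g₀.f x y ≤ 2 * a₀.f x y := by
    intro x y
    rw [haf, hg₀, normSq_f, Finset.mul_sum]
    refine Finset.sum_le_sum fun i _ => ?_
    have h := norm_add_le (A₁ i (upt x y)) (starRingEnd ℂ (A₂ i (upt x y)))
    rw [Complex.norm_conj] at h
    have := pow_le_pow_left₀ (norm_nonneg _) h 2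
    nlinarith [sq_nonneg (‖A₁ i (upt x y)‖ - ‖A₂ i (upt x y)‖)]
  have hP0 : 0 < p / 2 := by linarith
  have hP1 : p / 2 < 1 := by linarith
  set K := 2 / (p - 1) with hK
  have hK0 : 0 < K := div_pos two_pos (by linarith)
  have ha0 : ∀ x y, 0 ≤ a₀.f x y := fun x y => normSq_f_nonneg _ _ x y
  have hg0 : ∀ x y, 0 ≤ g₀.f x y := fun x y => normSq_f_nonneg _ _ x y
  have main : ∀ e : ℝ, 0 < e →
      ∫⁻ x, ENNReal.ofReal ((a₀.f x y + e) ^ (p / 2) - e ^ (p / 2)) ≤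
      ENNReal.ofReal K * ∫⁻ x, ENNReal.ofReal (g₀.f x y ^ (p / 2)) := by
    intro e he
    set a := a₀.add (PlaneJet.const e)
    set g := g₀.add (PlaneJet.const e)
    have had : Decays wOne wSq a := hda.one_of_sq.add (decays_const e)
    have hgd : Decays wOne wSq g := hdg.one_of_sq.add (decays_const e)
    have hae : ∀ x y, e ≤ a.f x y := fun x y => by
      have := ha0 x y
      simp only [a, PlaneJet.add, PlaneJet.const]; linarith
    have hge : ∀ x y, e ≤ g.f x y := fun x y => by
      have := hg0 x y
      simp only [g, PlaneJet.add, PlaneJet.const]; linarith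
    set B := (((PlaneJet.const K).mul (g.rpow (p / 2))).add
      ((PlaneJet.const (-1)).mul (a.rpow (p / 2)))).add
        (PlaneJet.const (-(K * e ^ (p / 2)) + e ^ (p / 2))) with hB
    have hBf : ∀ x y, B.f x y = K * ((g₀.f x y + e) ^ (p / 2) - e ^ (p / 2))
        - ((a₀.f x y + e) ^ (p / 2) - e ^ (p / 2)) := by
      intro x y
      simp only [hB, PlaneJet.add, PlaneJet.mul, PlaneJet.const, PlaneJet.rpow, a, g]
      ring
    have hdga := hdg.df.add_const_rpow_sub (fun x y _ => hg0 x y) he (p / 2)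
    have hdaa := hda.df.add_const_rpow_sub (fun x y _ => ha0 x y) he (p / 2)
    have hBd : Decays wSq wSq B := by
      refine Decays.upgrade ?_ ?_
      · exact (((decays_const K).mul_one_sq (hgd.rpow he (fun x y _ => hge x y) _)).add
          ((decays_const (-1)).mul_one_sq (had.rpow he (fun x y _ => hae x y) _))).add
            (decays_const _)
      · have := ((DecayBy.const K).bd_mul hdga).add hdaa.neg
        refine fun y₀ h0 => ?_
        obtain ⟨C, hC, h⟩ := this y₀ h0
        refine ⟨C, hC, fun x y hy => ?_⟩
        rw [hBf]
        simpa [sub_eq_add_neg] using h x y hy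
    have hBlap : ∀ x y, 0 < y → 0 ≤ B.lap x y := by
      intro x y _
      have hL : 0 ≤ g₀.lap x y := by rw [hg₀, lap_normSq]; positivity
      have e1 : a.lap x y = g₀.lap x y := by simp only [a, lap_add, lap_const, hlap, add_zero]
      have e2 : g.lap x y = g₀.lap x y := by simp only [g, lap_add, lap_const, add_zero]
      simp only [hB, lap_add, lap_const_mul, lap_const, lap_rpow, e1, e2]
      have hap : 0 < a.f x y := he.trans_le (hae x y)
      have hgp : 0 < g.f x y := he.trans_le (hge x y)
      have hGg : g.gradSq x y ≤ 2 * g.f x y * g₀.lap x y := by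
        simp only [g, gradSq_add_const]
        refine (gradSq_normSq_le _ _ x y).trans ?_
        refine mul_le_mul_of_nonneg_right ?_ hL
        simp only [PlaneJet.add, PlaneJet.const]
        linarith
      have hGa := a.gradSq_nonneg x y
      have hga : g.f x y ≤ 2 * a.f x y := by
        have := hle x y
        simp only [a, g, PlaneJet.add, PlaneJet.const]
        linarith
      have h1 : a.f x y ^ (p / 2 - 1) ≤ 2 * g.f x y ^ (p / 2 - 1) := by
        have h2 := Real.rpow_le_rpow_of_nonpos hgp hga (by linarith : p / 2 - 1 ≤ 0)
        rw [Real.mul_rpow (by norm_num) hap.le] at h2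
        have h3 : (2 : ℝ) ^ (-1 : ℝ) ≤ 2 ^ (p / 2 - 1) :=
          Real.rpow_le_rpow_of_exponent_le one_le_two (by linarith)
        rw [Real.rpow_neg_one] at h3
        have h4 : 0 < a.f x y ^ (p / 2 - 1) := by positivity
        nlinarith
      set t := g.f x y ^ (p / 2 - 1 - 1) with ht
      have ht0 : 0 < t := by positivity
      have e3 : g.f x y ^ (p / 2 - 1) = g.f x y * t := by
        rw [ht, Real.rpow_sub_one hgp.ne' (p / 2 - 1)]; field_simp
      have h5 : (p / 2) * (1 - p / 2) * t * g.gradSq x y ≤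
          (p / 2) * (1 - p / 2) * t * (2 * g.f x y * g₀.lap x y) :=
        mul_le_mul_of_nonneg_left hGg (by have : 0 ≤ 1 - p / 2 := by linarith
                                          positivity)
      have h6 : (p / 2) * (p - 1) * (g.f x y * t) * g₀.lap x y ≤
          p / 2 * (g.f x y * t) * g₀.lap x y + p / 2 * (p / 2 - 1) * t * g.gradSq x y := by
        nlinarith
      have h7 : p * (g.f x y * t) * g₀.lap x y ≤
          K * (p / 2 * (g.f x y * t) * g₀.lap x y + p / 2 * (p / 2 - 1) * t * g.gradSq x y) := by
        refine le_trans (le_of_eq ?_) (mul_le_mul_of_nonneg_left h6 hK0.le)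
        have : p - 1 ≠ 0 := by linarith
        rw [hK]
        field_simp
      have h8 : p / 2 * (p / 2 - 1) * a.f x y ^ (p / 2 - 1 - 1) * a.gradSq x y ≤ 0 := by
        have h9 : 0 ≤ (1 - p / 2) := by linarith
        have : 0 ≤ p / 2 * (1 - p / 2) * a.f x y ^ (p / 2 - 1 - 1) * a.gradSq x y := by positivity
        linarith
      have h10 : p / 2 * a.f x y ^ (p / 2 - 1) * g₀.lap x y ≤ p * (g.f x y * t) * g₀.lap x y := by
        refine mul_le_mul_of_nonneg_right ?_ hL
        rw [e3] at h1
        nlinarith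
      rw [e3]
      linarith
    have hlim : Tendsto (fun y => ∫ x, B.f x y) atTop (𝓝 0) := by
      obtain ⟨C, hC, hb⟩ := hBd.df 1 one_pos
      have : (0 : ℝ) = ∫ x : ℝ, (0 : ℝ) := by simp
      rw [this]
      refine tendsto_integral_filter_of_dominated_convergence (fun x => C * wSq x) ?_ ?_
        (integrable_wSq.const_mul C) ?_
      · filter_upwards [eventually_gt_atTop 0] with y hy
        exact (hBd.cf y hy).aestronglyMeasurable
      · filter_upwards [eventually_ge_atTop 1] with y hy
        exact Eventually.of_forall fun x => hb x y hy
      · refine Eventually.of_forall fun x => ?_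
        have hl : ∀ f : ℝ → ℝ, Tendsto f atTop (𝓝 0) →
            Tendsto (fun y => (f y + e) ^ (p / 2) - e ^ (p / 2)) atTop (𝓝 0) := by
          intro f hf
          have := ((hf.add_const e).rpow_const (p := p / 2) (Or.inr hP0.le)).sub_const (e ^ (p / 2))
          simpa using this
        have := ((hl _ (normSq_tendsto_zero h₁ h₂ x)).const_mul K).sub
          (hl _ (normSq_tendsto_zero hAAd (fun _ => UHPDecay.zero) x))
        simp only [hBf]
        simpa using this
    have hfin := hBd.integral_nonneg_of_tendsto hBlap hlim hy
    have hi1 := DecayBy.integrable hdga hy (((hdg.cf y hy).add continuous_const).rpow_const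
      (fun x => Or.inr hP0.le) |>.sub continuous_const)
    have hi2 := DecayBy.integrable hdaa hy (((hda.cf y hy).add continuous_const).rpow_const
      (fun x => Or.inr hP0.le) |>.sub continuous_const)
    simp only [hBf] at hfin
    rw [integral_sub (hi1.const_mul K) hi2, integral_const_mul] at hfin
    have hmono : ∀ s : ℝ, 0 ≤ s → 0 ≤ (s + e) ^ (p / 2) - e ^ (p / 2) := fun s hs =>
      sub_nonneg.2 (Real.rpow_le_rpow he.le (by linarith) hP0.le)
    rw [← ofReal_integral_eq_lintegral_ofReal hi2 (Eventually.of_forall fun x => hmono _ (ha0 x y))]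
    calc _ ≤ ENNReal.ofReal (K * ∫ x, ((g₀.f x y + e) ^ (p / 2) - e ^ (p / 2))) :=
          ENNReal.ofReal_le_ofReal (by linarith)
      _ = ENNReal.ofReal K * ∫⁻ x, ENNReal.ofReal ((g₀.f x y + e) ^ (p / 2) - e ^ (p / 2)) := by
          rw [ENNReal.ofReal_mul hK0.le, ofReal_integral_eq_lintegral_ofReal hi1
            (Eventually.of_forall fun x => hmono _ (hg0 x y))]
      _ ≤ _ := by
          gcongr with x
          have := Real.rpow_add_le_add_rpow (hg0 x y) he.le hP0.le hP1.le
          linarith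
  simp only [haf] at main
  simp only [hg₀, normSq_f] at main
  refine lintegral_le_of_tendsto (f := fun n x => ENNReal.ofReal
    ((∑ i, (‖A₁ i (upt x y)‖ ^ 2 + ‖A₂ i (upt x y)‖ ^ 2) + epsSeq n) ^ (p / 2)
      - epsSeq n ^ (p / 2))) ?_ (fun n => main _ (epsSeq_pos n)) ?_
  · intro n
    have hc : Continuous fun x => a₀.f x y := hda.cf y hy
    simp only [haf] at hc
    exact (ENNReal.measurable_ofReal.comp
      (((hc.measurable.add_const _).pow_const _).sub_const _)).aemeasurable
  · intro x
    refine (ENNReal.continuous_ofReal.tendsto _).comp ?_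
    simpa using (tendsto_add_epsSeq_rpow _ hP0.le).sub (tendsto_epsSeq_rpow hP0)

end Riesz

open PlaneJet

lemma norm_add_conj_sq_le (a b : ℂ) :
    ‖a + starRingEnd ℂ b‖ ^ 2 ≤ 2 * (‖a‖ ^ 2 + ‖b‖ ^ 2) := by
  have h := norm_add_le a (starRingEnd ℂ b)
  rw [Complex.norm_conj] at h
  have := pow_le_pow_left₀ (norm_nonneg _) h 2
  nlinarith [sq_nonneg (‖a‖ - ‖b‖)]

section Bellman

variable {ι κ : Type*} [Fintype ι] [Fintype κ]

/-- Regularised Bellman jet `v u^γ + 18 (u - u(∞))` with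
`u = (|F|² + e)^P + (|h|² + e)^Q` and `v = |h|²`. -/
def bellman (F : ι → ℂ → ℂ) (A₁ A₂ : κ → ℂ → ℂ) (P Q γ e : ℝ) : PlaneJet :=
  ((normSq A₁ A₂).mul
    (((((normSq F fun _ _ => 0).add (PlaneJet.const e)).rpow P).add
      (((normSq A₁ A₂).add (PlaneJet.const e)).rpow Q)).rpow γ)).add
  ((PlaneJet.const 18).mul
    (((((normSq F fun _ _ => 0).add (PlaneJet.const e)).rpow P).add
      (((normSq A₁ A₂).add (PlaneJet.const e)).rpow Q)).add
        (PlaneJet.const (-(e ^ P + e ^ Q)))))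

lemma bellman_f (F : ι → ℂ → ℂ) (A₁ A₂ : κ → ℂ → ℂ) (P Q γ e x y : ℝ) :
    (bellman F A₁ A₂ P Q γ e).f x y =
      (normSq A₁ A₂).f x y * (((normSq F fun _ _ => 0).f x y + e) ^ P
          + ((normSq A₁ A₂).f x y + e) ^ Q) ^ γ
        + 18 * ((((normSq F fun _ _ => 0).f x y + e) ^ P - e ^ P)
          + (((normSq A₁ A₂).f x y + e) ^ Q - e ^ Q)) := by
  simp only [bellman, PlaneJet.add, PlaneJet.mul, PlaneJet.const, PlaneJet.rpow]
  ring

/-- Relations between the Bellman exponents attached to `p ∈ (1, 2)`. -/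
structure BellmanExp (p P Q γ : ℝ) : Prop where
  hp1 : 1 < p
  hp2 : p < 2
  hP : P = p / 2
  hQ : Q = p / (2 * (p - 1))
  hγ : γ = (2 - p) / p

namespace BellmanExp
variable {p P Q γ : ℝ} (h : BellmanExp p P Q γ)
include h
lemma P_pos : 0 < P := by rw [h.hP]; linarith [h.hp1]
lemma half_le : 1 / 2 ≤ P := by rw [h.hP]; linarith [h.hp1]
lemma P_le : P ≤ 1 := by rw [h.hP]; linarith [h.hp2]
lemma Q_ge : 1 ≤ Q := by
  rw [h.hQ, le_div_iff₀ (by linarith [h.hp1])]; linarith [h.hp2]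
lemma γ_pos : 0 < γ := by
  rw [h.hγ]; exact div_pos (by linarith [h.hp2]) (by linarith [h.hp1])
lemma γ_lt : γ < 1 := by
  rw [h.hγ, div_lt_one (by linarith [h.hp1])]; linarith [h.hp1]
lemma P_mul : P * γ = 1 - P := by
  have : p ≠ 0 := by linarith [h.hp1]
  rw [h.hP, h.hγ]; field_simp
lemma Q_mul : Q * (1 - γ) = 1 := by
  have : p ≠ 0 := by linarith [h.hp1]
  have : p - 1 ≠ 0 := by linarith [h.hp1]
  rw [h.hQ, h.hγ]; field_simp; ring
end BellmanExp

lemma le_rpow_of_bellmanExp {p P Q γ : ℝ} (h : BellmanExp p P Q γ) {v r S : ℝ} (hv : 0 ≤ v)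
    (hvr : v ≤ r) (hS : 0 ≤ S) : v ≤ (S + r ^ Q) ^ (1 - γ) := by
  have hr : 0 ≤ r := hv.trans hvr
  have hγ : 0 ≤ 1 - γ := by linarith [h.γ_lt]
  calc v ≤ r := hvr
    _ = (r ^ Q) ^ (1 - γ) := by rw [← Real.rpow_mul hr, h.Q_mul, Real.rpow_one]
    _ ≤ _ := Real.rpow_le_rpow (by positivity) (by linarith) hγ

variable {F : ι → ℂ → ℂ} {A₁ A₂ : κ → ℂ → ℂ}

lemma decays_bellman (hF : ∀ i, UHPDecay (F i)) (h₁ : ∀ i, UHPDecay (A₁ i))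
    (h₂ : ∀ i, UHPDecay (A₂ i)) {p P Q γ : ℝ} (hb : BellmanExp p P Q γ) {e : ℝ} (he : 0 < e) :
    Decays wSq wSq (bellman F A₁ A₂ P Q γ e) := by
  have hdF : Decays wSq wSq (normSq F fun _ _ => 0) := decays_normSq hF fun _ => UHPDecay.zero
  have hdh : Decays wSq wSq (normSq A₁ A₂) := decays_normSq h₁ h₂
  have hs := hdF.one_of_sq.add (decays_const e)
  have hr := hdh.one_of_sq.add (decays_const e)
  have hs0 : ∀ x y, e ≤ ((normSq F fun _ _ => 0).add (PlaneJet.const e)).f x y := fun x y => by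
    have := normSq_f_nonneg F (fun _ _ => 0) x y
    simp only [PlaneJet.add, PlaneJet.const]; linarith
  have hr0 : ∀ x y, e ≤ ((normSq A₁ A₂).add (PlaneJet.const e)).f x y := fun x y => by
    have := normSq_f_nonneg A₁ A₂ x y
    simp only [PlaneJet.add, PlaneJet.const]; linarith
  have hu := (hs.rpow he (fun x y _ => hs0 x y) P).add (hr.rpow he (fun x y _ => hr0 x y) Q)
  have hu0 : ∀ x y, 0 < y → e ^ P ≤ ((((normSq F fun _ _ => 0).add (PlaneJet.const e)).rpow P).add
      (((normSq A₁ A₂).add (PlaneJet.const e)).rpow Q)).f x y := fun x y _ => by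
    have h1 := Real.rpow_le_rpow he.le (hs0 x y) hb.P_pos.le
    have h2 : 0 ≤ ((normSq A₁ A₂).add (PlaneJet.const e)).f x y ^ Q :=
      Real.rpow_nonneg (he.le.trans (hr0 x y)) _
    calc e ^ P ≤ _ := h1
      _ ≤ _ + _ := le_add_of_nonneg_right h2
  have hug := hu.rpow (Real.rpow_pos_of_pos he P) hu0 γ
  refine Decays.upgrade ?_ ?_
  · exact (hdh.one_of_sq.mul_one_sq hug).add
      ((decays_const 18).mul_one_sq (hu.add (decays_const _)))
  · have h3 := (hug.df.bd_mul hdh.df).add ((DecayBy.const 18).bd_mul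
      ((hdF.df.add_const_rpow_sub (fun x y _ => normSq_f_nonneg _ _ x y) he P).add
        (hdh.df.add_const_rpow_sub (fun x y _ => normSq_f_nonneg _ _ x y) he Q)))
    intro y₀ h0
    obtain ⟨C, hC, h⟩ := h3 y₀ h0
    refine ⟨C, hC, fun x y hy => ?_⟩
    rw [bellman_f, mul_comm ((normSq A₁ A₂).f x y)]
    exact h x y hy

lemma bellman_lap_ge {p P Q γ : ℝ} (hb : BellmanExp p P Q γ) {e : ℝ} (he : 0 < e) (x y : ℝ) :
    2 * (Real.sqrt (∑ i, ‖deriv (F i) (upt x y)‖ ^ 2) * Real.sqrt (∑ k,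
        ‖deriv (A₁ k) (upt x y) + starRingEnd ℂ (deriv (A₂ k) (upt x y))‖ ^ 2)) ≤
      (bellman F A₁ A₂ P Q γ e).lap x y := by
  set V := normSq A₁ A₂ with hV
  set s := (normSq F fun _ _ => 0).add (PlaneJet.const e) with hs
  set r := V.add (PlaneJet.const e) with hr
  set U := (s.rpow P).add (r.rpow Q) with hU
  have hv0 : 0 ≤ V.f x y := normSq_f_nonneg _ _ x y
  have hσ0 := normSq_f_nonneg F (fun _ _ => 0) x y
  have hsf : s.f x y = (normSq F fun _ _ => 0).f x y + e := rfl
  have hrf : r.f x y = V.f x y + e := rfl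
  have hs0 : 0 < s.f x y := by rw [hsf]; linarith
  have hr0 : 0 < r.f x y := by rw [hrf]; linarith
  have hUf : U.f x y = s.f x y ^ P + r.f x y ^ Q := rfl
  have hU0 : 0 < U.f x y := by rw [hUf]; positivity
  set X := ∑ i, ‖deriv (F i) (upt x y)‖ ^ 2 with hX
  set E := ∑ i, (‖deriv (A₁ i) (upt x y)‖ ^ 2 + ‖deriv (A₂ i) (upt x y)‖ ^ 2) with hE
  have hX0 : 0 ≤ X := by rw [hX]; positivity
  have hE0 : 0 ≤ E := by rw [hE]; positivity
  have hlV : V.lap x y = 4 * E := lap_normSq _ _ x y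
  have hlF : (normSq F fun _ _ => 0).lap x y = 4 * X := by rw [lap_normSq]; simp [hX]
  have hls : s.lap x y = 4 * X := by rw [hs, lap_add, lap_const, hlF, add_zero]
  have hlr : r.lap x y = 4 * E := by rw [hr, lap_add, lap_const, hlV, add_zero]
  have hgs : s.gradSq x y ≤ s.f x y * s.lap x y := by
    rw [hs, gradSq_add_const]
    refine (gradSq_normSq_le_of_analytic F x y).trans ?_
    rw [← hs, hls, hlF, hsf]
    exact mul_le_mul_of_nonneg_right (by linarith) (by linarith)
  have hgV : V.gradSq x y ≤ 2 * V.f x y * V.lap x y := gradSq_normSq_le _ _ x y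
  have hgr : r.gradSq x y ≤ 2 * r.f x y * r.lap x y := by
    rw [hr, gradSq_add_const]
    refine hgV.trans ?_
    rw [← hr, hlr, hlV, hrf]
    exact mul_le_mul_of_nonneg_right (by linarith) (by linarith)
  obtain ⟨hS1, hS2⟩ := lap_rpow_ge_of_le_one hs0 hgs hb.P_pos.le hb.P_le
  obtain ⟨hR1, hR2⟩ := lap_rpow_nonneg_of_one_le hr0 hgr hb.Q_ge
  have hsp : 0 < s.f x y ^ (P - 1) := by positivity
  have hS3 : s.f x y ^ (P - 1) * X ≤ (s.rpow P).lap x y := by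
    refine le_trans ?_ hS1
    have h1 : (1 / 4 : ℝ) ≤ P ^ 2 := by nlinarith [hb.half_le]
    rw [hls]
    have h2 : 0 ≤ s.f x y ^ (P - 1) * X := by positivity
    nlinarith
  have hS4 : 0 ≤ (s.rpow P).lap x y := le_trans (by positivity) hS3
  have hlU : U.lap x y = (s.rpow P).lap x y + (r.rpow Q).lap x y := lap_add _ _ _ _
  have hlU0 : 0 ≤ U.lap x y := by rw [hlU]; positivity
  have hgU : U.gradSq x y ≤ 4 * U.f x y * U.lap x y := by
    refine (gradSq_add_le _ _ x y).trans ?_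
    rw [hlU, hUf]
    have h1 : 0 < s.f x y ^ P := by positivity
    have h2 : 0 < r.f x y ^ Q := by positivity
    have h3 : 0 ≤ s.f x y ^ P * (r.rpow Q).lap x y := by positivity
    have h4 : 0 ≤ r.f x y ^ Q * (s.rpow P).lap x y := by positivity
    have h5 : 0 ≤ s.f x y ^ P * (s.rpow P).lap x y := by positivity
    linarith
  have hvu : V.f x y * U.f x y ^ (γ - 1) ≤ 1 := by
    have h1 : V.f x y ≤ U.f x y ^ (1 - γ) := by
      rw [hUf]
      exact le_rpow_of_bellmanExp hb hv0 (by rw [hrf]; linarith) (by positivity)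
    calc V.f x y * U.f x y ^ (γ - 1) ≤ U.f x y ^ (1 - γ) * U.f x y ^ (γ - 1) :=
          mul_le_mul_of_nonneg_right h1 (by positivity)
      _ = 1 := by rw [← Real.rpow_add hU0]; simp
  have hmain := lap_mul_rpow_ge hb.γ_pos.le hb.γ_lt.le hv0 hU0 (by rw [hlV]; positivity) hlU0 hgV
    hgU hvu
  have hlB : (bellman F A₁ A₂ P Q γ e).lap x y = (V.mul (U.rpow γ)).lap x y + 18 * U.lap x y := by
    rw [bellman, lap_add, lap_const_mul, lap_add, lap_const, add_zero]
  have hUγ : s.f x y ^ (1 - P) ≤ U.f x y ^ γ := by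
    rw [← hb.P_mul, Real.rpow_mul hs0.le, hUf]
    exact Real.rpow_le_rpow (by positivity) (le_add_of_nonneg_right (by positivity)) hb.γ_pos.le
  have hone : s.f x y ^ (1 - P) * s.f x y ^ (P - 1) = 1 := by
    rw [← Real.rpow_add hs0]; simp
  have hlow : 2 * s.f x y ^ (1 - P) * E + s.f x y ^ (P - 1) * X ≤
      (bellman F A₁ A₂ P Q γ e).lap x y := by
    rw [hlB]
    rw [hlV] at hmain
    have h1 : s.f x y ^ (1 - P) * E ≤ U.f x y ^ γ * E := mul_le_mul_of_nonneg_right hUγ hE0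
    have h2 : 0 ≤ (r.rpow Q).lap x y := hR1
    linarith
  refine le_trans ?_ hlow
  set D := Real.sqrt X * Real.sqrt (∑ k,
        ‖deriv (A₁ k) (upt x y) + starRingEnd ℂ (deriv (A₂ k) (upt x y))‖ ^ 2) with hD
  have hcs : D ^ 2 ≤ X * (2 * E) := by
    rw [hD, mul_pow, Real.sq_sqrt hX0, Real.sq_sqrt (by positivity)]
    refine mul_le_mul_of_nonneg_left ?_ hX0
    rw [hE, Finset.mul_sum]
    refine Finset.sum_le_sum fun i _ => ?_
    exact norm_add_conj_sq_le _ _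
  set a := s.f x y ^ (1 - P)
  set b := s.f x y ^ (P - 1)
  have ha : 0 < a := by positivity
  refine (abs_le_of_sq_le_sq' ?_ (by positivity)).2
  have h1 : (a * E) * (b * X) = X * E := by
    calc (a * E) * (b * X) = (a * b) * (X * E) := by ring
      _ = X * E := by rw [hone, one_mul]
  have h2 : (2 * a * E + b * X) ^ 2 = (2 * a * E - b * X) ^ 2 + 8 * ((a * E) * (b * X)) := by ring
  rw [h1] at h2
  calc (2 * D) ^ 2 = 4 * D ^ 2 := by ring
    _ ≤ 8 * (X * E) := by linarith
    _ ≤ (2 * a * E + b * X) ^ 2 := by linarith [sq_nonneg (2 * a * E - b * X)]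

/-- The bilinear Littlewood-Paley estimate above a horizontal line, via the Bellman function. -/
lemma bellman_upper (hF : ∀ i, UHPDecay (F i)) (h₁ : ∀ i, UHPDecay (A₁ i))
    (h₂ : ∀ i, UHPDecay (A₂ i)) {p P Q γ : ℝ} (hb : BellmanExp p P Q γ) {a : ℝ} (ha : 0 < a) :
    ∫⁻ y in Set.Ioi a, ENNReal.ofReal (y - a) * ∫⁻ x, ENNReal.ofReal
        (2 * (Real.sqrt (∑ i, ‖deriv (F i) (upt x y)‖ ^ 2) * Real.sqrt (∑ k,
          ‖deriv (A₁ k) (upt x y) + starRingEnd ℂ (deriv (A₂ k) (upt x y))‖ ^ 2))) ≤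
      19 * ((∫⁻ x, ENNReal.ofReal ((∑ i, ‖F i (upt x a)‖ ^ 2) ^ P)) +
        ∫⁻ x, ENNReal.ofReal
          ((∑ i, ‖A₁ i (upt x a) + starRingEnd ℂ (A₂ i (upt x a))‖ ^ 2) ^ Q)) := by
  set s₀ := normSq F fun _ _ => 0 with hs₀
  set V := normSq A₁ A₂ with hV
  have hs0 : ∀ x, 0 ≤ s₀.f x a := fun x => normSq_f_nonneg _ _ x a
  have hv0 : ∀ x, 0 ≤ V.f x a := fun x => normSq_f_nonneg _ _ x a
  have hsd : Decays wSq wSq s₀ := decays_normSq hF fun _ => UHPDecay.zero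
  have hVd : Decays wSq wSq V := decays_normSq h₁ h₂
  have esf : ∀ x, ∑ i, ‖F i (upt x a)‖ ^ 2 = s₀.f x a := fun x => by rw [hs₀, normSq_f]; simp
  have evf : ∀ x, ∑ i, ‖A₁ i (upt x a) + starRingEnd ℂ (A₂ i (upt x a))‖ ^ 2 = V.f x a :=
    fun x => by rw [hV, normSq_f]
  simp only [esf, evf]
  have hP := hb.P_pos
  have hQ := hb.Q_ge
  have hγ := hb.γ_pos
  have hγ1 := hb.γ_lt
  set D : ℝ → ℝ → ℝ := fun e x => V.f x a * ((s₀.f x a + e) ^ P + (V.f x a + e) ^ Q) ^ γ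
      + 18 * ((V.f x a + e) ^ Q - e ^ Q) with hD
  have hDm : ∀ e, Measurable (D e) := by
    intro e
    have h1 := (hsd.cf a ha).measurable
    have h2 := (hVd.cf a ha).measurable
    exact (h2.mul ((((h1.add_const e).pow_const P).add ((h2.add_const e).pow_const Q)).pow_const
      γ)).add ((((h2.add_const e).pow_const Q).sub_const _).const_mul 18)
  -- the bound for fixed `e`
  have hstep : ∀ e : ℝ, 0 < e → ∫⁻ y in Set.Ioi a, ENNReal.ofReal (y - a) * ∫⁻ x, ENNReal.ofReal
        (2 * (Real.sqrt (∑ i, ‖deriv (F i) (upt x y)‖ ^ 2) * Real.sqrt (∑ k,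
          ‖deriv (A₁ k) (upt x y) + starRingEnd ℂ (deriv (A₂ k) (upt x y))‖ ^ 2))) ≤
      (∫⁻ x, ENNReal.ofReal (D e x)) + 18 * ∫⁻ x, ENNReal.ofReal (s₀.f x a ^ P) := by
    intro e he
    have hB := decays_bellman hF h₁ h₂ hb he
    have hlap : ∀ x y, 0 < y → 0 ≤ (bellman F A₁ A₂ P Q γ e).lap x y := fun x y _ =>
      le_trans (by positivity) (bellman_lap_ge hb he x y)
    have hmS : ∀ x, 0 ≤ s₀.f x a → 0 ≤ (s₀.f x a + e) ^ P - e ^ P := fun x hx =>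
      sub_nonneg.2 (Real.rpow_le_rpow he.le (by linarith) hP.le)
    have hpos : ∀ x y, 0 < y → 0 ≤ (bellman F A₁ A₂ P Q γ e).f x y := by
      intro x y _
      rw [bellman_f]
      have h1 : 0 ≤ (normSq F fun _ _ => 0).f x y := normSq_f_nonneg _ _ x y
      have h2 : 0 ≤ (normSq A₁ A₂).f x y := normSq_f_nonneg _ _ x y
      have h3 : e ^ P ≤ ((normSq F fun _ _ => 0).f x y + e) ^ P :=
        Real.rpow_le_rpow he.le (by linarith) hP.le
      have h4 : e ^ Q ≤ ((normSq A₁ A₂).f x y + e) ^ Q :=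
        Real.rpow_le_rpow he.le (by linarith) (by linarith)
      have h5 : 0 ≤ (normSq A₁ A₂).f x y * (((normSq F fun _ _ => 0).f x y + e) ^ P
          + ((normSq A₁ A₂).f x y + e) ^ Q) ^ γ := by positivity
      linarith
    calc _ ≤ ∫⁻ y in Set.Ioi a, ENNReal.ofReal (y - a) *
            ∫⁻ x, ENNReal.ofReal ((bellman F A₁ A₂ P Q γ e).lap x y) := by
          gcongr with y x
          exact bellman_lap_ge hb he x y
      _ ≤ ENNReal.ofReal (∫ x, (bellman F A₁ A₂ P Q γ e).f x a) := hB.green hlap hpos ha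
      _ = ∫⁻ x, ENNReal.ofReal ((bellman F A₁ A₂ P Q γ e).f x a) :=
          ofReal_integral_eq_lintegral_ofReal (DecayBy.integrable hB.df ha (hB.cf a ha))
            (Eventually.of_forall fun x => hpos x a ha)
      _ ≤ ∫⁻ x, (ENNReal.ofReal (D e x) + 18 * ENNReal.ofReal (s₀.f x a ^ P)) := by
          refine lintegral_mono fun x => ?_
          have h1 : (bellman F A₁ A₂ P Q γ e).f x a ≤ D e x + 18 * s₀.f x a ^ P := by
            rw [bellman_f]
            have := Real.rpow_add_le_add_rpow (hs0 x) he.le hP.le hb.P_le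
            simp only [hD]
            linarith
          refine (ENNReal.ofReal_le_ofReal h1).trans (ENNReal.ofReal_add_le.trans ?_)
          rw [ENNReal.ofReal_mul (by norm_num)]
          simp
      _ = _ := by
          rw [lintegral_add_left (hDm e).ennreal_ofReal, lintegral_const_mul']
          simp
  -- the limit of the main term
  obtain ⟨C, hC, hCb⟩ := hVd.df a ha
  obtain ⟨C', hC', hCb'⟩ := hsd.df a ha
  have hvC : ∀ x, V.f x a ≤ C * wSq x := fun x => (le_abs_self _).trans (hCb x a le_rfl)
  have hvC1 : ∀ x, V.f x a ≤ C := fun x =>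
    (hvC x).trans (mul_le_of_le_one_right hC (wSq_le_one x))
  have hsC1 : ∀ x, s₀.f x a ≤ C' := fun x =>
    ((le_abs_self _).trans (hCb' x a le_rfl)).trans (mul_le_of_le_one_right hC' (wSq_le_one x))
  set M := ((C' + 1) ^ P + (C + 1) ^ Q) ^ γ + 18 * (Q * (C + 1) ^ (Q - 1)) with hM
  have hlim : Tendsto (fun n => ∫⁻ x, ENNReal.ofReal (D (epsSeq n) x)) atTop
      (𝓝 (∫⁻ x, ENNReal.ofReal (V.f x a * (s₀.f x a ^ P + V.f x a ^ Q) ^ γ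
        + 18 * V.f x a ^ Q))) := by
    refine tendsto_lintegral_of_dominated_convergence
      (fun x => ENNReal.ofReal (M * C * wSq x)) (fun n => (hDm _).ennreal_ofReal) ?_ ?_ ?_
    · intro n
      refine Eventually.of_forall fun x => ENNReal.ofReal_le_ofReal ?_
      have he := epsSeq_pos n
      have he1 := epsSeq_le_one n
      have h1 : ((s₀.f x a + epsSeq n) ^ P + (V.f x a + epsSeq n) ^ Q) ^ γ ≤
          ((C' + 1) ^ P + (C + 1) ^ Q) ^ γ := by
        have h2 := hs0 x
        have h3 := hv0 x
        refine Real.rpow_le_rpow (by positivity) ?_ hγ.le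
        exact add_le_add
          (Real.rpow_le_rpow (by positivity) (add_le_add (hsC1 x) he1) hP.le)
          (Real.rpow_le_rpow (by positivity) (add_le_add (hvC1 x) he1) (by linarith))
      have h4 : (V.f x a + epsSeq n) ^ Q - epsSeq n ^ Q ≤ Q * (C + 1) ^ (Q - 1) * V.f x a := by
        have := (convex_Icc (epsSeq n) (V.f x a + epsSeq n)).norm_image_sub_le_of_norm_hasDerivWithin_le
          (f := fun t : ℝ => t ^ Q) (f' := fun t => Q * t ^ (Q - 1)) (C := Q * (C + 1) ^ (Q - 1))
          (x := epsSeq n) (y := V.f x a + epsSeq n)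
          (fun z hz => (Real.hasDerivAt_rpow_const
            (Or.inl (he.trans_le hz.1).ne')).hasDerivWithinAt)
          (fun z hz => by
            have hz0 : 0 < z := he.trans_le hz.1
            rw [Real.norm_of_nonneg (by positivity)]
            refine mul_le_mul_of_nonneg_left (Real.rpow_le_rpow hz0.le ?_ (by linarith))
              (by linarith)
            exact hz.2.trans (add_le_add (hvC1 x) he1))
          ⟨le_rfl, by linarith [hv0 x]⟩ ⟨by linarith [hv0 x], le_rfl⟩
        rw [add_sub_cancel_right, Real.norm_of_nonneg (hv0 x)] at this
        exact (le_abs_self _).trans this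
      have h5 : V.f x a * ((s₀.f x a + epsSeq n) ^ P + (V.f x a + epsSeq n) ^ Q) ^ γ ≤
          V.f x a * ((C' + 1) ^ P + (C + 1) ^ Q) ^ γ := mul_le_mul_of_nonneg_left h1 (hv0 x)
      calc D (epsSeq n) x ≤ M * V.f x a := by simp only [hD, hM]; linarith
        _ ≤ M * (C * wSq x) := mul_le_mul_of_nonneg_left (hvC x) (by positivity)
        _ = _ := by ring
    · exact ((integrable_wSq.const_mul _).lintegral_lt_top).ne
    · refine Eventually.of_forall fun x => (ENNReal.continuous_ofReal.tendsto _).comp ?_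
      have h1 := ((((tendsto_add_epsSeq_rpow (s₀.f x a) hP.le).add
        (tendsto_add_epsSeq_rpow (V.f x a) (by linarith : 0 ≤ Q))).rpow_const
          (Or.inr hγ.le)).const_mul (V.f x a)).add
        (((tendsto_add_epsSeq_rpow (V.f x a) (by linarith : 0 ≤ Q)).sub
          (tendsto_epsSeq_rpow (by linarith : 0 < Q))).const_mul 18)
      simpa [hD, Function.comp_def] using h1
  have hfin := ge_of_tendsto (hlim.add_const (18 * ∫⁻ x, ENNReal.ofReal (s₀.f x a ^ P)))
    (Eventually.of_forall fun n => hstep _ (epsSeq_pos n))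
  refine hfin.trans ?_
  have hm1 : Measurable fun x => ENNReal.ofReal (s₀.f x a ^ P) :=
    (((hsd.cf a ha).measurable).pow_const P).ennreal_ofReal
  have h1 : ∫⁻ x, ENNReal.ofReal (V.f x a * (s₀.f x a ^ P + V.f x a ^ Q) ^ γ
        + 18 * V.f x a ^ Q) ≤
      (∫⁻ x, ENNReal.ofReal (s₀.f x a ^ P)) + 19 * ∫⁻ x, ENNReal.ofReal (V.f x a ^ Q) := by
    rw [← lintegral_const_mul' _ _ (by simp), ← lintegral_add_left hm1]
    refine lintegral_mono fun x => ?_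
    have h2 := hs0 x
    have h3 := hv0 x
    set u := s₀.f x a ^ P + V.f x a ^ Q with hu
    have hu0 : 0 ≤ u := by positivity
    have h4 : V.f x a * u ^ γ ≤ u := by
      calc V.f x a * u ^ γ ≤ u ^ (1 - γ) * u ^ γ :=
            mul_le_mul_of_nonneg_right (le_rpow_of_bellmanExp hb h3 le_rfl (by positivity))
              (by positivity)
        _ = u := by rw [← Real.rpow_add' hu0 (by simp)]; simp
    have h5 : (19 : ℝ≥0∞) = ENNReal.ofReal 19 := by simp
    rw [h5, ← ENNReal.ofReal_mul (by norm_num), ← ENNReal.ofReal_add (by positivity) (by positivity)]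
    exact ENNReal.ofReal_le_ofReal (by linarith)
  refine (add_le_add_left h1 _).trans (le_of_eq ?_)
  ring

end Bellman

/-- The Poisson kernel of the upper half plane at height `w`. -/
def pois (s w : ℝ) : ℝ := w / (Real.pi * (s ^ 2 + w ^ 2))

lemma pois_nonneg (s : ℝ) {w : ℝ} (hw : 0 < w) : 0 ≤ pois s w := by
  unfold pois; positivity

lemma continuous_pois {w : ℝ} (hw : 0 < w) : Continuous (fun s => pois s w) := by
  unfold pois
  refine continuous_const.div (by fun_prop) fun s => ?_
  have := Real.pi_pos
  positivity

lemma pois_eq (s : ℝ) {w : ℝ} (hw : 0 < w) :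
    pois s w = (Real.pi * w)⁻¹ * (1 + (s / w) ^ 2)⁻¹ := by
  have := Real.pi_pos
  unfold pois
  field_simp
  ring

lemma integrable_pois {w : ℝ} (hw : 0 < w) : Integrable (fun s => pois s w) := by
  have h := (integrable_inv_one_add_sq.comp_div hw.ne').const_mul (Real.pi * w)⁻¹
  refine h.congr (ae_of_all _ fun s => ?_)
  simp only [pois_eq s hw]

lemma integral_pois {w : ℝ} (hw : 0 < w) : ∫ s, pois s w = 1 := by
  simp_rw [pois_eq _ hw]
  rw [integral_const_mul, Measure.integral_comp_div (fun s => (1 + s ^ 2)⁻¹),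
    integral_univ_inv_one_add_sq, abs_of_pos hw, smul_eq_mul]
  have := Real.pi_pos
  field_simp

lemma pois_neg (s w : ℝ) : pois (-s) w = pois s w := by simp [pois]

lemma continuous_expAbs (c : ℝ) : Continuous (fun v : ℝ => (Real.exp (-c * |v|) : ℂ)) := by
  fun_prop

lemma integrable_expAbs {c : ℝ} (hc : 0 < c) :
    Integrable (fun v : ℝ => (Real.exp (-c * |v|) : ℂ)) := by
  rw [← integrableOn_univ, ← Set.Iic_union_Ioi (a := (0:ℝ))]
  refine IntegrableOn.union ?_ ?_
  · refine (integrableOn_exp_mul_complex_Iic (a := c) (by simpa using hc) 0).congr_fun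
      (fun v hv => ?_) measurableSet_Iic
    simp [abs_of_nonpos (Set.mem_Iic.1 hv)]
  · refine (integrableOn_exp_mul_complex_Ioi (a := -c) (by simpa using hc) 0).congr_fun
      (fun v hv => ?_) measurableSet_Ioi
    simp [abs_of_pos (Set.mem_Ioi.1 hv)]

open FourierTransform in
lemma fourier_expAbs {w : ℝ} (hw : 0 < w) (s : ℝ) :
    𝓕 (fun v : ℝ => (Real.exp (-(2 * Real.pi * w) * |v|) : ℂ)) s = pois s w := by
  have hpi := Real.pi_pos
  rw [Real.fourier_eq']
  have hI : Integrable (fun v : ℝ => Complex.exp (((-2 * Real.pi * inner ℝ v s : ℝ) : ℂ) * Complex.I) •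
      (Real.exp (-(2 * Real.pi * w) * |v|) : ℂ)) := by
    have := (integrable_expAbs (c := 2 * Real.pi * w) (by positivity)).bdd_mul (c := 1)
      (f := fun v : ℝ => Complex.exp (((-2 * Real.pi * inner ℝ v s : ℝ) : ℂ) * Complex.I))
      (Continuous.aestronglyMeasurable (by fun_prop))
      (ae_of_all _ fun v => by rw [Complex.norm_exp_ofReal_mul_I])
    simpa only [smul_eq_mul] using this
  rw [← integral_add_compl measurableSet_Iic hI (s := Set.Iic 0), Set.compl_Iic]
  have e1 : ∫ v in Set.Iic (0:ℝ), Complex.exp (((-2 * Real.pi * inner ℝ v s : ℝ) : ℂ) * Complex.I) •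
      (Real.exp (-(2 * Real.pi * w) * |v|) : ℂ) =
      ∫ v in Set.Iic (0:ℝ), Complex.exp ((2 * Real.pi * (w - s * Complex.I) : ℂ) * v) := by
    refine setIntegral_congr_fun measurableSet_Iic fun v hv => ?_
    simp only [abs_of_nonpos (Set.mem_Iic.1 hv), smul_eq_mul, Complex.ofReal_exp, ← Complex.exp_add]
    congr 1
    simp
    ring
  have e2 : ∫ v in Set.Ioi (0:ℝ), Complex.exp (((-2 * Real.pi * inner ℝ v s : ℝ) : ℂ) * Complex.I) •
      (Real.exp (-(2 * Real.pi * w) * |v|) : ℂ) =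
      ∫ v in Set.Ioi (0:ℝ), Complex.exp ((-2 * Real.pi * (w + s * Complex.I) : ℂ) * v) := by
    refine setIntegral_congr_fun measurableSet_Ioi fun v hv => ?_
    simp only [abs_of_pos (Set.mem_Ioi.1 hv), smul_eq_mul, Complex.ofReal_exp, ← Complex.exp_add]
    congr 1
    simp
    ring
  rw [e1, e2, integral_exp_mul_complex_Iic (by simp; positivity),
    integral_exp_mul_complex_Ioi (by simp; positivity)]
  have h1 : (w : ℂ) - s * Complex.I ≠ 0 := fun h => by
    have := congrArg Complex.re h; simp at this; exact hw.ne' this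
  have h2 : (w : ℂ) + s * Complex.I ≠ 0 := fun h => by
    have := congrArg Complex.re h; simp at this; exact hw.ne' this
  have h3 : (Real.pi : ℂ) ≠ 0 := by exact_mod_cast hpi.ne'
  have h4 : (s : ℂ) ^ 2 + w ^ 2 ≠ 0 := by
    have : s ^ 2 + w ^ 2 ≠ 0 := by positivity
    exact_mod_cast this
  have h5 : (s : ℂ) ^ 2 + w ^ 2 = (w - s * Complex.I) * (w + s * Complex.I) := by
    ring_nf; simp
  unfold pois
  push_cast
  simp only [mul_zero, Complex.exp_zero]
  rw [h5]
  field_simp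
  ring

open FourierTransform in
lemma integral_pois_mul_exp {w : ℝ} (hw : 0 < w) (τ : ℝ) :
    ∫ s : ℝ, (pois s w : ℂ) * Complex.exp (Complex.I * s * τ) = Real.exp (-w * |τ|) := by
  have hpi := Real.pi_pos
  have hf := integrable_expAbs (c := 2 * Real.pi * w) (by positivity)
  have hF : 𝓕 (fun v : ℝ => (Real.exp (-(2 * Real.pi * w) * |v|) : ℂ)) =
    fun s => (pois s w : ℂ) := funext (fourier_expAbs hw)
  have h := (continuous_expAbs (2 * Real.pi * w)).fourierInv_fourier_eq hf
    (by rw [hF]; exact (integrable_pois hw).ofReal)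
  have h' := congrFun h (τ / (2 * Real.pi))
  rw [hF, Real.fourierInv_eq'] at h'
  have e : Real.exp (-w * |τ|) = Real.exp (-(2 * Real.pi * w) * |τ / (2 * Real.pi)|) := by
    rw [abs_div, abs_of_pos (by positivity : 0 < 2 * Real.pi)]
    congr 1
    field_simp
  rw [e]
  rw [← h']
  congr 1
  ext s
  rw [smul_eq_mul, mul_comm]
  congr 2
  have : (Real.pi : ℂ) ≠ 0 := by exact_mod_cast hpi.ne'
  simp
  field_simp

lemma lintegral_mul_rpow_le {α : Type*} [MeasurableSpace α] {μ : Measure α} {a b : α → ℝ≥0∞}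
    (ha : Measurable a) (hb : AEMeasurable b μ) (h1 : ∫⁻ s, a s ∂μ = 1) {r : ℝ} (hr : 1 ≤ r) :
    (∫⁻ s, a s * b s ∂μ) ^ r ≤ ∫⁻ s, a s * b s ^ r ∂μ := by
  have hr0 : 0 < r := by linarith
  set ν := μ.withDensity a with hν
  have hac : ν ≪ μ := withDensity_absolutelyContinuous μ a
  have hb' : AEMeasurable b ν := hb.mono_ac hac
  have e1 : ∫⁻ s, a s * b s ∂μ = ∫⁻ s, b s ∂ν :=
    (lintegral_withDensity_eq_lintegral_mul₀ ha.aemeasurable hb).symm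
  have e2 : ∫⁻ s, a s * b s ^ r ∂μ = ∫⁻ s, b s ^ r ∂ν :=
    (lintegral_withDensity_eq_lintegral_mul₀ ha.aemeasurable (hb.pow_const r)).symm
  have : IsProbabilityMeasure ν := ⟨by rw [hν, withDensity_apply _ .univ]; simpa using h1⟩
  rw [e1, e2]
  have := eLpNorm'_le_eLpNorm'_of_exponent_le (f := b) (μ := ν) one_pos hr hb'.aestronglyMeasurable
  simp only [eLpNorm', enorm_eq_self, ENNReal.rpow_one, one_div, inv_one] at this
  calc _ ≤ ((∫⁻ s, b s ^ r ∂ν) ^ r⁻¹) ^ r := ENNReal.rpow_le_rpow this hr0.le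
    _ = _ := by rw [← ENNReal.rpow_mul, inv_mul_cancel₀ hr0.ne', ENNReal.rpow_one]

lemma ofReal_sum_sq_rpow {ι : Type*} [Fintype ι] (v : ι → ℂ) {r : ℝ} (hr : 0 ≤ r) :
    ENNReal.ofReal ((∑ i, ‖v i‖ ^ 2) ^ (r / 2)) = ‖(WithLp.toLp 2 v : EuclideanSpace ℂ ι)‖ₑ ^ r := by
  rw [← ofReal_norm, ENNReal.ofReal_rpow_of_nonneg (norm_nonneg _) hr,
    EuclideanSpace.norm_eq, Real.sqrt_eq_rpow, ← Real.rpow_mul (by positivity)]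
  congr 2
  ring

lemma jensen_sq {ι α : Type*} [Fintype ι] [MeasurableSpace α] {μ : Measure α} {ρ : α → ℝ}
    (hρ : Measurable ρ) (hρ0 : ∀ᵐ s ∂μ, 0 ≤ ρ s) (h1 : ∫⁻ s, ENNReal.ofReal (ρ s) ∂μ = 1)
    {g : ι → α → ℂ} (hm : ∀ i, AEStronglyMeasurable (g i) μ)
    (hg : ∀ i, Integrable (fun s => (ρ s : ℂ) * g i s) μ) {r : ℝ} (hr : 1 ≤ r) :
    ENNReal.ofReal ((∑ i, ‖∫ s, (ρ s : ℂ) * g i s ∂μ‖ ^ 2) ^ (r / 2)) ≤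
      ∫⁻ s, ENNReal.ofReal (ρ s) * ENNReal.ofReal ((∑ i, ‖g i s‖ ^ 2) ^ (r / 2)) ∂μ := by
  have hr0 : 0 ≤ r := by linarith
  simp_rw [ofReal_sum_sq_rpow _ hr0]
  have hmv : AEStronglyMeasurable (fun s => (WithLp.toLp 2 (fun i => g i s) : EuclideanSpace ℂ ι)) μ :=
    (PiLp.continuous_toLp 2 (fun _ : ι => ℂ)).comp_aestronglyMeasurable
      (AEMeasurable.aestronglyMeasurable (aemeasurable_pi_lambda _ fun i => (hm i).aemeasurable))
  refine le_trans (ENNReal.rpow_le_rpow ?_ hr0)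
    (lintegral_mul_rpow_le (hρ.ennreal_ofReal) hmv.enorm h1 hr)
  have h_integrable : Integrable (fun s => (WithLp.toLp 2 (fun i => (ρ s : ℂ) * g i s) : EuclideanSpace ℂ ι)) μ := by
    have := Integrable.of_eval (f := fun s i => (ρ s : ℂ) * g i s) (μ := μ) hg
    exact (PiLp.continuousLinearEquiv 2 ℂ (fun _ : ι => ℂ)).symm.toContinuousLinearMap.integrable_comp this
  have e : (WithLp.toLp 2 (fun i => ∫ s, (ρ s : ℂ) * g i s ∂μ) : EuclideanSpace ℂ ι) =
      ∫ s, (WithLp.toLp 2 (fun i => (ρ s : ℂ) * g i s) : EuclideanSpace ℂ ι) ∂μ := by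
    ext i
    have := (EuclideanSpace.proj (𝕜 := ℂ) i : EuclideanSpace ℂ ι →L[ℂ] ℂ).integral_comp_comm h_integrable
    simpa using this
  rw [e]
  refine (enorm_integral_le_lintegral_enorm _).trans (lintegral_mono_ae ?_)
  filter_upwards [hρ0] with s hs
  have : (WithLp.toLp 2 (fun i => (ρ s : ℂ) * g i s) : EuclideanSpace ℂ ι) =
      (ρ s : ℂ) • (WithLp.toLp 2 (fun i => g i s) : EuclideanSpace ℂ ι) := by
    ext i; simp
  rw [this, enorm_smul]
  gcongr
  rw [← ofReal_norm, Complex.norm_real, Real.norm_of_nonneg hs]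

lemma lintegral_ofReal_pois {w : ℝ} (hw : 0 < w) : ∫⁻ s, ENNReal.ofReal (pois s w) = 1 := by
  rw [← ofReal_integral_eq_lintegral_ofReal (integrable_pois hw)
    (ae_of_all _ fun s => pois_nonneg s hw), integral_pois hw, ENNReal.ofReal_one]

lemma poisson_contract {ι : Type*} [Fintype ι] {g : ι → ℝ → ℂ} (hm : ∀ i, Measurable (g i))
    {w : ℝ} (hw : 0 < w) (hg : ∀ i x, Integrable (fun s => (pois s w : ℂ) * g i (x + s)))
    {r : ℝ} (hr : 1 ≤ r) :
    ∫⁻ x, ENNReal.ofReal ((∑ i, ‖∫ s, (pois s w : ℂ) * g i (x + s)‖ ^ 2) ^ (r / 2)) ≤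
      ∫⁻ x, ENNReal.ofReal ((∑ i, ‖g i x‖ ^ 2) ^ (r / 2)) := by
  have hM : Measurable (fun x => ENNReal.ofReal ((∑ i, ‖g i x‖ ^ 2) ^ (r / 2))) := by fun_prop
  calc _ ≤ ∫⁻ x, ∫⁻ s, ENNReal.ofReal (pois s w) *
        ENNReal.ofReal ((∑ i, ‖g i (x + s)‖ ^ 2) ^ (r / 2)) :=
      lintegral_mono fun x => jensen_sq (continuous_pois hw).measurable
        (ae_of_all _ fun s => pois_nonneg s hw) (lintegral_ofReal_pois hw)
        (fun i => ((hm i).comp (measurable_const_add x)).aestronglyMeasurable) (fun i => hg i x) hr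
    _ = ∫⁻ s, ∫⁻ x, ENNReal.ofReal (pois s w) *
        ENNReal.ofReal ((∑ i, ‖g i (x + s)‖ ^ 2) ^ (r / 2)) := by
      have hM2 : Measurable (fun z : ℝ × ℝ => ENNReal.ofReal (pois z.2 w) *
          ENNReal.ofReal ((∑ i, ‖g i (z.1 + z.2)‖ ^ 2) ^ (r / 2))) :=
        (((continuous_pois hw).measurable.comp measurable_snd).ennreal_ofReal).mul
          (hM.comp (measurable_fst.add measurable_snd))
      exact lintegral_lintegral_swap hM2.aemeasurable
    _ = ∫⁻ s, ENNReal.ofReal (pois s w) *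
        ∫⁻ x, ENNReal.ofReal ((∑ i, ‖g i x‖ ^ 2) ^ (r / 2)) := by
      refine lintegral_congr fun s => ?_
      rw [lintegral_const_mul' _ _ ENNReal.ofReal_ne_top,
        lintegral_add_right_eq_self (fun x => ENNReal.ofReal ((∑ i, ‖g i x‖ ^ 2) ^ (r / 2))) s]
    _ = _ := by
      rw [lintegral_mul_const _ (continuous_pois hw).measurable.ennreal_ofReal,
        lintegral_ofReal_pois hw, one_mul]

/-- The function on the line with frequency profile `Ψ`. -/
def syn (Ψ : ℝ → ℂ) (x : ℝ) : ℂ := ∫ τ : ℝ, Ψ τ * Complex.exp (Complex.I * x * τ)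

lemma norm_exp_I_mul_mul (x τ : ℝ) : ‖Complex.exp (Complex.I * x * τ)‖ = 1 := by
  rw [Complex.norm_exp]; simp

lemma integrable_mul_exp {Ψ : ℝ → ℂ} {μ : Measure ℝ} (h : Integrable Ψ μ) (x : ℝ) :
    Integrable (fun τ : ℝ => Ψ τ * Complex.exp (Complex.I * x * τ)) μ :=
  h.mul_bdd (c := 1) (Continuous.aestronglyMeasurable (by fun_prop))
    (ae_of_all _ fun τ => (norm_exp_I_mul_mul x τ).le)

lemma norm_syn_le (Ψ : ℝ → ℂ) (x : ℝ) : ‖syn Ψ x‖ ≤ ∫ τ, ‖Ψ τ‖ := by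
  refine (norm_integral_le_integral_norm _).trans (le_of_eq ?_)
  simp only [norm_mul, norm_exp_I_mul_mul, mul_one]

lemma continuous_syn {Ψ : ℝ → ℂ} (h : Integrable Ψ) : Continuous (syn Ψ) := by
  refine continuous_of_dominated (bound := fun τ => ‖Ψ τ‖) (fun x => (integrable_mul_exp h x).1)
    (fun x => ae_of_all _ fun τ => ?_) h.norm (ae_of_all _ fun τ => by fun_prop)
  rw [norm_mul, norm_exp_I_mul_mul, mul_one]

lemma integrable_pois_mul {g : ℝ → ℂ} {w : ℝ} (hw : 0 < w) (hg : Continuous g) {C : ℝ}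
    (hb : ∀ x, ‖g x‖ ≤ C) (x : ℝ) : Integrable (fun s => (pois s w : ℂ) * g (x + s)) :=
  (integrable_pois hw).ofReal.mul_bdd (c := C) (Continuous.aestronglyMeasurable (by fun_prop))
    (ae_of_all _ fun τ => hb _)

lemma pois_syn {Ψ : ℝ → ℂ} (h : Integrable Ψ) {w : ℝ} (hw : 0 < w) (x : ℝ) :
    ∫ s, (pois s w : ℂ) * syn Ψ (x + s) = syn (fun τ => Real.exp (-w * |τ|) * Ψ τ) x := by
  unfold syn
  simp_rw [← integral_const_mul]
  have hI : Integrable (fun z : ℝ × ℝ => (pois z.1 w : ℂ) * Ψ z.2) (volume.prod volume) :=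
    (integrable_pois hw).ofReal.mul_prod h
  have hI2 : Integrable (fun z : ℝ × ℝ => (pois z.1 w : ℂ) *
      (Ψ z.2 * Complex.exp (Complex.I * ((x + z.1 : ℝ) : ℂ) * z.2))) (volume.prod volume) := by
    have := hI.mul_bdd (c := 1)
      (g := fun z : ℝ × ℝ => Complex.exp (Complex.I * ((x + z.1 : ℝ) : ℂ) * z.2))
      (Continuous.aestronglyMeasurable (by fun_prop))
      (ae_of_all _ fun τ => (norm_exp_I_mul_mul _ _).le)
    simpa only [mul_assoc] using this
  rw [integral_integral_swap hI2]
  congr 1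
  ext τ
  rw [← integral_pois_mul_exp hw, ← integral_mul_const, ← integral_mul_const]
  congr 1
  ext s
  have : Complex.exp (Complex.I * ((x + s : ℝ) : ℂ) * τ) =
      Complex.exp (Complex.I * x * τ) * Complex.exp (Complex.I * s * τ) := by
    rw [← Complex.exp_add]; congr 1; push_cast; ring
  rw [this]
  ring

lemma syn_contract {ι : Type*} [Fintype ι] {Ψ : ι → ℝ → ℂ} (h : ∀ i, Integrable (Ψ i)) {w : ℝ}
    (hw : 0 < w) {r : ℝ} (hr : 1 ≤ r) :
    ∫⁻ x, ENNReal.ofReal ((∑ i, ‖syn (fun τ => Real.exp (-w * |τ|) * Ψ i τ) x‖ ^ 2) ^ (r / 2)) ≤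
      ∫⁻ x, ENNReal.ofReal ((∑ i, ‖syn (Ψ i) x‖ ^ 2) ^ (r / 2)) := by
  simp_rw [← pois_syn (h _) hw]
  exact poisson_contract (fun i => (continuous_syn (h i)).measurable) hw
    (fun i x => integrable_pois_mul hw (continuous_syn (h i)) (norm_syn_le (Ψ i)) x) hr

/-- Differentiable integrable functions with integrable derivative. -/
def C1Int (Φ : ℝ → ℂ) : Prop :=
  ∃ Φ' : ℝ → ℂ, (∀ τ, HasDerivAt Φ (Φ' τ) τ) ∧ Integrable Φ ∧ Integrable Φ'

lemma C1Int.integrable {Φ : ℝ → ℂ} (h : C1Int Φ) : Integrable Φ := by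
  obtain ⟨_, _, h, _⟩ := h; exact h

lemma C1Int.continuous {Φ : ℝ → ℂ} (h : C1Int Φ) : Continuous Φ := by
  obtain ⟨_, h, _⟩ := h
  exact continuous_iff_continuousAt.2 fun t => (h t).continuousAt

lemma C1Int.add_const {Φ : ℝ → ℂ} (h : C1Int Φ) (c : ℝ) : C1Int (fun τ => Φ (τ + c)) := by
  obtain ⟨Φ', h1, h2, h3⟩ := h
  exact ⟨fun τ => Φ' (τ + c), fun τ => (h1 (τ + c)).comp_add_const τ c,
    h2.comp_add_right c, h3.comp_add_right c⟩

lemma C1Int.conj_const_sub {Φ : ℝ → ℂ} (h : C1Int Φ) (c : ℝ) :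
    C1Int (fun τ => starRingEnd ℂ (Φ (c - τ))) := by
  obtain ⟨Φ', h1, h2, h3⟩ := h
  refine ⟨fun τ => starRingEnd ℂ (-Φ' (c - τ)), fun τ => ?_, ?_, ?_⟩
  · have := (h1 (c - τ)).comp_const_sub c τ
    exact Complex.conjCLE.toContinuousLinearMap.hasFDerivAt.comp_hasDerivAt τ this
  · exact Complex.conjCLE.toContinuousLinearMap.integrable_comp (h2.comp_sub_left c)
  · exact Complex.conjCLE.toContinuousLinearMap.integrable_comp (h3.comp_sub_left c).neg

lemma C1Int.mul_of_pos {Φ : ℝ → ℂ} (h : C1Int Φ) (h0 : ∀ τ < 0, Φ τ = 0) {m m' : ℝ → ℝ}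
    (hm : Measurable m) (hm' : Measurable m')
    (hd : ∀ τ, 0 < τ → HasDerivAt m (m' τ) τ) {M : ℝ} (hM : ∀ τ, 0 ≤ τ → |m τ| ≤ M)
    (hM' : ∀ τ, 0 ≤ τ → |m' τ| ≤ M) : C1Int (fun τ => (m τ : ℂ) * Φ τ) := by
  have hc := h.continuous
  obtain ⟨Φ', h1, h2, h3⟩ := h
  have hz : Φ 0 = 0 := by
    have : Tendsto Φ (𝓝[<] 0) (𝓝 (Φ 0)) := hc.continuousAt.continuousWithinAt
    refine tendsto_nhds_unique this (tendsto_const_nhds.congr' ?_)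
    filter_upwards [self_mem_nhdsWithin] with t ht using (h0 t ht).symm
  have hn : ∀ τ < 0, Φ' τ = 0 := fun τ hτ =>
    (h1 τ).unique ((hasDerivAt_const τ (0:ℂ)).congr_of_eventuallyEq
      (by filter_upwards [Iio_mem_nhds hτ] with t ht using h0 t ht))
  have hz' : Φ' 0 = 0 := by
    have ha := (h1 0).hasDerivWithinAt (s := Set.Iic 0)
    have hb : HasDerivWithinAt Φ 0 (Set.Iic 0) 0 :=
      (hasDerivWithinAt_const 0 (Set.Iic (0:ℝ)) (0:ℂ)).congr (fun t ht => by
        rcases (Set.mem_Iic.1 ht).lt_or_eq with h | h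
        · exact h0 t h
        · rw [h, hz]) hz
    exact (uniqueDiffWithinAt_Iic (0:ℝ)).eq_deriv _ ha hb
  have hM0 : 0 ≤ M := (abs_nonneg _).trans (hM 0 le_rfl)
  have key : ∀ (n : ℝ → ℝ) (Ψ : ℝ → ℂ), Measurable n → (∀ τ, 0 ≤ τ → |n τ| ≤ M) →
      (∀ τ < 0, Ψ τ = 0) → Integrable Ψ → Integrable (fun τ => (n τ : ℂ) * Ψ τ) := by
    intro n Ψ hn hb hΨ hI
    refine (hI.norm.const_mul M).mono' (hn.complex_ofReal.aestronglyMeasurable.mul hI.1)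
      (ae_of_all _ fun τ => ?_)
    rw [norm_mul, Complex.norm_real, Real.norm_eq_abs]
    rcases lt_or_ge τ 0 with ht | ht
    · simp [hΨ τ ht]
    · exact mul_le_mul_of_nonneg_right (hb τ ht) (norm_nonneg _)
  refine ⟨fun τ => (m' τ : ℂ) * Φ τ + (m τ : ℂ) * Φ' τ, fun τ => ?_,
    key m Φ hm hM h0 h2, (key m' Φ hm' hM' h0 h2).add (key m Φ' hm hM hn h3)⟩
  rcases lt_trichotomy τ 0 with ht | rfl | ht
  · beta_reduce
    rw [h0 τ ht, hn τ ht, mul_zero, mul_zero, add_zero]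
    refine (hasDerivAt_const τ (0:ℂ)).congr_of_eventuallyEq ?_
    filter_upwards [Iio_mem_nhds ht] with t ht
    rw [h0 t ht, mul_zero]
  · beta_reduce
    rw [hz, hz', mul_zero, mul_zero, add_zero, hasDerivAt_iff_isLittleO]
    have hl := (hasDerivAt_iff_isLittleO.1 (hz' ▸ h1 0))
    simp only [hz, smul_zero, sub_zero, mul_zero] at hl ⊢
    refine Asymptotics.IsBigO.trans_isLittleO ?_ hl
    refine Asymptotics.IsBigO.of_bound M (Eventually.of_forall fun t => ?_)
    rw [norm_mul, Complex.norm_real, Real.norm_eq_abs]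
    rcases lt_or_ge t 0 with ht | ht
    · simp [h0 t ht]
    · exact mul_le_mul_of_nonneg_right (hM t ht) (norm_nonneg _)
  · exact (hd τ ht).ofReal_comp.mul (h1 τ)

/-- The Fourier-Laplace transform on the upper half plane. -/
def Lap (α : ℝ → ℂ) (z : ℂ) : ℂ := ∫ τ in Set.Ioi (0:ℝ), Complex.exp (Complex.I * z * τ) * α τ

lemma norm_exp_I_mul_le {z : ℂ} (hz : 0 ≤ z.im) {τ : ℝ} (hτ : 0 ≤ τ) :
    ‖Complex.exp (Complex.I * z * τ)‖ ≤ 1 := by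
  rw [Complex.norm_exp]
  simp
  positivity

lemma integrableOn_exp_I_mul {α : ℝ → ℂ} (hα : Integrable α) {z : ℂ} (hz : 0 ≤ z.im) :
    IntegrableOn (fun τ : ℝ => Complex.exp (Complex.I * z * τ) * α τ) (Set.Ioi 0) := by
  refine hα.integrableOn.bdd_mul (c := 1) (Continuous.aestronglyMeasurable (by fun_prop)) ?_
  filter_upwards [ae_restrict_mem measurableSet_Ioi] with τ hτ
  exact norm_exp_I_mul_le hz (le_of_lt hτ)

lemma norm_Lap_le {α : ℝ → ℂ} (hα : Integrable α) {z : ℂ} (hz : 0 ≤ z.im) :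
    ‖Lap α z‖ ≤ ∫ τ, ‖α τ‖ := by
  refine (norm_integral_le_of_norm_le hα.norm.integrableOn ?_).trans
    (setIntegral_le_integral hα.norm (ae_of_all _ fun τ => norm_nonneg _))
  filter_upwards [ae_restrict_mem measurableSet_Ioi] with τ hτ
  rw [norm_mul]
  exact mul_le_of_le_one_left (norm_nonneg _) (norm_exp_I_mul_le hz (le_of_lt hτ))

lemma hasDerivAt_Lap {α : ℝ → ℂ} (hα : Integrable α) {z : ℂ} (hz : 0 < z.im) :
    HasDerivAt (Lap α) (∫ τ in Set.Ioi (0:ℝ), Complex.I * τ *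
      (Complex.exp (Complex.I * z * τ) * α τ)) z := by
  have hball : ∀ x ∈ Metric.ball z (z.im / 2), z.im / 2 ≤ x.im := by
    intro x hx
    have h1 : |(x - z).im| ≤ z.im / 2 :=
      (Complex.abs_im_le_norm _).trans (by simpa [dist_eq_norm] using (Metric.mem_ball.1 hx).le)
    rw [Complex.sub_im, abs_le] at h1
    linarith [h1.1]
  refine (hasDerivAt_integral_of_dominated_loc_of_deriv_le
    (bound := fun τ => (2 / z.im) * ‖α τ‖) (F := fun z τ => Complex.exp (Complex.I * z * τ) * α τ)
    (F' := fun z τ => Complex.I * τ * (Complex.exp (Complex.I * z * τ) * α τ))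
    (Metric.ball_mem_nhds z (half_pos hz)) ?_ ?_ ?_ ?_ ?_ ?_).2
  · exact Eventually.of_forall fun x => (Continuous.aestronglyMeasurable (by fun_prop)).mul
      hα.1.restrict
  · exact integrableOn_exp_I_mul hα hz.le
  · exact (Continuous.aestronglyMeasurable (by fun_prop)).mul
      ((Continuous.aestronglyMeasurable (by fun_prop)).mul hα.1.restrict)
  · filter_upwards [ae_restrict_mem measurableSet_Ioi] with τ hτ x hx
    rw [Set.mem_Ioi] at hτ
    rw [← mul_assoc, norm_mul]
    refine mul_le_mul_of_nonneg_right ?_ (norm_nonneg _)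
    rw [norm_mul, norm_mul, Complex.norm_I, one_mul, Complex.norm_real, Real.norm_of_nonneg hτ.le,
      Complex.norm_exp]
    have h2 : (Complex.I * x * τ).re ≤ -(z.im / 2 * τ) := by
      have := mul_le_mul_of_nonneg_right (hball x hx) hτ.le
      simp
      linarith
    calc τ * Real.exp _ ≤ τ * Real.exp (-(z.im / 2 * τ)) := by gcongr
      _ ≤ 2 / z.im := by
        rw [Real.exp_neg, ← div_eq_mul_inv, div_le_div_iff₀ (Real.exp_pos _) hz]
        linarith [Real.add_one_le_exp (z.im / 2 * τ)]
  · exact (hα.norm.const_mul _).integrableOn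
  · refine ae_of_all _ fun τ x hx => ?_
    have : HasDerivAt (fun x : ℂ => Complex.exp (Complex.I * x * τ))
        (Complex.exp (Complex.I * x * τ) * (Complex.I * τ)) x := by
      refine HasDerivAt.cexp ?_
      simpa using (((hasDerivAt_id x).const_mul Complex.I).mul_const (τ : ℂ))
    exact (this.mul_const (α τ)).congr_deriv (by ring)

lemma C1Int.uhpDecay {α : ℝ → ℂ} (h : C1Int α) : UHPDecay (Lap α) := by
  have hα := h.integrable
  refine ⟨fun z hz => (hasDerivAt_Lap hα hz).differentiableAt.differentiableWithinAt,
    fun y₀ h0 => ?_⟩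
  obtain ⟨Φ', h1, h2, h3⟩ := h
  refine ⟨(∫ τ, ‖α τ‖) + (‖α 0‖ + ∫ τ, ‖Φ' τ‖), by positivity, fun z hz => ?_⟩
  have hz0 : 0 < z.im := h0.trans_le hz
  have hd : ∀ τ : ℝ, HasDerivAt (fun τ : ℝ => Complex.exp (Complex.I * z * τ) * α τ)
      (Complex.I * z * (Complex.exp (Complex.I * z * τ) * α τ) +
        Complex.exp (Complex.I * z * τ) * Φ' τ) τ := by
    intro τ
    have h5 : HasDerivAt (fun τ : ℝ => Complex.exp (Complex.I * z * τ))
        (Complex.exp (Complex.I * z * τ) * (Complex.I * z)) τ := by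
      refine HasDerivAt.cexp ?_
      simpa using ((hasDerivAt_id τ).ofReal_comp.const_mul (Complex.I * z))
    exact (h5.mul (h1 τ)).congr_deriv (by ring)
  have hi1 := (integrableOn_exp_I_mul hα hz0.le).const_mul (Complex.I * z)
  have hi2 := integrableOn_exp_I_mul h3 hz0.le
  have ht := tendsto_zero_of_hasDerivAt_of_integrableOn_Ioi (a := 0) (fun τ _ => hd τ)
    (hi1.add hi2) (integrableOn_exp_I_mul hα hz0.le)
  have hI := integral_Ioi_of_hasDerivAt_of_tendsto (a := 0) (hd 0).continuousAt.continuousWithinAt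
    (fun τ _ => hd τ) (hi1.add hi2) ht
  rw [integral_add hi1 hi2, integral_const_mul] at hI
  simp only [Complex.ofReal_zero, mul_zero, Complex.exp_zero, one_mul, zero_sub] at hI
  have e : Complex.I * z * Lap α z = -α 0 - Lap Φ' z := eq_sub_of_add_eq hI
  have h6 : ‖z‖ * ‖Lap α z‖ ≤ ‖α 0‖ + ∫ τ, ‖Φ' τ‖ := by
    have := congrArg norm e
    rw [norm_mul, norm_mul, Complex.norm_I, one_mul] at this
    rw [this]
    refine (norm_sub_le _ _).trans ?_
    rw [norm_neg]
    gcongr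
    exact norm_Lap_le h3 hz0.le
  rw [le_div_iff₀ (by positivity)]
  linarith [norm_Lap_le hα hz0.le]

lemma exp_I_upt (x w τ : ℝ) : Complex.exp (Complex.I * upt x w * τ) =
    Complex.exp (Complex.I * x * τ) * Real.exp (-w * τ) := by
  rw [Complex.ofReal_exp, ← Complex.exp_add]
  congr 1
  simp only [upt, Complex.ofReal_mul, Complex.ofReal_neg]
  linear_combination (w : ℂ) * τ * Complex.I_sq

lemma integrable_expAbs_mul {Ψ : ℝ → ℂ} (h : Integrable Ψ) {w : ℝ} (hw : 0 ≤ w) :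
    Integrable (fun τ => (Real.exp (-w * |τ|) : ℂ) * Ψ τ) := by
  refine h.bdd_mul (c := 1) (Continuous.aestronglyMeasurable (by fun_prop))
    (ae_of_all _ fun τ => ?_)
  rw [Complex.norm_real, Real.norm_of_nonneg (Real.exp_pos _).le, Real.exp_le_one_iff]
  have := mul_nonneg hw (abs_nonneg τ)
  linarith

lemma Lap_shift_add_conj {Ψ : ℝ → ℂ} (h : Integrable Ψ) (c x : ℝ) {w : ℝ} (hw : 0 < w) :
    Lap (fun τ => Ψ (τ + c)) (upt x w) +
      starRingEnd ℂ (Lap (fun τ => starRingEnd ℂ (Ψ (c - τ))) (upt x w)) =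
    syn (fun τ => Real.exp (-w * |τ|) * Ψ (τ + c)) x := by
  have hI := integrable_mul_exp (integrable_expAbs_mul (h.comp_add_right c) hw.le) x
  unfold syn
  rw [← integral_add_compl measurableSet_Iic hI (s := Set.Iic 0), Set.compl_Iic, add_comm]
  congr 1
  · unfold Lap
    rw [← integral_conj, ← neg_zero, ← integral_comp_neg_Iic, neg_zero]
    refine setIntegral_congr_fun measurableSet_Iic fun τ hτ => ?_
    beta_reduce
    rw [exp_I_upt, abs_of_nonpos (Set.mem_Iic.1 hτ), map_mul, map_mul, Complex.conj_conj,
      Complex.conj_ofReal, ← Complex.exp_conj, sub_neg_eq_add, add_comm c τ]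
    simp only [map_mul, Complex.conj_I, Complex.conj_ofReal, Complex.ofReal_neg, map_neg]
    ring_nf
  · unfold Lap
    refine setIntegral_congr_fun measurableSet_Ioi fun τ hτ => ?_
    beta_reduce
    rw [exp_I_upt, abs_of_pos (Set.mem_Ioi.1 hτ)]
    ring

lemma syn_add_const (Ψ : ℝ → ℂ) (c x : ℝ) :
    syn (fun τ => Ψ (τ + c)) x = Complex.exp (-(Complex.I * x * c)) * syn Ψ x := by
  unfold syn
  rw [← integral_const_mul, ← integral_add_right_eq_self
    (fun τ : ℝ => Complex.exp (-(Complex.I * x * c)) * (Ψ τ * Complex.exp (Complex.I * x * τ))) c]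
  congr 1
  ext τ
  rw [mul_left_comm, ← Complex.exp_add]
  congr 2
  push_cast
  ring

lemma norm_syn_add_const (Ψ : ℝ → ℂ) (c x : ℝ) : ‖syn (fun τ => Ψ (τ + c)) x‖ = ‖syn Ψ x‖ := by
  rw [syn_add_const, norm_mul, Complex.norm_exp]
  simp

lemma syn_indicator_add_const (Ψ : ℝ → ℂ) (c x : ℝ) :
    ‖∫ τ in Set.Ioi (0:ℝ), Complex.exp (Complex.I * x * τ) * Ψ (τ + c)‖ =
      ‖syn ((Set.Ioi c).indicator Ψ) x‖ := by
  rw [← norm_syn_add_const _ c x, syn, ← integral_indicator measurableSet_Ioi]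
  congr 2
  ext τ
  by_cases hτ : 0 < τ
  · rw [Set.indicator_of_mem (by exact hτ), Set.indicator_of_mem (by simpa using hτ), mul_comm]
  · rw [Set.indicator_of_notMem (by exact hτ), Set.indicator_of_notMem (by simpa using hτ), zero_mul]

lemma tendsto_Lap_upt {α : ℝ → ℂ} (hα : Integrable α) (x : ℝ) :
    Tendsto (fun n => Lap α (upt x (epsSeq n))) atTop
      (𝓝 (∫ τ in Set.Ioi (0:ℝ), Complex.exp (Complex.I * x * τ) * α τ)) := by
  refine tendsto_integral_of_dominated_convergence (fun τ => ‖α τ‖)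
    (fun n => (integrableOn_exp_I_mul hα (by simpa using (epsSeq_pos n).le)).1)
    hα.norm.integrableOn (fun n => ?_) (ae_of_all _ fun τ => ?_)
  · filter_upwards [ae_restrict_mem measurableSet_Ioi] with τ hτ
    rw [norm_mul]
    exact mul_le_of_le_one_left (norm_nonneg _)
      (norm_exp_I_mul_le (by simpa using (epsSeq_pos n).le) (le_of_lt hτ))
  · have h1 : Continuous (fun y : ℝ => Complex.exp (Complex.I * upt x y * τ) * α τ) := by
      unfold upt; fun_prop
    have h2 := (h1.tendsto 0).comp tendsto_epsSeq
    simpa [upt, Function.comp_def] using h2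

lemma riesz_boundary {ι : Type*} [Fintype ι] {Ψ : ι → ℝ → ℂ} (h : ∀ i, C1Int (Ψ i)) (c : ι → ℝ)
    {p : ℝ} (hp1 : 1 < p) (hp2 : p < 2) :
    ∫⁻ x, ENNReal.ofReal ((∑ i, ‖syn ((Set.Ioi (c i)).indicator (Ψ i)) x‖ ^ 2) ^ (p / 2)) ≤
      ENNReal.ofReal (2 / (p - 1)) *
        ∫⁻ x, ENNReal.ofReal ((∑ i, ‖syn (Ψ i) x‖ ^ 2) ^ (p / 2)) := by
  have hp0 : 0 ≤ p / 2 := by linarith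
  have h1 := fun i => ((h i).add_const (c i)).uhpDecay
  have h2 := fun i => ((h i).conj_const_sub (c i)).uhpDecay
  simp_rw [← syn_indicator_add_const]
  refine lintegral_le_of_tendsto (f := fun n x =>
    ENNReal.ofReal ((∑ i, ‖Lap (fun τ => Ψ i (τ + c i)) (upt x (epsSeq n))‖ ^ 2) ^ (p / 2)))
    (fun n => ?_) (fun n => ?_) fun x => ?_
  · refine Continuous.aemeasurable ?_
    refine ENNReal.continuous_ofReal.comp (Continuous.rpow_const ?_ fun _ => Or.inr hp0)
    exact continuous_finsetSum _ fun i _ => ((h1 i).continuous (epsSeq_pos n)).norm.pow 2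
  · have hR := riesz_upper h1 h2 hp1 hp2 (epsSeq_pos n)
    simp_rw [Lap_shift_add_conj (h _).integrable _ _ (epsSeq_pos n)] at hR
    calc _ ≤ _ := lintegral_mono fun x => ENNReal.ofReal_le_ofReal
          (Real.rpow_le_rpow (by positivity)
            (Finset.sum_le_sum fun i _ => le_add_of_nonneg_right (by positivity)) hp0)
      _ ≤ _ := hR
      _ ≤ _ := by
        refine mul_le_mul_right ?_ _
        have := syn_contract (fun i => ((h i).add_const (c i)).integrable) (epsSeq_pos n) hp1.le
        simpa only [norm_syn_add_const] using this
  · refine ENNReal.tendsto_ofReal (Tendsto.rpow_const ?_ (Or.inr hp0))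
    exact tendsto_finsetSum _ fun i _ =>
      ((tendsto_Lap_upt ((h i).add_const (c i)).integrable x).norm.pow 2)

/-- Measurable functions which are integrable together with their first moment. -/
structure IntMom (h : ℝ → ℂ) : Prop where
  meas : Measurable h
  int : Integrable h
  mom : Integrable (fun t : ℝ => (t : ℂ) * h t)

lemma IntMom.conj {h : ℝ → ℂ} (hh : IntMom h) : IntMom (fun t => starRingEnd ℂ (h t)) where
  meas := Complex.continuous_conj.measurable.comp hh.meas
  int := Complex.conjCLE.toContinuousLinearMap.integrable_comp hh.int
  mom := by simpa using Complex.conjCLE.toContinuousLinearMap.integrable_comp hh.mom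

/-- The Cauchy transform. -/
def cauchyT (h : ℝ → ℂ) (z : ℂ) : ℂ := ∫ t : ℝ, h t * ((t : ℂ) - z)⁻¹

lemma im_le_norm_ofReal_sub (t : ℝ) (z : ℂ) : z.im ≤ ‖(t : ℂ) - z‖ := by
  have := Complex.abs_im_le_norm ((t : ℂ) - z)
  simp only [Complex.sub_im, Complex.ofReal_im, zero_sub, abs_neg] at this
  exact (le_abs_self _).trans this

lemma ofReal_sub_ne_zero (t : ℝ) {z : ℂ} (hz : 0 < z.im) : (t : ℂ) - z ≠ 0 := fun h => by
  have := im_le_norm_ofReal_sub t z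
  rw [h, norm_zero] at this
  linarith

lemma measurable_inv_sub (z : ℂ) : Measurable (fun t : ℝ => ((t : ℂ) - z)⁻¹) := by fun_prop

lemma integrable_cauchy {h : ℝ → ℂ} (hh : Integrable h) {z : ℂ} (hz : 0 < z.im) :
    Integrable (fun t : ℝ => h t * ((t : ℂ) - z)⁻¹) := by
  refine hh.mul_bdd (c := z.im⁻¹) (measurable_inv_sub z).aestronglyMeasurable
    (ae_of_all _ fun t => ?_)
  rw [norm_inv]
  exact inv_anti₀ hz (im_le_norm_ofReal_sub t z)

lemma hasDerivAt_cauchyT {h : ℝ → ℂ} (hh : Integrable h) {z : ℂ} (hz : 0 < z.im) :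
    HasDerivAt (cauchyT h) (∫ t : ℝ, h t * (((t : ℂ) - z) ^ 2)⁻¹) z := by
  have hball : ∀ x ∈ Metric.ball z (z.im / 2), z.im / 2 ≤ x.im := by
    intro x hx
    have h1 : |(x - z).im| ≤ z.im / 2 :=
      (Complex.abs_im_le_norm _).trans (by simpa [dist_eq_norm] using (Metric.mem_ball.1 hx).le)
    rw [Complex.sub_im, abs_le] at h1
    linarith [h1.1]
  refine (hasDerivAt_integral_of_dominated_loc_of_deriv_le
    (bound := fun t => ‖h t‖ * ((z.im / 2) ^ 2)⁻¹) (F := fun z (t : ℝ) => h t * ((t : ℂ) - z)⁻¹)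
    (F' := fun z (t : ℝ) => h t * (((t : ℂ) - z) ^ 2)⁻¹)
    (Metric.ball_mem_nhds z (half_pos hz)) ?_ ?_ ?_ ?_ ?_ ?_).2
  · exact Eventually.of_forall fun x => hh.1.mul (measurable_inv_sub x).aestronglyMeasurable
  · exact integrable_cauchy hh hz
  · exact hh.1.mul (Measurable.aestronglyMeasurable (by fun_prop))
  · refine ae_of_all _ fun t x hx => ?_
    rw [norm_mul, norm_inv, norm_pow]
    have := (hball x hx).trans (im_le_norm_ofReal_sub t x)
    gcongr
  · exact hh.norm.mul_const _
  · refine ae_of_all _ fun t x hx => ?_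
    have hx0 : 0 < x.im := (half_pos hz).trans_le (hball x hx)
    have := ((hasDerivAt_id x).const_sub (t : ℂ)).inv (ofReal_sub_ne_zero t hx0)
    exact (this.const_mul (h t)).congr_deriv (by simp [div_eq_mul_inv])

lemma IntMom.uhpDecay {h : ℝ → ℂ} (hh : IntMom h) : UHPDecay (cauchyT h) := by
  refine ⟨fun z hz => (hasDerivAt_cauchyT hh.int hz).differentiableAt.differentiableWithinAt,
    fun y₀ h0 => ?_⟩
  refine ⟨(∫ t, ‖h t‖) * y₀⁻¹ + ((∫ t : ℝ, ‖(t : ℂ) * h t‖) * y₀⁻¹ + ∫ t, ‖h t‖),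
    by positivity, fun z hz => ?_⟩
  have hz0 : 0 < z.im := h0.trans_le hz
  have hb : ∀ t : ℝ, ‖((t : ℂ) - z)⁻¹‖ ≤ y₀⁻¹ := fun t => by
    rw [norm_inv]
    exact inv_anti₀ h0 (hz.trans (im_le_norm_ofReal_sub t z))
  have hA : ∀ g : ℝ → ℂ, Integrable g → ‖cauchyT g z‖ ≤ (∫ t, ‖g t‖) * y₀⁻¹ := by
    intro g hg
    rw [← integral_mul_const]
    refine norm_integral_le_of_norm_le (hg.norm.mul_const _) (ae_of_all _ fun t => ?_)
    rw [norm_mul]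
    exact mul_le_mul_of_nonneg_left (hb t) (norm_nonneg _)
  have e : z * cauchyT h z = cauchyT (fun t => (t : ℂ) * h t) z - ∫ t, h t := by
    unfold cauchyT
    rw [← integral_const_mul, ← integral_sub (integrable_cauchy hh.mom hz0) hh.int]
    congr 1
    ext t
    have := ofReal_sub_ne_zero t hz0
    field_simp
    ring
  have h6 : ‖z‖ * ‖cauchyT h z‖ ≤ (∫ t : ℝ, ‖(t : ℂ) * h t‖) * y₀⁻¹ + ∫ t, ‖h t‖ := by
    rw [← norm_mul, e]
    exact (norm_sub_le _ _).trans (add_le_add (hA _ hh.mom) (norm_integral_le_integral_norm _))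
  rw [le_div_iff₀ (by positivity)]
  linarith [hA _ hh.int]

/-- The analytic half of the Poisson extension. -/
def cauchyA (h : ℝ → ℂ) (z : ℂ) : ℂ := (2 * Real.pi * Complex.I)⁻¹ * cauchyT h z

lemma IntMom.cauchyA_uhpDecay {h : ℝ → ℂ} (hh : IntMom h) : UHPDecay (cauchyA h) :=
  hh.uhpDecay.const_mul _

lemma integral_pois_add (h : ℝ → ℂ) (x w : ℝ) :
    ∫ t, (pois (t - x) w : ℂ) * h t = ∫ s, (pois s w : ℂ) * h (x + s) := by
  rw [← integral_add_left_eq_self (fun t => (pois (t - x) w : ℂ) * h t) x]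
  simp

/-- The Poisson extension. -/
def poisExt (h : ℝ → ℂ) (x w : ℝ) : ℂ :=
  cauchyA h (upt x w) + starRingEnd ℂ (cauchyA (fun t => starRingEnd ℂ (h t)) (upt x w))

lemma poisExt_eq {h : ℝ → ℂ} (hh : Integrable h) (x : ℝ) {w : ℝ} (hw : 0 < w) :
    poisExt h x w = ∫ t, (pois (t - x) w : ℂ) * h t := by
  have hz : 0 < (upt x w).im := by simpa using hw
  have hz' : ∀ t : ℝ, (t : ℂ) - starRingEnd ℂ (upt x w) ≠ 0 := fun t h => by
    refine ofReal_sub_ne_zero t hz ?_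
    have := congrArg (starRingEnd ℂ) h
    simpa using this
  have hI2 : Integrable (fun t : ℝ => h t * ((t : ℂ) - starRingEnd ℂ (upt x w))⁻¹) := by
    have := Complex.conjCLE.toContinuousLinearMap.integrable_comp
      (integrable_cauchy (Complex.conjCLE.toContinuousLinearMap.integrable_comp hh) hz)
    simpa using this
  unfold poisExt cauchyA cauchyT
  rw [map_mul, ← integral_conj]
  simp only [map_mul, map_inv₀, map_sub, Complex.conj_conj, Complex.conj_ofReal, Complex.conj_I,
    map_ofNat]
  rw [← integral_const_mul, ← integral_const_mul,
    ← integral_add ((integrable_cauchy hh hz).const_mul _) (hI2.const_mul _)]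
  congr 1
  ext t
  have hpi : (Real.pi : ℂ) ≠ 0 := by exact_mod_cast Real.pi_ne_zero
  have e : ((t - x : ℝ) : ℂ) ^ 2 + (w : ℂ) ^ 2 =
      ((t : ℂ) - upt x w) * ((t : ℂ) - starRingEnd ℂ (upt x w)) := by
    simp only [upt, map_add, map_mul, Complex.conj_ofReal, Complex.conj_I]
    push_cast
    linear_combination (w : ℂ) ^ 2 * Complex.I_sq
  have h1 := ofReal_sub_ne_zero t hz
  have h2 := hz' t
  unfold pois
  rw [Complex.ofReal_div, Complex.ofReal_mul, Complex.ofReal_add, Complex.ofReal_pow,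
    Complex.ofReal_pow, e]
  have e2 : upt x w - starRingEnd ℂ (upt x w) = 2 * Complex.I * w := by
    simp only [upt, map_add, map_mul, Complex.conj_ofReal, Complex.conj_I]; ring
  field_simp
  have e3 : (t : ℂ) - starRingEnd ℂ (upt x w) - (t - upt x w) = 2 * Complex.I * w := by
    rw [← e2]; ring
  linear_combination h t * e3

/-- The horizontal derivative of the Poisson extension. -/
def poisExtX (h : ℝ → ℂ) (x w : ℝ) : ℂ :=
  deriv (cauchyA h) (upt x w) +
    starRingEnd ℂ (deriv (cauchyA (fun t => starRingEnd ℂ (h t))) (upt x w))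

lemma measurable_upt : Measurable (fun z : ℝ × ℝ => upt z.1 z.2) := by
  unfold upt; fun_prop

lemma measurable_deriv_upt (F : ℂ → ℂ) : Measurable (fun z : ℝ × ℝ => deriv F (upt z.1 z.2)) :=
  (measurable_deriv F).comp measurable_upt

lemma measurable_poisExtX (h : ℝ → ℂ) : Measurable (fun z : ℝ × ℝ => poisExtX h z.1 z.2) :=
  (measurable_deriv_upt _).add
    (Complex.continuous_conj.measurable.comp (measurable_deriv_upt _))

lemma hasDerivAt_poisExt {h : ℝ → ℂ} (hh : IntMom h) (x : ℝ) {w : ℝ} (hw : 0 < w) :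
    HasDerivAt (fun x => poisExt h x w) (poisExtX h x w) x :=
  (hh.cauchyA_uhpDecay.hasDerivAt_left hw).add
    (Complex.conjCLE.toContinuousLinearMap.hasFDerivAt.comp_hasDerivAt x
      (hh.conj.cauchyA_uhpDecay.hasDerivAt_left hw))

lemma Lap_upt_eq_syn {Φ : ℝ → ℂ} (h0 : ∀ τ < 0, Φ τ = 0) (x w : ℝ) :
    Lap Φ (upt x w) = syn (fun τ => Real.exp (-w * |τ|) * Φ τ) x := by
  unfold Lap syn
  rw [← integral_Ici_eq_integral_Ioi, ← integral_indicator measurableSet_Ici]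
  congr 1
  ext τ
  by_cases hτ : 0 ≤ τ
  · beta_reduce
    rw [Set.indicator_of_mem (by exact hτ), exp_I_upt, abs_of_nonneg hτ]
    ring
  · beta_reduce
    rw [Set.indicator_of_notMem (by exact hτ), h0 τ (not_le.1 hτ)]
    simp

lemma bellman_boundary {ι κ : Type*} [Fintype ι] [Fintype κ] {Φ : ι → ℝ → ℂ}
    (hΦ : ∀ i, C1Int (Φ i)) (h0 : ∀ i, ∀ τ < 0, Φ i τ = 0) {h : κ → ℝ → ℂ}
    (hh : ∀ k, IntMom (h k)) (hb : ∀ k, ∃ C, ∀ t, ‖h k t‖ ≤ C) {p P Q γ : ℝ} (hB : BellmanExp p P Q γ) :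
    ∫⁻ y in Set.Ioi (0:ℝ), ENNReal.ofReal y * ∫⁻ x, ENNReal.ofReal
        (2 * (Real.sqrt (∑ i, ‖deriv (Lap (Φ i)) (upt x y)‖ ^ 2) *
          Real.sqrt (∑ k, ‖poisExtX (h k) x y‖ ^ 2))) ≤
      19 * ((∫⁻ x, ENNReal.ofReal ((∑ i, ‖syn (Φ i) x‖ ^ 2) ^ P)) +
        ∫⁻ x, ENNReal.ofReal ((∑ k, ‖h k x‖ ^ 2) ^ Q)) := by
  set G : ℝ → ℝ≥0∞ := fun y => ∫⁻ x, ENNReal.ofReal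
        (2 * (Real.sqrt (∑ i, ‖deriv (Lap (Φ i)) (upt x y)‖ ^ 2) *
          Real.sqrt (∑ k, ‖poisExtX (h k) x y‖ ^ 2))) with hG
  have hGm : Measurable G := by
    have : Measurable (fun z : ℝ × ℝ => ENNReal.ofReal
        (2 * (Real.sqrt (∑ i, ‖deriv (Lap (Φ i)) (upt z.1 z.2)‖ ^ 2) *
          Real.sqrt (∑ k, ‖poisExtX (h k) z.1 z.2‖ ^ 2)))) := by
      have h1 : ∀ i, Measurable (fun z : ℝ × ℝ => deriv (Lap (Φ i)) (upt z.1 z.2)) :=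
        fun i => measurable_deriv_upt _
      have h2 := fun k => measurable_poisExtX (h k)
      refine Measurable.ennreal_ofReal (Measurable.const_mul (Measurable.mul ?_ ?_) _)
      · exact (Finset.measurable_sum _ fun i _ => (h1 i).norm.pow_const 2).sqrt
      · exact (Finset.measurable_sum _ fun i _ => (h2 i).norm.pow_const 2).sqrt
    exact this.lintegral_prod_left'
  rw [← lintegral_indicator measurableSet_Ioi]
  refine lintegral_le_of_tendsto
    (f := fun n => (Set.Ioi (epsSeq n)).indicator fun y => ENNReal.ofReal (y - epsSeq n) * G y)
    (fun n => ?_) (fun n => ?_) fun y => ?_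
  · exact ((((measurable_id.sub_const _).ennreal_ofReal).mul hGm).indicator
      measurableSet_Ioi).aemeasurable
  · rw [lintegral_indicator measurableSet_Ioi]
    refine (bellman_upper (fun i => (hΦ i).uhpDecay) (fun k => (hh k).cauchyA_uhpDecay)
      (fun k => (hh k).conj.cauchyA_uhpDecay) hB (epsSeq_pos n)).trans ?_
    gcongr 19 * (?_ + ?_)
    · simp_rw [Lap_upt_eq_syn (h0 _)]
      have := syn_contract (fun i => (hΦ i).integrable) (epsSeq_pos n) (r := 2 * P)
        (by linarith [hB.half_le])
      simpa only [mul_div_cancel_left₀ P two_ne_zero] using this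
    · have e : ∀ k x, cauchyA (h k) (upt x (epsSeq n)) + starRingEnd ℂ
          (cauchyA (fun t => starRingEnd ℂ (h k t)) (upt x (epsSeq n))) =
          ∫ s, (pois s (epsSeq n) : ℂ) * h k (x + s) := fun k x => by
        rw [← integral_pois_add, ← poisExt_eq (hh k).int x (epsSeq_pos n)]; rfl
      simp_rw [e]
      have := poisson_contract (g := h) (fun k => (hh k).meas) (epsSeq_pos n) (fun k x => ?_)
        (r := 2 * Q) (by linarith [hB.Q_ge])
      · simpa only [mul_div_cancel_left₀ Q two_ne_zero] using this
      · obtain ⟨C, hC⟩ := hb k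
        exact (integrable_pois (epsSeq_pos n)).ofReal.mul_bdd (c := C)
          ((hh k).meas.comp (measurable_const_add x)).aestronglyMeasurable
          (ae_of_all _ fun τ => hC _)
  · by_cases hy : 0 < y
    · rw [Set.indicator_of_mem (by exact hy)]
      have h1 : Tendsto (fun n => ENNReal.ofReal (y - epsSeq n) * G y) atTop
          (𝓝 (ENNReal.ofReal y * G y)) := by
        refine ENNReal.Tendsto.mul_const ?_ (Or.inl (by simpa using hy))
        have := tendsto_const_nhds (x := y) (f := atTop) |>.sub tendsto_epsSeq
        rw [sub_zero] at this
        exact ENNReal.tendsto_ofReal this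
      refine h1.congr' ?_
      filter_upwards [tendsto_epsSeq.eventually_lt_const hy] with n hn
      rw [Set.indicator_of_mem (by exact hn)]
    · rw [Set.indicator_of_notMem (by exact hy)]
      refine tendsto_const_nhds.congr fun n => ?_
      rw [Set.indicator_of_notMem]
      intro h
      exact hy ((epsSeq_pos n).trans h)

lemma integral_mul_syn {f g : ℝ → ℂ} (hf : Integrable f) (hg : Integrable g) :
    ∫ t, f t * syn g t = ∫ τ, g τ * syn f τ := by
  unfold syn
  simp_rw [← integral_const_mul]
  have hI : Integrable (fun z : ℝ × ℝ => f z.1 * (g z.2 *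
      Complex.exp (Complex.I * z.1 * z.2))) (volume.prod volume) := by
    have := (hf.mul_prod hg).mul_bdd (c := 1)
      (g := fun z : ℝ × ℝ => Complex.exp (Complex.I * z.1 * z.2))
      (Continuous.aestronglyMeasurable (by fun_prop))
      (ae_of_all _ fun τ => (norm_exp_I_mul_mul _ _).le)
    simpa only [mul_assoc] using this
  rw [integral_integral_swap hI]
  congr 1; ext τ; congr 1; ext t
  rw [mul_right_comm Complex.I]
  ring

lemma integrable_mul_of_decay {f g : ℝ → ℂ} (hf : Continuous f) (hg : Continuous g) {C D : ℝ}
    (hfb : ∀ x, ‖f x‖ ≤ C / (1 + |x|)) (hgb : ∀ x, ‖g x‖ ≤ D / (1 + |x|)) :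
    Integrable (fun x => f x * g x) := by
  refine (integrable_wSq.const_mul (C * D)).mono' (hf.mul hg).aestronglyMeasurable
    (ae_of_all _ fun x => ?_)
  have hC : 0 ≤ C := by simpa using (norm_nonneg _).trans (hfb 0)
  have hD : 0 ≤ D := by simpa using (norm_nonneg _).trans (hgb 0)
  rw [norm_mul]
  calc _ ≤ C / (1 + |x|) * (D / (1 + |x|)) :=
        mul_le_mul (hfb x) (hgb x) (norm_nonneg _) (by positivity)
    _ = C * D * (wAbs x * wAbs x) := by unfold wAbs; ring
    _ ≤ _ := by gcongr; exact wAbs_mul_le x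

lemma UHPDecay.slice_bound {A : ℂ → ℂ} (hA : UHPDecay A) {y : ℝ} (hy : 0 < y) :
    ∃ C, ∀ x, ‖A (upt x y)‖ ≤ C / (1 + |x|) := by
  obtain ⟨C, hC, hb⟩ := hA.2 y hy
  refine ⟨C, fun x => (hb _ (by simp)).trans ?_⟩
  have := one_add_abs_re_le (upt x y)
  rw [upt_re] at this
  gcongr

lemma conj_add_bound {A B : ℝ → ℂ} (hA : ∃ C, ∀ x, ‖A x‖ ≤ C / (1 + |x|))
    (hB : ∃ C, ∀ x, ‖B x‖ ≤ C / (1 + |x|)) :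
    ∃ C, ∀ x, ‖starRingEnd ℂ (A x + starRingEnd ℂ (B x))‖ ≤ C / (1 + |x|) := by
  obtain ⟨C, hC⟩ := hA
  obtain ⟨D, hD⟩ := hB
  refine ⟨C + D, fun x => ?_⟩
  rw [RCLike.norm_conj, add_div]
  exact (norm_add_le _ _).trans (add_le_add (hC x) (by rw [RCLike.norm_conj]; exact hD x))

lemma abs_pow_mul_exp_le {c τ : ℝ} (hc : 0 < c) (hτ : 0 ≤ τ) :
    τ * Real.exp (-(c * τ)) ≤ 1 / c := by
  rw [Real.exp_neg, ← div_eq_mul_inv, div_le_div_iff₀ (Real.exp_pos _) hc]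
  linarith [Real.add_one_le_exp (c * τ)]

/-- The profile of the second derivative at height `w`. -/
def secProf (Φ : ℝ → ℂ) (w : ℝ) : ℝ → ℂ :=
  (Set.Ioi (0:ℝ)).indicator fun τ => ((τ ^ 2 * Real.exp (-w * τ) : ℝ) : ℂ) * Φ τ

lemma integrable_secProf {Φ : ℝ → ℂ} (h : Integrable Φ) {w : ℝ} (hw : 0 < w) :
    Integrable (secProf Φ w) := by
  rw [secProf, integrable_indicator_iff measurableSet_Ioi]
  refine h.integrableOn.bdd_mul (c := (2 / w) * (2 / w))
    (Continuous.aestronglyMeasurable (by fun_prop)) ?_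
  filter_upwards [ae_restrict_mem measurableSet_Ioi] with τ hτ
  rw [Set.mem_Ioi] at hτ
  have h1 := abs_pow_mul_exp_le (c := w / 2) (by positivity) hτ.le
  rw [Complex.norm_real, Real.norm_of_nonneg (by positivity)]
  have e : τ ^ 2 * Real.exp (-w * τ) =
      (τ * Real.exp (-(w / 2 * τ))) * (τ * Real.exp (-(w / 2 * τ))) := by
    rw [mul_mul_mul_comm, ← Real.exp_add]; ring_nf
  rw [e]
  have e2 : 2 / w = 1 / (w / 2) := by field_simp
  rw [e2]
  gcongr

lemma deriv_deriv_Lap {Φ : ℝ → ℂ} (h : Integrable Φ) (x : ℝ) {w : ℝ} (hw : 0 < w) :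
    deriv (deriv (Lap Φ)) (upt x w) = - syn (secProf Φ w) x := by
  set α : ℝ → ℂ := fun τ => if 0 < τ then Complex.I * τ * Real.exp (-(w / 2) * τ) * Φ τ else 0 with hα
  have hαi : Integrable α := by
    have : α = (Set.Ioi (0:ℝ)).indicator fun τ => Complex.I * τ * Real.exp (-(w / 2) * τ) * Φ τ := by
      ext τ; simp [hα, Set.indicator]
    rw [this, integrable_indicator_iff measurableSet_Ioi]
    refine h.integrableOn.bdd_mul (c := 1 / (w / 2))
      (Continuous.aestronglyMeasurable (by fun_prop)) ?_
    filter_upwards [ae_restrict_mem measurableSet_Ioi] with τ hτ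
    rw [Set.mem_Ioi] at hτ
    have h1 := abs_pow_mul_exp_le (c := w / 2) (by positivity) hτ.le
    rw [norm_mul, norm_mul, Complex.norm_I, Complex.norm_real, Complex.norm_real, one_mul,
      Real.norm_of_nonneg hτ.le, Real.norm_of_nonneg (Real.exp_pos _).le]
    simpa using h1
  have hz : w / 2 < (upt x w).im := by simp [hw]
  have e1 : deriv (Lap Φ) =ᶠ[𝓝 (upt x w)] fun z => Lap α (z - (w / 2 : ℝ) * Complex.I) := by
    filter_upwards [(isOpen_lt continuous_const Complex.continuous_im).mem_nhds hz] with z hz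
    have hz' : w / 2 < z.im := hz
    have hz0 : 0 < z.im := by linarith
    rw [(hasDerivAt_Lap h hz0).deriv, Lap]
    refine setIntegral_congr_fun measurableSet_Ioi fun τ hτ => ?_
    have hτ' : 0 < τ := hτ
    simp only [hα, if_pos hτ', Complex.ofReal_exp]
    have : Complex.exp (Complex.I * z * τ) = Complex.exp (Complex.I * (z - ((w / 2 : ℝ) : ℂ) * Complex.I) * τ) *
        Complex.exp ((-(w / 2) * τ : ℝ) : ℂ) := by
      rw [← Complex.exp_add]
      congr 1
      push_cast
      linear_combination (w / 2 : ℂ) * τ * Complex.I_sq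
    rw [this]
    ring
  have hz2 : 0 < (upt x w - ((w / 2 : ℝ) : ℂ) * Complex.I).im := by
    simp [upt]
    linarith
  rw [e1.deriv_eq, deriv_comp_sub_const, (hasDerivAt_Lap hαi hz2).deriv, syn, ← integral_neg,
    ← integral_indicator measurableSet_Ioi]
  congr 1
  ext τ
  by_cases hτ : 0 < τ
  · simp only [secProf]
    rw [Set.indicator_of_mem (by exact hτ), Set.indicator_of_mem (by exact hτ)]
    simp only [hα, if_pos hτ, Complex.ofReal_exp, Complex.ofReal_mul]
    have : Complex.exp (Complex.I * (upt x w - ((w / 2 : ℝ) : ℂ) * Complex.I) * τ) *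
        Complex.exp (((-(w / 2) : ℝ) : ℂ) * τ) =
        Complex.exp (((-w : ℝ) : ℂ) * τ) * Complex.exp (Complex.I * x * τ) := by
      rw [← Complex.exp_add, ← Complex.exp_add]
      congr 1
      simp only [upt]
      push_cast
      linear_combination ((w : ℂ) - w / 2) * τ * Complex.I_sq
    calc _ = (Complex.I ^ 2) * (τ : ℂ) ^ 2 * (Complex.exp (Complex.I * (upt x w - ((w / 2 : ℝ) : ℂ) * Complex.I) * τ) *
        Complex.exp (((-(w / 2) : ℝ) : ℂ) * τ)) * Φ τ := by ring
      _ = _ := by rw [this, Complex.I_sq]; push_cast; ring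
  · simp only [secProf]
    rw [Set.indicator_of_notMem (by exact hτ), Set.indicator_of_notMem (by exact hτ)]
    simp

lemma integral_syn_mul_conj_poisExt {D : ℝ → ℂ} (hD : Integrable D) {h : ℝ → ℂ} (hh : IntMom h)
    {w : ℝ} (hw : 0 < w) : ∫ x, syn D x * starRingEnd ℂ (poisExt h x w) =
      ∫ t, starRingEnd ℂ (h t) * syn (fun τ => Real.exp (-w * |τ|) * D τ) t := by
  have e1 : ∀ x, syn D x * starRingEnd ℂ (poisExt h x w) =
      ∫ t, starRingEnd ℂ (h t) * ((pois (x - t) w : ℂ) * syn D x) := fun x => by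
    rw [poisExt_eq hh.int x hw, ← integral_conj, ← integral_const_mul]
    congr 1; ext t
    rw [map_mul, Complex.conj_ofReal, ← neg_sub t x, pois_neg]
    ring
  simp_rw [e1]
  have hI : Integrable (fun z : ℝ × ℝ => starRingEnd ℂ (h z.2) * ((pois (z.1 - z.2) w : ℂ) *
      syn D z.1)) (volume.prod volume) := by
    have h1 : Integrable (fun z : ℝ × ℝ => starRingEnd ℂ (h z.2) * (pois (z.1 - z.2) w : ℂ))
        (volume.prod volume) := Integrable.convolution_integrand (μ := volume) (ν := volume) (ContinuousLinearMap.mul ℂ ℂ) hh.conj.int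
      (integrable_pois hw).ofReal (𝕜 := ℂ)
    have := h1.mul_bdd (c := ∫ τ, ‖D τ‖) (g := fun z : ℝ × ℝ => syn D z.1)
      ((continuous_syn hD).comp continuous_fst).aestronglyMeasurable
      (ae_of_all _ fun τ => norm_syn_le D _)
    simpa only [mul_assoc] using this
  rw [integral_integral_swap hI]
  congr 1; ext t
  rw [integral_const_mul, ← pois_syn hD hw]
  congr 1
  rw [← integral_add_left_eq_self (fun x => (pois (x - t) w : ℂ) * syn D x) t]
  simp

lemma pairing {Φ : ℝ → ℂ} (hΦ : C1Int Φ) {h : ℝ → ℂ} (hh : IntMom h) {w : ℝ} (hw : 0 < w) :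
    ∫ x, deriv (Lap Φ) (upt x w) * starRingEnd ℂ (poisExtX h x w) =
      ∫ τ in Set.Ioi (0:ℝ), ((τ ^ 2 * Real.exp (-2 * w * τ) : ℝ) : ℂ) * Φ τ *
        syn (fun t => starRingEnd ℂ (h t)) τ := by
  have hF := hΦ.uhpDecay
  obtain ⟨C1, hC1⟩ := hF.deriv.slice_bound hw
  obtain ⟨C2, hC2⟩ := hF.deriv.deriv.slice_bound hw
  obtain ⟨C3, hC3⟩ := conj_add_bound (hh.cauchyA_uhpDecay.slice_bound hw)
    (hh.conj.cauchyA_uhpDecay.slice_bound hw)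
  obtain ⟨C4, hC4⟩ := conj_add_bound (hh.cauchyA_uhpDecay.deriv.slice_bound hw)
    (hh.conj.cauchyA_uhpDecay.deriv.slice_bound hw)
  have c1 := hF.deriv.continuous hw
  have c2 := hF.deriv.deriv.continuous hw
  have c3 : Continuous fun x => starRingEnd ℂ (poisExt h x w) :=
    Complex.continuous_conj.comp ((hh.cauchyA_uhpDecay.continuous hw).add
      (Complex.continuous_conj.comp (hh.conj.cauchyA_uhpDecay.continuous hw)))
  have c4 : Continuous fun x => starRingEnd ℂ (poisExtX h x w) :=
    Complex.continuous_conj.comp ((hh.cauchyA_uhpDecay.deriv.continuous hw).add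
      (Complex.continuous_conj.comp (hh.conj.cauchyA_uhpDecay.deriv.continuous hw)))
  have hibp := integral_mul_deriv_eq_deriv_mul_of_integrable
    (u := fun x => deriv (Lap Φ) (upt x w)) (u' := fun x => deriv (deriv (Lap Φ)) (upt x w))
    (v := fun x => starRingEnd ℂ (poisExt h x w)) (v' := fun x => starRingEnd ℂ (poisExtX h x w))
    (fun x _ => hF.deriv.hasDerivAt_left hw)
    (fun x _ => Complex.conjCLE.toContinuousLinearMap.hasFDerivAt.comp_hasDerivAt x
      (hasDerivAt_poisExt hh x hw))
    (integrable_mul_of_decay c1 c4 hC1 hC4) (integrable_mul_of_decay c2 c3 hC2 hC3)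
    (integrable_mul_of_decay c1 c3 hC1 hC3)
  rw [hibp]
  simp_rw [deriv_deriv_Lap hΦ.integrable _ hw, neg_mul]
  rw [integral_neg, neg_neg, integral_syn_mul_conj_poisExt (integrable_secProf hΦ.integrable hw) hh hw,
    integral_mul_syn hh.conj.int (integrable_expAbs_mul (integrable_secProf hΦ.integrable hw) hw.le),
    ← integral_indicator measurableSet_Ioi]
  congr 1; ext τ
  by_cases hτ : 0 < τ
  · rw [secProf, Set.indicator_of_mem (by exact hτ), Set.indicator_of_mem (by exact hτ),
      abs_of_pos hτ, ← mul_assoc, ← Complex.ofReal_mul]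
    congr 3
    rw [mul_left_comm, ← Real.exp_add]
    ring_nf
  · rw [secProf, Set.indicator_of_notMem (by exact hτ), Set.indicator_of_notMem (by exact hτ)]
    simp

/-- The kernel expressing a multiplier through its profile in the vertical variable. -/
def kern (w τ : ℝ) : ℝ := 4 * w * (τ ^ 2 * Real.exp (-2 * w * τ))

lemma kern_nonneg {w : ℝ} (hw : 0 ≤ w) (τ : ℝ) : 0 ≤ kern w τ := by unfold kern; positivity

lemma continuous_kern : Continuous (fun z : ℝ × ℝ => kern z.1 z.2) := by unfold kern; fun_prop

lemma integral_kern {τ : ℝ} (hτ : 0 < τ) : ∫ w in Set.Ioi (0:ℝ), kern w τ = 1 := by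
  have h := Real.integral_rpow_mul_exp_neg_mul_Ioi (a := 2) (r := 2 * τ) (by norm_num) (by positivity)
  have e : ∀ w : ℝ, kern w τ = 4 * τ ^ 2 * (w ^ ((2:ℝ) - 1) * Real.exp (-(2 * τ * w))) := by
    intro w
    unfold kern
    norm_num
    rw [show -(2 * τ * w) = -(2 * w * τ) by ring]
    ring
  simp_rw [e]
  rw [integral_const_mul, h]
  have : Real.Gamma 2 = 1 := Real.Gamma_two
  rw [this, show (2:ℝ) = ((2:ℕ):ℝ) by norm_num, Real.rpow_natCast]
  field_simp
  norm_num

lemma integrableOn_kern {τ : ℝ} (hτ : 0 < τ) : IntegrableOn (fun w => kern w τ) (Set.Ioi 0) := by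
  by_contra h
  have := integral_undef h
  rw [integral_kern hτ] at this
  exact one_ne_zero this

/-- The multiplier with vertical profile `a`. -/
def mult (a : ℝ → ℝ) (τ : ℝ) : ℝ := ∫ w in Set.Ioi (0:ℝ), kern w τ * a w

lemma measurable_mult {a : ℝ → ℝ} (ha : Measurable a) : Measurable (mult a) := by
  have : StronglyMeasurable (fun z : ℝ × ℝ => kern z.2 z.1 * a z.2) :=
    ((continuous_kern.measurable.comp measurable_swap).mul (ha.comp measurable_snd)).stronglyMeasurable
  exact (this.integral_prod_right' (ν := volume.restrict (Set.Ioi 0))).measurable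

lemma integrableOn_kern_mul {a : ℝ → ℝ} (ha : Measurable a) {A : ℝ} (hA : ∀ w, 0 < w → |a w| ≤ A)
    {τ : ℝ} (hτ : 0 < τ) : IntegrableOn (fun w => kern w τ * a w) (Set.Ioi 0) := by
  refine (integrableOn_kern hτ).mul_bdd (c := A) ha.aestronglyMeasurable ?_
  filter_upwards [ae_restrict_mem measurableSet_Ioi] with w hw using hA w hw

lemma abs_mult_le {a : ℝ → ℝ} {A : ℝ} (hA : ∀ w, 0 < w → |a w| ≤ A) {τ : ℝ} (hτ : 0 < τ) :
    |mult a τ| ≤ A := by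
  have : ‖mult a τ‖ ≤ ∫ w in Set.Ioi (0:ℝ), kern w τ * A := by
    refine norm_integral_le_of_norm_le ((integrableOn_kern hτ).mul_const A) ?_
    filter_upwards [ae_restrict_mem measurableSet_Ioi] with w hw
    rw [norm_mul, Real.norm_of_nonneg (kern_nonneg (le_of_lt hw) τ)]
    exact mul_le_mul_of_nonneg_left (hA w hw) (kern_nonneg (le_of_lt hw) τ)
  rwa [integral_mul_const, integral_kern hτ, one_mul] at this

/-- The profile `Φ` multiplied by `mult a` on the positive half line. -/
def mprof (a : ℝ → ℝ) (Φ : ℝ → ℂ) : ℝ → ℂ :=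
  (Set.Ioi (0:ℝ)).indicator fun τ => (mult a τ : ℂ) * Φ τ

lemma integrable_mprof {a : ℝ → ℝ} (ha : Measurable a) {A : ℝ} (hA : ∀ w, 0 < w → |a w| ≤ A)
    {Φ : ℝ → ℂ} (h : Integrable Φ) : Integrable (mprof a Φ) := by
  rw [mprof, integrable_indicator_iff measurableSet_Ioi]
  refine h.integrableOn.bdd_mul (c := A) (measurable_mult ha).complex_ofReal.aestronglyMeasurable ?_
  filter_upwards [ae_restrict_mem measurableSet_Ioi] with τ hτ
  rw [Complex.norm_real]
  exact abs_mult_le hA hτ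

lemma pairing_mult {a : ℝ → ℝ} (ha : Measurable a) {A : ℝ} (hA : ∀ w, 0 < w → |a w| ≤ A)
    {Φ : ℝ → ℂ} (hΦ : C1Int Φ) {h : ℝ → ℂ} (hh : IntMom h) :
    ∫ t, starRingEnd ℂ (h t) * syn (mprof a Φ) t =
      ∫ w in Set.Ioi (0:ℝ), ((4 * w * a w : ℝ) : ℂ) *
        ∫ x, deriv (Lap Φ) (upt x w) * starRingEnd ℂ (poisExtX h x w) := by
  rw [integral_mul_syn hh.conj.int (integrable_mprof ha hA hΦ.integrable)]
  set K := syn (fun t => starRingEnd ℂ (h t)) with hK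
  have hKi : Integrable (fun τ => Φ τ * K τ) :=
    hΦ.integrable.mul_bdd (c := ∫ τ, ‖starRingEnd ℂ (h τ)‖) (continuous_syn hh.conj.int).aestronglyMeasurable
      (ae_of_all _ fun τ => norm_syn_le _ _)
  have e1 : ∫ τ, mprof a Φ τ * K τ = ∫ τ in Set.Ioi (0:ℝ), ∫ w in Set.Ioi (0:ℝ),
      ((kern w τ * a w : ℝ) : ℂ) * (Φ τ * K τ) := by
    rw [← integral_indicator measurableSet_Ioi]
    congr 1; ext τ
    by_cases hτ : 0 < τ
    · rw [mprof, Set.indicator_of_mem (by exact hτ), Set.indicator_of_mem (by exact hτ),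
        integral_mul_const, integral_complex_ofReal, mult, mul_assoc]
    · rw [mprof, Set.indicator_of_notMem (by exact hτ), Set.indicator_of_notMem (by exact hτ),
        zero_mul]
  have hA0 : 0 ≤ A := (abs_nonneg _).trans (hA 1 one_pos)
  have hI : Integrable (fun z : ℝ × ℝ => ((kern z.2 z.1 * a z.2 : ℝ) : ℂ) * (Φ z.1 * K z.1))
      ((volume.restrict (Set.Ioi (0:ℝ))).prod (volume.restrict (Set.Ioi (0:ℝ)))) := by
    have hm : AEStronglyMeasurable (fun z : ℝ × ℝ => ((kern z.2 z.1 * a z.2 : ℝ) : ℂ) * (Φ z.1 * K z.1))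
      ((volume.restrict (Set.Ioi (0:ℝ))).prod (volume.restrict (Set.Ioi (0:ℝ)))) := by
      refine Measurable.aestronglyMeasurable ?_
      refine Measurable.mul (Measurable.complex_ofReal ?_) ?_
      · exact (continuous_kern.measurable.comp measurable_swap).mul (ha.comp measurable_snd)
      · exact (hΦ.continuous.measurable.mul (continuous_syn hh.conj.int).measurable).comp measurable_fst
    rw [integrable_prod_iff hm]
    constructor
    · filter_upwards [ae_restrict_mem measurableSet_Ioi] with τ hτ
      exact (integrableOn_kern_mul ha hA hτ).ofReal.mul_const _
    · refine Integrable.mono' (hKi.norm.const_mul A).integrableOn hm.norm.integral_prod_right' ?_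
      filter_upwards [ae_restrict_mem measurableSet_Ioi] with τ hτ
      rw [Real.norm_of_nonneg (integral_nonneg fun _ => norm_nonneg _)]
      simp_rw [norm_mul _ (Φ τ * K τ)]
      rw [integral_mul_const]
      refine mul_le_mul_of_nonneg_right ?_ (norm_nonneg _)
      calc _ ≤ ∫ w in Set.Ioi (0:ℝ), kern w τ * A := by
            refine setIntegral_mono_on (integrableOn_kern_mul ha hA hτ).ofReal.norm
              ((integrableOn_kern hτ).mul_const A) measurableSet_Ioi fun w hw => ?_
            rw [Complex.norm_real, norm_mul, Real.norm_of_nonneg (kern_nonneg (le_of_lt hw) τ)]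
            exact mul_le_mul_of_nonneg_left (hA w hw) (kern_nonneg (le_of_lt hw) τ)
        _ = A := by rw [integral_mul_const, integral_kern hτ, one_mul]
  rw [e1, integral_integral_swap hI]
  refine setIntegral_congr_fun measurableSet_Ioi fun w hw => ?_
  rw [pairing hΦ hh hw, ← integral_const_mul]
  congr 1; ext τ
  unfold kern
  push_cast
  ring

lemma sum_prod_le {ι J : Type*} [Fintype ι] [Fintype J] (a : J → ℝ) (f : ι → ℝ) (g : ι × J → ℝ)
    (ha : ∀ j, 0 ≤ a j) (hf : ∀ i, 0 ≤ f i) {O : ℝ} (hO : ∑ j, a j ^ 2 ≤ O) :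
    ∑ k : ι × J, a k.2 * f k.1 * g k ≤
      Real.sqrt O * (Real.sqrt (∑ i, f i ^ 2) * Real.sqrt (∑ k, g k ^ 2)) := by
  refine (Real.sum_mul_le_sqrt_mul_sqrt _ _ _).trans ?_
  rw [← mul_assoc, ← Real.sqrt_mul ((Finset.sum_nonneg fun j _ => sq_nonneg (a j)).trans hO)]
  refine mul_le_mul_of_nonneg_right (Real.sqrt_le_sqrt ?_) (Real.sqrt_nonneg _)
  rw [Fintype.sum_prod_type]
  simp_rw [mul_pow]
  simp_rw [← Finset.sum_mul]
  rw [← Finset.mul_sum]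
  exact mul_le_mul_of_nonneg_right hO (Finset.sum_nonneg fun i _ => sq_nonneg _)

lemma pairing_bound {ι J : Type*} [Fintype ι] [Fintype J] {a : J → ℝ → ℝ}
    (ha : ∀ j, Measurable (a j)) (ha0 : ∀ j w, 0 < w → 0 ≤ a j w) {O : ℝ}
    (hO : ∀ w, 0 < w → ∑ j, a j w ^ 2 ≤ O) {Φ : ι → ℝ → ℂ} (hΦ : ∀ i, C1Int (Φ i))
    (h0 : ∀ i, ∀ τ < 0, Φ i τ = 0) {h : ι × J → ℝ → ℂ} (hh : ∀ k, IntMom (h k))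
    (hb : ∀ k, ∃ C, ∀ t, ‖h k t‖ ≤ C) {p P Q γ : ℝ} (hB : BellmanExp p P Q γ) :
    ‖∑ k, ∫ t, starRingEnd ℂ (h k t) * syn (mprof (a k.2) (Φ k.1)) t‖ₑ ≤
      ENNReal.ofReal (2 * Real.sqrt O) * (19 * ((∫⁻ x, ENNReal.ofReal ((∑ i, ‖syn (Φ i) x‖ ^ 2) ^ P)) +
        ∫⁻ x, ENNReal.ofReal ((∑ k, ‖h k x‖ ^ 2) ^ Q))) := by
  have haO : ∀ j w, 0 < w → |a j w| ≤ Real.sqrt O := fun j w hw => by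
    refine Real.abs_le_sqrt ((Finset.single_le_sum (f := fun j => a j w ^ 2)
      (fun j _ => sq_nonneg _) (Finset.mem_univ j)).trans (hO w hw))
  have hmF : ∀ i, Measurable (fun z : ℝ × ℝ => deriv (Lap (Φ i)) (upt z.1 z.2)) :=
    fun i => measurable_deriv_upt _
  have hmH := fun k => measurable_poisExtX (h k)
  have hm : ∀ k : ι × J, Measurable (fun z : ℝ × ℝ => ENNReal.ofReal (4 * z.2 * (a k.2 z.2 *
      ‖deriv (Lap (Φ k.1)) (upt z.1 z.2)‖ * ‖poisExtX (h k) z.1 z.2‖))) := fun k =>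
    (Measurable.mul (by fun_prop) ((((ha k.2).comp measurable_snd).mul (hmF k.1).norm).mul
      (hmH k).norm)).ennreal_ofReal
  simp_rw [fun k : ι × J => pairing_mult (ha k.2) (haO k.2) (hΦ k.1) (hh k)]
  calc _ ≤ ∑ k : ι × J, ∫⁻ w in Set.Ioi (0:ℝ), ∫⁻ x, ENNReal.ofReal (4 * w * (a k.2 w *
        ‖deriv (Lap (Φ k.1)) (upt x w)‖ * ‖poisExtX (h k) x w‖)) := by
        refine (enorm_sum_le _ _).trans (Finset.sum_le_sum fun k _ => ?_)
        refine (enorm_integral_le_lintegral_enorm _).trans ?_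
        refine setLIntegral_mono' measurableSet_Ioi fun w hw => ?_
        rw [← integral_const_mul]
        refine (enorm_integral_le_lintegral_enorm _).trans (le_of_eq ?_)
        refine lintegral_congr fun x => ?_
        rw [← ofReal_norm]
        congr 1
        have hw' : 0 < w := hw
        rw [norm_mul, norm_mul, RCLike.norm_conj, Complex.norm_real, Real.norm_of_nonneg
          (mul_nonneg (by positivity) (ha0 _ w hw'))]
        ring
    _ = ∫⁻ w in Set.Ioi (0:ℝ), ∫⁻ x, ∑ k : ι × J, ENNReal.ofReal (4 * w * (a k.2 w *
        ‖deriv (Lap (Φ k.1)) (upt x w)‖ * ‖poisExtX (h k) x w‖)) := by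
        rw [← lintegral_finsetSum _ fun k _ => ?_]
        · refine lintegral_congr fun w => ?_
          rw [lintegral_finsetSum _ fun k _ => ?_]
          exact (hm k).comp (measurable_id.prodMk measurable_const)
        · exact (hm k).lintegral_prod_left'
    _ ≤ ∫⁻ w in Set.Ioi (0:ℝ), ENNReal.ofReal (2 * Real.sqrt O) * (ENNReal.ofReal w *
        ∫⁻ x, ENNReal.ofReal (2 * (Real.sqrt (∑ i, ‖deriv (Lap (Φ i)) (upt x w)‖ ^ 2) *
          Real.sqrt (∑ k, ‖poisExtX (h k) x w‖ ^ 2)))) := by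
        refine setLIntegral_mono' measurableSet_Ioi fun w hw => ?_
        have hw' : 0 < w := hw
        rw [← lintegral_const_mul' _ _ ENNReal.ofReal_ne_top,
          ← lintegral_const_mul' _ _ ENNReal.ofReal_ne_top]
        refine lintegral_mono fun x => ?_
        rw [← ENNReal.ofReal_sum_of_nonneg fun k _ => ?_,
          ← ENNReal.ofReal_mul hw'.le, ← ENNReal.ofReal_mul (by positivity)]
        · refine ENNReal.ofReal_le_ofReal ?_
          rw [← Finset.mul_sum]
          have := sum_prod_le (fun j => a j w) (fun i => ‖deriv (Lap (Φ i)) (upt x w)‖)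
            (fun k => ‖poisExtX (h k) x w‖) (fun j => ha0 j w hw') (fun i => norm_nonneg _) (hO w hw')
          have := mul_le_mul_of_nonneg_left this (by positivity : 0 ≤ 4 * w)
          refine this.trans (le_of_eq (by ring))
        · exact mul_nonneg (by positivity) (mul_nonneg (mul_nonneg (ha0 _ w hw') (norm_nonneg _)) (norm_nonneg _))
    _ ≤ _ := by
        rw [lintegral_const_mul' _ _ ENNReal.ofReal_ne_top]
        exact mul_le_mul_right (bellman_boundary hΦ h0 hh hb hB) _

lemma IntMom.of_bdd_indicator {g : ℝ → ℂ} (hg : Measurable g) {B : ℝ} (hB : ∀ t, ‖g t‖ ≤ B) (R : ℝ) :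
    IntMom ((Set.Icc (-R) R).indicator g) := by
  refine ⟨hg.indicator measurableSet_Icc, ?_, ?_⟩
  · rw [integrable_indicator_iff measurableSet_Icc]
    exact Measure.integrableOn_of_bounded (M := B) (by simp) hg.aestronglyMeasurable
      (ae_of_all _ hB)
  · have : (fun t : ℝ => (t : ℂ) * (Set.Icc (-R) R).indicator g t) =
        (Set.Icc (-R) R).indicator (fun t : ℝ => (t : ℂ) * g t) := by
      ext t; by_cases h : t ∈ Set.Icc (-R) R <;> simp [h]
    rw [this, integrable_indicator_iff measurableSet_Icc]
    refine Measure.integrableOn_of_bounded (M := |R| * B) (by simp)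
      (Complex.measurable_ofReal.mul hg).aestronglyMeasurable ?_
    filter_upwards [ae_restrict_mem measurableSet_Icc] with t ht
    rw [norm_mul, Complex.norm_real]
    exact mul_le_mul ((abs_le.2 ht).trans (le_abs_self R)) (hB t) (norm_nonneg _) (abs_nonneg _)

lemma ennreal_absorb {T p : ℝ} (hT : 0 < T) {X Y : ℝ≥0∞} (hY : Y ≠ ∞)
    (h : ENNReal.ofReal (T ^ (1 - p)) * Y ≤
      ENNReal.ofReal (T / 38) * (19 * (X + ENNReal.ofReal (T ^ (-p)) * Y))) :
    Y ≤ ENNReal.ofReal (T ^ p) * X := by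
  have hp0 : 0 < T ^ p := Real.rpow_pos_of_pos hT p
  by_cases hX : X = ∞
  · rw [hX, ENNReal.mul_top]
    · exact le_top
    · simpa using hp0
  lift X to NNReal using hX
  lift Y to NNReal using hY
  have e : ∀ r : NNReal, (r : ℝ≥0∞) = ENNReal.ofReal (r : ℝ) := fun r => by simp
  have e19 : (19 : ℝ≥0∞) = ENNReal.ofReal 19 := by simp
  have h1 : 0 < T ^ (1 - p) := Real.rpow_pos_of_pos hT _
  have h2 : 0 < T ^ (-p) := Real.rpow_pos_of_pos hT _
  rw [e X, e Y, e19, ← ENNReal.ofReal_mul h1.le, ← ENNReal.ofReal_mul h2.le,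
    ← ENNReal.ofReal_add X.coe_nonneg (by positivity), ← ENNReal.ofReal_mul (by norm_num),
    ← ENNReal.ofReal_mul (by positivity), ENNReal.ofReal_le_ofReal_iff (by positivity)] at h
  rw [e X, e Y, ← ENNReal.ofReal_mul hp0.le]
  refine ENNReal.ofReal_le_ofReal ?_
  have k1 : T ^ (1 - p) = T * T ^ (-p) := by
    rw [sub_eq_add_neg, Real.rpow_add hT, Real.rpow_one]
  have k2 : T ^ p * T ^ (-p) = 1 := by rw [← Real.rpow_add hT]; simp
  rw [k1] at h
  have h3 : T * (T ^ (-p) * Y) ≤ T * X := by nlinarith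
  have h4 := le_of_mul_le_mul_left h3 hT
  calc (Y : ℝ) = T ^ p * (T ^ (-p) * Y) := by rw [← mul_assoc, k2, one_mul]
    _ ≤ _ := mul_le_mul_of_nonneg_left h4 hp0.le

lemma lp_upper {ι J : Type*} [Fintype ι] [Fintype J] {a : J → ℝ → ℝ}
    (ha : ∀ j, Measurable (a j)) (ha0 : ∀ j w, 0 < w → 0 ≤ a j w) {O : ℝ} (hOp : 0 < O)
    (hO : ∀ w, 0 < w → ∑ j, a j w ^ 2 ≤ O) {Φ : ι → ℝ → ℂ} (hΦ : ∀ i, C1Int (Φ i))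
    (h0 : ∀ i, ∀ τ < 0, Φ i τ = 0) {p : ℝ} (hp1 : 1 < p) (hp2 : p < 2) :
    ∫⁻ x, ENNReal.ofReal ((∑ k : ι × J, ‖syn (mprof (a k.2) (Φ k.1)) x‖ ^ 2) ^ (p / 2)) ≤
      ENNReal.ofReal ((76 * Real.sqrt O) ^ p) *
        ∫⁻ x, ENNReal.ofReal ((∑ i, ‖syn (Φ i) x‖ ^ 2) ^ (p / 2)) := by
  set G : ι × J → ℝ → ℂ := fun k => syn (mprof (a k.2) (Φ k.1)) with hG
  set T := 76 * Real.sqrt O with hT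
  have hTp : 0 < T := by positivity
  have haO : ∀ j w, 0 < w → |a j w| ≤ Real.sqrt O := fun j w hw => by
    refine Real.abs_le_sqrt ((Finset.single_le_sum (f := fun j => a j w ^ 2)
      (fun j _ => sq_nonneg _) (Finset.mem_univ j)).trans (hO w hw))
  have h_integrable := fun k : ι × J => integrable_mprof (ha k.2) (haO k.2) (hΦ k.1).integrable
  have hGc : ∀ k, Continuous (G k) := fun k => continuous_syn (h_integrable k)
  have hGb : ∀ k x, ‖G k x‖ ≤ ∫ τ, ‖mprof (a k.2) (Φ k.1) τ‖ := fun k x => norm_syn_le _ _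
  set N : ℝ → ℝ := fun x => Real.sqrt (∑ k, ‖G k x‖ ^ 2) with hN
  have hNc : Continuous N := by fun_prop
  have hN0 : ∀ x, 0 ≤ N x := fun x => Real.sqrt_nonneg _
  have hNsq : ∀ x, N x ^ 2 = ∑ k, ‖G k x‖ ^ 2 := fun x =>
    Real.sq_sqrt (Finset.sum_nonneg fun k _ => sq_nonneg _)
  have hGN : ∀ k x, ‖G k x‖ ≤ N x := fun k x => by
    refine Real.le_sqrt_of_sq_le ?_
    exact Finset.single_le_sum (f := fun k => ‖G k x‖ ^ 2) (fun j _ => sq_nonneg _) (Finset.mem_univ k)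
  set B := Real.sqrt (∑ k : ι × J, (∫ τ, ‖mprof (a k.2) (Φ k.1) τ‖) ^ 2) with hB
  have hNB : ∀ x, N x ≤ B := fun x => Real.sqrt_le_sqrt (Finset.sum_le_sum fun k _ =>
    pow_le_pow_left₀ (norm_nonneg _) (hGb k x) 2)
  have hNp : ∀ x, (∑ k : ι × J, ‖syn (mprof (a k.2) (Φ k.1)) x‖ ^ 2) ^ (p / 2) = N x ^ p := fun x => by
    change (∑ k, ‖G k x‖ ^ 2) ^ (p / 2) = N x ^ p
    rw [← hNsq, ← Real.rpow_natCast, ← Real.rpow_mul (hN0 x)]; congr 1; push_cast; ring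
  simp_rw [hNp]
  set X := ∫⁻ x, ENNReal.ofReal ((∑ i, ‖syn (Φ i) x‖ ^ 2) ^ (p / 2)) with hX
  have hpp : 0 < p := by linarith
  have hNpc : Continuous fun x => N x ^ p := hNc.rpow_const fun x => Or.inr hpp.le
  have hNpm : Continuous fun x => N x ^ (p - 1) := hNc.rpow_const fun x => Or.inr (by linarith)
  have key : ∀ R : ℕ, ∫⁻ x, (Set.Icc (-(R:ℝ)) R).indicator (fun x => ENNReal.ofReal (N x ^ p)) x ≤
      ENNReal.ofReal (T ^ p) * X := by
    intro R
    set S := Set.Icc (-(R:ℝ)) R with hS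
    have hSm : MeasurableSet S := measurableSet_Icc
    rw [lintegral_indicator hSm]
    set g : ι × J → ℝ → ℂ := fun k t => ((T ^ (1 - p) * N t ^ (p - 2) : ℝ) : ℂ) * G k t with hg
    have hgm : ∀ k, Measurable (g k) := fun k =>
      (((hNc.measurable.pow_const _).const_mul _).complex_ofReal).mul (hGc k).measurable
    have hs0 : 0 < T ^ (1 - p) := Real.rpow_pos_of_pos hTp _
    have hNn : ∀ t, 0 ≤ T ^ (1 - p) * N t ^ (p - 2) := fun t => by
      have := Real.rpow_nonneg (hN0 t) (p - 2); positivity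
    have hgn : ∀ k t, ‖g k t‖ = T ^ (1 - p) * N t ^ (p - 2) * ‖G k t‖ := fun k t => by
      rw [hg]; beta_reduce
      rw [norm_mul, Complex.norm_real, Real.norm_of_nonneg (hNn t)]
    have hNN : ∀ t, N t ^ (p - 2) * N t = N t ^ (p - 1) := fun t => by
      rcases eq_or_lt_of_le (hN0 t) with h | h
      · rw [← h, mul_zero, Real.zero_rpow (by linarith)]
      · rw [← Real.rpow_add_one h.ne']; congr 1; ring
    have hNNp : ∀ t, N t ^ (p - 2) * N t ^ 2 = N t ^ p := fun t => by
      rcases eq_or_lt_of_le (hN0 t) with h | h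
      · rw [← h, Real.zero_rpow (x := p) (by linarith)]; simp
      · rw [← Real.rpow_add_natCast h.ne']; congr 1; push_cast; ring
    have hgb : ∀ k t, ‖g k t‖ ≤ T ^ (1 - p) * B ^ (p - 1) := fun k t => by
      rw [hgn, mul_assoc]
      refine mul_le_mul_of_nonneg_left ?_ hs0.le
      refine (mul_le_mul_of_nonneg_left (hGN k t) (Real.rpow_nonneg (hN0 t) _)).trans ?_
      rw [hNN]
      exact Real.rpow_le_rpow (hN0 t) (hNB t) (by linarith)
    have hQ := pairing_bound ha ha0 hO hΦ h0 (fun k => IntMom.of_bdd_indicator (hgm k) (hgb k) R)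
      (fun k => ⟨T ^ (1 - p) * B ^ (p - 1), fun t => by
        rw [norm_indicator_eq_indicator_norm]
        refine Set.indicator_le_self' (fun _ _ => norm_nonneg _) t |>.trans (hgb k t)⟩)
      (p := p) (P := p / 2) (Q := p / (2 * (p - 1))) (γ := (2 - p) / p) ⟨hp1, hp2, rfl, rfl, rfl⟩
    have e1 : ∑ k : ι × J, ∫ t, starRingEnd ℂ (S.indicator (g k) t) *
        syn (mprof (a k.2) (Φ k.1)) t = ∫ t in S, ((T ^ (1 - p) * N t ^ p : ℝ) : ℂ) := by
      have : ∀ k : ι × J, (fun t => starRingEnd ℂ (S.indicator (g k) t) *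
        syn (mprof (a k.2) (Φ k.1)) t) = S.indicator fun t => starRingEnd ℂ (g k t) * G k t := by
        intro k; ext t; by_cases h : t ∈ S <;> simp [h, hG]
      simp_rw [this, integral_indicator hSm]
      rw [← integral_finsetSum]
      · congr 1; ext t
        rw [← hNNp, hNsq]
        push_cast
        rw [Finset.mul_sum, Finset.mul_sum]
        refine Finset.sum_congr rfl fun k _ => ?_
        rw [hg]; beta_reduce
        rw [map_mul, Complex.conj_ofReal, mul_assoc, Complex.conj_mul']
        push_cast; ring
      · intro k _
        refine Measure.integrableOn_of_bounded (M := T ^ (1 - p) * B ^ (p - 1) * B) (by simp [hS])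
          ((Complex.continuous_conj.measurable.comp (hgm k)).mul (hGc k).measurable).aestronglyMeasurable
          (ae_of_all _ fun t => ?_)
        rw [norm_mul]
        refine mul_le_mul (by simpa using hgb k t) ((hGN k t).trans (hNB t)) (norm_nonneg _) ?_
        exact (norm_nonneg _).trans (hgb k t)
    have e2 : ‖∫ t in S, ((T ^ (1 - p) * N t ^ p : ℝ) : ℂ)‖ₑ =
        ENNReal.ofReal (T ^ (1 - p)) * ∫⁻ t in S, ENNReal.ofReal (N t ^ p) := by
      have hi : IntegrableOn (fun t => N t ^ p) S := hNpc.continuousOn.integrableOn_compact isCompact_Icc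
      rw [integral_complex_ofReal, ← ofReal_norm, Complex.norm_real, Real.norm_of_nonneg, integral_const_mul,
        ENNReal.ofReal_mul hs0.le, ofReal_integral_eq_lintegral_ofReal hi
          (ae_of_all _ fun t => Real.rpow_nonneg (hN0 t) _)]
      exact integral_nonneg fun t => mul_nonneg hs0.le (Real.rpow_nonneg (hN0 t) _)
    have e3 : ∫⁻ x, ENNReal.ofReal ((∑ k, ‖S.indicator (g k) x‖ ^ 2) ^ (p / (2 * (p - 1)))) =
        ENNReal.ofReal (T ^ (-p)) * ∫⁻ t in S, ENNReal.ofReal (N t ^ p) := by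
      rw [← lintegral_const_mul' _ _ ENNReal.ofReal_ne_top, ← lintegral_indicator hSm]
      refine lintegral_congr fun t => ?_
      by_cases h : t ∈ S
      · simp only [Set.indicator_of_mem h]
        rw [← ENNReal.ofReal_mul (Real.rpow_nonneg hTp.le _)]
        congr 1
        simp_rw [hgn, mul_pow _ (‖G _ t‖)]
        rw [← Finset.mul_sum, ← hNsq, ← mul_pow, mul_assoc, hNN]
        have hp1' : p - 1 ≠ 0 := by linarith
        rw [← Real.rpow_natCast, ← Real.rpow_mul (by have := Real.rpow_nonneg (hN0 t) (p-1); positivity),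
          Real.mul_rpow hs0.le (Real.rpow_nonneg (hN0 t) _), ← Real.rpow_mul hTp.le, ← Real.rpow_mul (hN0 t)]
        congr 2 <;> (push_cast; field_simp)
        ring
      · simp only [Set.indicator_of_notMem h]
        have : p / (2 * (p - 1)) ≠ 0 := by
          have : 0 < p - 1 := by linarith
          positivity
        simp [this]
    rw [e1, e2, e3, show 2 * Real.sqrt O = T / 38 by rw [hT]; ring] at hQ
    refine ennreal_absorb hTp ?_ hQ
    have hi : IntegrableOn (fun t => N t ^ p) S := hNpc.continuousOn.integrableOn_compact isCompact_Icc
    exact (hi.lintegral_lt_top).ne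
  refine lintegral_le_of_tendsto (fun R => (hNpc.measurable.ennreal_ofReal.indicator
    measurableSet_Icc).aemeasurable) key fun x => ?_
  refine tendsto_const_nhds.congr' ?_
  obtain ⟨n, hn⟩ := exists_nat_ge |x|
  filter_upwards [eventually_ge_atTop n] with R hR
  rw [Set.indicator_of_mem]
  have : (n:ℝ) ≤ R := by exact_mod_cast hR
  exact abs_le.1 (hn.trans this)

/-- The `p`-th power of the `L^p(ℓ²)` norm of the family synthesised from the profiles `α`. -/
def synE {κ : Type*} [Fintype κ] (p : ℝ) (α : κ → ℝ → ℂ) : ℝ≥0∞ :=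
  ∫⁻ x, ENNReal.ofReal ((∑ k, ‖syn (α k) x‖ ^ 2) ^ (p / 2))

section synE
variable {κ : Type*} [Fintype κ] {p : ℝ}

lemma synE_congr {α β : κ → ℝ → ℂ} (h : ∀ k, α k =ᵐ[volume] β k) : synE p α = synE p β := by
  unfold synE
  have : ∀ k, syn (α k) = syn (β k) := fun k => by
    ext x
    refine integral_congr_ae ?_
    filter_upwards [h k] with τ hτ
    rw [hτ]
  simp_rw [this]

lemma syn_add {α β : ℝ → ℂ} (hα : Integrable α) (hβ : Integrable β) (x : ℝ) :
    syn (fun τ => α τ + β τ) x = syn α x + syn β x := by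
  unfold syn
  simp_rw [add_mul]
  exact integral_add (integrable_mul_exp hα x) (integrable_mul_exp hβ x)

lemma syn_const_mul (c : ℂ) (α : ℝ → ℂ) (x : ℝ) : syn (fun τ => c * α τ) x = c * syn α x := by
  unfold syn
  simp_rw [mul_assoc]
  exact integral_const_mul _ _

lemma measurable_synE_integrand {α : κ → ℝ → ℂ} (hα : ∀ k, Integrable (α k)) :
    Measurable fun x => ENNReal.ofReal ((∑ k, ‖syn (α k) x‖ ^ 2) ^ (p / 2)) := by
  have := fun k => (continuous_syn (hα k)).measurable
  exact ((Finset.measurable_sum _ fun k _ => (this k).norm.pow_const 2).pow_const _).ennreal_ofReal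

lemma synE_add_le {α β : κ → ℝ → ℂ} (hα : ∀ k, Integrable (α k)) (hβ : ∀ k, Integrable (β k))
    (hp1 : 1 < p) (hp2 : p < 2) :
    synE p (fun k τ => α k τ + β k τ) ≤ 2 * (synE p α + synE p β) := by
  unfold synE
  rw [← lintegral_add_left (measurable_synE_integrand hα), ← lintegral_const_mul' _ _ (by simp)]
  refine lintegral_mono fun x => ?_
  have e2 : (2 : ℝ≥0∞) = ENNReal.ofReal 2 := by simp
  set A := ∑ k, ‖syn (α k) x‖ ^ 2 with hA
  set B := ∑ k, ‖syn (β k) x‖ ^ 2 with hB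
  have hA0 : 0 ≤ A := Finset.sum_nonneg fun k _ => sq_nonneg _
  have hB0 : 0 ≤ B := Finset.sum_nonneg fun k _ => sq_nonneg _
  have hA1 := Real.rpow_nonneg hA0 (p / 2)
  have hB1 := Real.rpow_nonneg hB0 (p / 2)
  rw [e2, ← ENNReal.ofReal_add hA1 hB1, ← ENNReal.ofReal_mul (by norm_num)]
  refine ENNReal.ofReal_le_ofReal ?_
  have h1 : ∑ k, ‖syn (fun τ => α k τ + β k τ) x‖ ^ 2 ≤ 2 * (A + B) := by
    rw [hA, hB, ← Finset.sum_add_distrib, Finset.mul_sum]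
    refine Finset.sum_le_sum fun k _ => ?_
    rw [syn_add (hα k) (hβ k)]
    have h := norm_add_le (syn (α k) x) (syn (β k) x)
    have h' := pow_le_pow_left₀ (norm_nonneg _) h 2
    nlinarith [sq_nonneg (‖syn (α k) x‖ - ‖syn (β k) x‖)]
  calc _ ≤ (2 * (A + B)) ^ (p / 2) :=
        Real.rpow_le_rpow (Finset.sum_nonneg fun k _ => sq_nonneg _) h1 (by linarith)
    _ = 2 ^ (p / 2) * (A + B) ^ (p / 2) := Real.mul_rpow (by norm_num) (by positivity)
    _ ≤ 2 ^ (1:ℝ) * (A ^ (p / 2) + B ^ (p / 2)) := by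
        refine mul_le_mul (Real.rpow_le_rpow_of_exponent_le (by norm_num) (by linarith)) ?_
          (by positivity) (by positivity)
        exact Real.rpow_add_le_add_rpow hA0 hB0 (by linarith) (by linarith)
    _ = _ := by rw [Real.rpow_one]

lemma synE_const_mul_le {α : κ → ℝ → ℂ} {c : ℝ} (hc : |c| ≤ 4) (hp1 : 1 < p) (hp2 : p < 2) :
    synE p (fun k τ => (c : ℂ) * α k τ) ≤ 16 * synE p α := by
  unfold synE
  rw [← lintegral_const_mul' _ _ (by simp)]
  refine lintegral_mono fun x => ?_
  have e2 : (16 : ℝ≥0∞) = ENNReal.ofReal 16 := by simp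
  simp_rw [syn_const_mul, norm_mul, mul_pow, Complex.norm_real, Real.norm_eq_abs]
  rw [← Finset.mul_sum]
  have hA0 : 0 ≤ ∑ k, ‖syn (α k) x‖ ^ 2 := Finset.sum_nonneg fun k _ => sq_nonneg _
  rw [e2, ← ENNReal.ofReal_mul (by norm_num), Real.mul_rpow (by positivity) hA0]
  refine ENNReal.ofReal_le_ofReal (mul_le_mul_of_nonneg_right ?_ (Real.rpow_nonneg hA0 _))
  calc (|c| ^ 2) ^ (p / 2) ≤ 16 ^ (p / 2) := by
        refine Real.rpow_le_rpow (by positivity) ?_ (by linarith)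
        nlinarith [abs_nonneg c]
    _ ≤ 16 ^ (1:ℝ) := Real.rpow_le_rpow_of_exponent_le (by norm_num) (by linarith)
    _ = 16 := Real.rpow_one _

end synE

/-- An average of cut-offs of `(·, ℓ)`-type: the mean of `1_{ℓ c(η) < τ}` in `η ∈ (0,1)`. -/
def cutAvg (ρ c : ℝ → ℝ) (ℓ τ : ℝ) : ℝ :=
  ∫ η in Set.Ioo (0:ℝ) 1, ρ η * (Set.Ioi (ℓ * c η)).indicator (fun _ => (1:ℝ)) τ

lemma measurable_cut {c : ℝ → ℝ} (hc : Measurable c) (ℓ : ℝ) :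
    Measurable fun z : ℝ × ℝ => (Set.Ioi (ℓ * c z.2)).indicator (fun _ => (1:ℝ)) z.1 := by
  have : (fun z : ℝ × ℝ => (Set.Ioi (ℓ * c z.2)).indicator (fun _ => (1:ℝ)) z.1) =
      Set.indicator {z : ℝ × ℝ | ℓ * c z.2 < z.1} (fun _ => 1) := by
    ext z; by_cases h : ℓ * c z.2 < z.1 <;> simp [h]
  rw [this]
  exact measurable_const.indicator
    (measurableSet_lt ((hc.comp measurable_snd).const_mul _) measurable_fst)

lemma cut_le_one (a τ : ℝ) : ‖(Set.Ioi a).indicator (fun _ => (1:ℝ)) τ‖ ≤ 1 := by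
  by_cases h : a < τ <;> simp [h]

section cutAvg
variable {ρ c : ℝ → ℝ} (hρ : Measurable ρ) (hc : Measurable c)
  (hρ0 : ∀ᵐ η ∂(volume.restrict (Set.Ioo (0:ℝ) 1)), 0 ≤ ρ η)
  (h1 : ∫⁻ η in Set.Ioo (0:ℝ) 1, ENNReal.ofReal (ρ η) = 1)
include hρ hρ0 h1

lemma integrable_density : IntegrableOn ρ (Set.Ioo (0:ℝ) 1) := by
  refine ⟨hρ.aestronglyMeasurable, ?_⟩
  rw [hasFiniteIntegral_iff_ofReal hρ0, h1]
  simp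

include hc

lemma abs_cutAvg_le (ℓ τ : ℝ) : ‖cutAvg ρ c ℓ τ‖ ≤ ∫ η in Set.Ioo (0:ℝ) 1, ‖ρ η‖ := by
  refine norm_integral_le_of_norm_le (integrable_density hρ hρ0 h1).norm (ae_of_all _ fun η => ?_)
  rw [norm_mul]
  exact mul_le_of_le_one_right (norm_nonneg _) (cut_le_one _ _)

lemma measurable_cutAvg (ℓ : ℝ) : Measurable (cutAvg ρ c ℓ) := by
  have : StronglyMeasurable (fun z : ℝ × ℝ => ρ z.2 * (Set.Ioi (ℓ * c z.2)).indicator (fun _ => (1:ℝ)) z.1) :=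
    ((hρ.comp measurable_snd).mul (measurable_cut hc ℓ)).stronglyMeasurable
  exact (this.integral_prod_right' (ν := volume.restrict (Set.Ioo 0 1))).measurable

lemma integrable_cutAvg_mul (ℓ : ℝ) {Ψ : ℝ → ℂ} (hΨ : Integrable Ψ) :
    Integrable (fun τ => (cutAvg ρ c ℓ τ : ℂ) * Ψ τ) := by
  refine hΨ.bdd_mul (c := ∫ η in Set.Ioo (0:ℝ) 1, ‖ρ η‖)
    (measurable_cutAvg hρ hc hρ0 h1 ℓ).complex_ofReal.aestronglyMeasurable (ae_of_all _ fun τ => ?_)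
  rw [Complex.norm_real]
  exact abs_cutAvg_le hρ hc hρ0 h1 ℓ τ

lemma syn_cutAvg (ℓ : ℝ) {Ψ : ℝ → ℂ} (hΨ : Integrable Ψ) (hΨm : Measurable Ψ) (x : ℝ) :
    syn (fun τ => (cutAvg ρ c ℓ τ : ℂ) * Ψ τ) x =
      ∫ η in Set.Ioo (0:ℝ) 1, (ρ η : ℂ) * syn ((Set.Ioi (ℓ * c η)).indicator Ψ) x := by
  have hx := integrable_mul_exp hΨ x
  have hI : Integrable (fun z : ℝ × ℝ => ((ρ z.2 *
      (Set.Ioi (ℓ * c z.2)).indicator (fun _ => (1:ℝ)) z.1 : ℝ) : ℂ) *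
      (Ψ z.1 * Complex.exp (Complex.I * x * z.1))) (volume.prod (volume.restrict (Set.Ioo (0:ℝ) 1))) := by
    have h0 := hx.mul_prod ((integrable_density hρ hρ0 h1).ofReal (𝕜 := ℂ))
    have := h0.bdd_mul (c := 1) (measurable_cut hc ℓ).complex_ofReal.aestronglyMeasurable
      (ae_of_all _ fun z => by rw [Complex.norm_real]; exact cut_le_one _ _)
    refine this.congr (ae_of_all _ fun z => ?_)
    simp only [Complex.ofReal_mul, Complex.coe_algebraMap]
    ring
  have e : syn (fun τ => (cutAvg ρ c ℓ τ : ℂ) * Ψ τ) x = ∫ τ, ∫ η in Set.Ioo (0:ℝ) 1, ((ρ η *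
      (Set.Ioi (ℓ * c η)).indicator (fun _ => (1:ℝ)) τ : ℝ) : ℂ) *
      (Ψ τ * Complex.exp (Complex.I * x * τ)) := by
    unfold syn
    congr 1; ext τ
    rw [integral_mul_const, integral_complex_ofReal, mul_assoc]
    rfl
  rw [e, integral_integral_swap hI]
  congr 1; ext η
  unfold syn
  rw [← integral_const_mul]
  congr 1; ext τ
  by_cases h : ℓ * c η < τ <;> simp [h, mul_assoc]

lemma riesz_avg {κ : Type*} [Fintype κ] {Ψ : κ → ℝ → ℂ} (hΨ : ∀ k, C1Int (Ψ k)) (ℓ : κ → ℝ)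
    {p : ℝ} (hp1 : 1 < p) (hp2 : p < 2) :
    synE p (fun k τ => (cutAvg ρ c (ℓ k) τ : ℂ) * Ψ k τ) ≤ ENNReal.ofReal (2 / (p - 1)) * synE p Ψ := by
  have hm : ∀ k, Measurable fun z : ℝ × ℝ => syn ((Set.Ioi (ℓ k * c z.2)).indicator (Ψ k)) z.1 := by
    intro k
    unfold syn
    have : StronglyMeasurable (fun z : (ℝ × ℝ) × ℝ => (Set.Ioi (ℓ k * c z.1.2)).indicator (Ψ k) z.2 *
        Complex.exp (Complex.I * z.1.1 * z.2)) := by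
      refine (Measurable.mul ?_ (by fun_prop)).stronglyMeasurable
      have h := ((measurable_cut hc (ℓ k)).comp (measurable_snd.prodMk
        (measurable_snd.comp measurable_fst) : Measurable fun z : (ℝ × ℝ) × ℝ => (z.2, z.1.2))).complex_ofReal.mul
        ((hΨ k).continuous.measurable.comp measurable_snd)
      convert h using 1
      ext z
      by_cases h : ℓ k * c z.1.2 < z.2 <;> simp [h]
    exact (this.integral_prod_right' (ν := volume)).measurable
  have hm' : ∀ x k, Measurable fun η => syn ((Set.Ioi (ℓ k * c η)).indicator (Ψ k)) x := fun x k =>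
    (hm k).comp (measurable_const.prodMk measurable_id)
  unfold synE
  calc _ ≤ ∫⁻ x, ∫⁻ η in Set.Ioo (0:ℝ) 1, ENNReal.ofReal (ρ η) * ENNReal.ofReal
        ((∑ k, ‖syn ((Set.Ioi (ℓ k * c η)).indicator (Ψ k)) x‖ ^ 2) ^ (p / 2)) := by
        refine lintegral_mono fun x => ?_
        simp_rw [fun k => syn_cutAvg hρ hc hρ0 h1 (ℓ k) (hΨ k).integrable (hΨ k).continuous.measurable x]
        refine jensen_sq hρ hρ0 h1 (fun k => (hm' x k).aestronglyMeasurable) (fun k => ?_) hp1.le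
        refine ((integrable_density hρ hρ0 h1).ofReal (𝕜 := ℂ)).mul_bdd (c := ∫ τ, ‖Ψ k τ‖)
          (hm' x k).aestronglyMeasurable (ae_of_all _ fun η => ?_)
        refine (norm_syn_le _ _).trans ?_
        refine integral_mono ((hΨ k).integrable.indicator measurableSet_Ioi).norm (hΨ k).integrable.norm
          fun τ => ?_
        exact norm_indicator_le_norm_self _ _
    _ = ∫⁻ η in Set.Ioo (0:ℝ) 1, ENNReal.ofReal (ρ η) * ∫⁻ x, ENNReal.ofReal
        ((∑ k, ‖syn ((Set.Ioi (ℓ k * c η)).indicator (Ψ k)) x‖ ^ 2) ^ (p / 2)) := by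
        rw [lintegral_lintegral_swap]
        · refine lintegral_congr fun η => ?_
          rw [lintegral_const_mul' _ _ ENNReal.ofReal_ne_top]
        · refine Measurable.aemeasurable (Measurable.mul (hρ.comp measurable_snd).ennreal_ofReal ?_)
          exact ((Finset.measurable_sum _ fun k _ => (hm k).norm.pow_const 2).pow_const _).ennreal_ofReal
    _ ≤ ∫⁻ η in Set.Ioo (0:ℝ) 1, ENNReal.ofReal (ρ η) * (ENNReal.ofReal (2 / (p - 1)) *
        ∫⁻ x, ENNReal.ofReal ((∑ k, ‖syn (Ψ k) x‖ ^ 2) ^ (p / 2))) :=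
        lintegral_mono fun η => mul_le_mul_right (riesz_boundary hΨ _ hp1 hp2) _
    _ = _ := by
        rw [lintegral_mul_const _ hρ.ennreal_ofReal, h1, one_mul]

end cutAvg

lemma mult_exp {ℓ τ : ℝ} (hℓ : 0 < ℓ) (hτ : 0 < τ) :
    mult (fun w => Real.exp (-2 * w * ℓ)) τ = τ ^ 2 / (τ + ℓ) ^ 2 := by
  have e : ∀ w, kern w τ * Real.exp (-2 * w * ℓ) = τ ^ 2 / (τ + ℓ) ^ 2 * kern w (τ + ℓ) := by
    intro w
    unfold kern
    rw [show -2 * w * (τ + ℓ) = -2 * w * τ + -2 * w * ℓ by ring, Real.exp_add]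
    field_simp
  unfold mult
  simp_rw [e]
  rw [integral_const_mul, integral_kern (by positivity), mul_one]

/-- The vertical profile of `uMul`. -/
def uAmp (ℓ w : ℝ) : ℝ := 2 * (w * ℓ) * Real.exp (-2 * w * ℓ)

/-- The smooth bump `2τ²ℓ/(τ+ℓ)³` adapted to frequency `ℓ`. -/
def uMul (ℓ τ : ℝ) : ℝ := 2 * τ ^ 2 * ℓ / (τ + ℓ) ^ 3

lemma mult_uAmp {ℓ τ : ℝ} (hℓ : 0 < ℓ) (hτ : 0 < τ) : mult (uAmp ℓ) τ = uMul ℓ τ := by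
  have h := Real.integral_rpow_mul_exp_neg_mul_Ioi (a := 3) (r := 2 * (τ + ℓ)) (by norm_num) (by positivity)
  have e : ∀ w : ℝ, kern w τ * uAmp ℓ w =
      8 * τ ^ 2 * ℓ * (w ^ ((3:ℝ) - 1) * Real.exp (-(2 * (τ + ℓ) * w))) := by
    intro w
    unfold kern uAmp
    rw [show (3:ℝ) - 1 = ((2:ℕ):ℝ) by norm_num, Real.rpow_natCast,
      show -(2 * (τ + ℓ) * w) = -2 * w * τ + -2 * w * ℓ by ring, Real.exp_add]
    ring
  unfold mult
  simp_rw [e]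
  have h3 : Real.Gamma 3 = 2 := by
    have := Real.Gamma_nat_eq_factorial 2
    norm_num at this
    simpa [Nat.factorial] using this
  rw [integral_const_mul, h, h3, show (3:ℝ) = ((3:ℕ):ℝ) by norm_num, Real.rpow_natCast, uMul]
  field_simp
  norm_num

lemma C1Int.uMul_mul {Φ : ℝ → ℂ} (h : C1Int Φ) (h0 : ∀ τ < 0, Φ τ = 0) {ℓ : ℝ} (hℓ : 0 < ℓ) :
    C1Int (fun τ => (uMul ℓ τ : ℂ) * Φ τ) := by
  refine h.mul_of_pos h0 (m := uMul ℓ)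
    (m' := fun τ => (4 * τ * ℓ * (τ + ℓ) ^ 3 - 2 * τ ^ 2 * ℓ * (3 * (τ + ℓ) ^ 2)) / ((τ + ℓ) ^ 3) ^ 2)
    (M := 2 + 10 / ℓ) ?_ ?_ ?_ ?_ ?_
  · unfold uMul; fun_prop
  · fun_prop
  · intro τ hτ
    have h1 : HasDerivAt (fun τ : ℝ => 2 * τ ^ 2 * ℓ) (4 * τ * ℓ) τ :=
      (((hasDerivAt_pow 2 τ).const_mul 2).mul_const ℓ).congr_deriv (by push_cast; ring)
    have h2 : HasDerivAt (fun τ : ℝ => (τ + ℓ) ^ 3) (3 * (τ + ℓ) ^ 2) τ :=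
      (((hasDerivAt_id τ).add_const ℓ).pow 3).congr_deriv (by simp)
    exact h1.div h2 (by positivity)
  · intro τ hτ
    have hs : 0 < τ + ℓ := by positivity
    have hp : 0 ≤ uMul ℓ τ := by unfold uMul; positivity
    rw [abs_of_nonneg hp]
    have : uMul ℓ τ ≤ 2 := by
      unfold uMul
      rw [div_le_iff₀ (by positivity)]
      have : 0 ≤ τ * ℓ ^ 2 := by positivity
      have : 0 ≤ τ ^ 2 * ℓ := by positivity
      have : 0 ≤ τ ^ 3 := by positivity
      have : 0 ≤ ℓ ^ 3 := by positivity
      nlinarith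
    have : 0 ≤ 10 / ℓ := by positivity
    linarith
  · intro τ hτ
    have hs : 0 < τ + ℓ := by positivity
    have e : (4 * τ * ℓ * (τ + ℓ) ^ 3 - 2 * τ ^ 2 * ℓ * (3 * (τ + ℓ) ^ 2)) / ((τ + ℓ) ^ 3) ^ 2 =
        (4 * τ * ℓ * (τ + ℓ) - 6 * τ ^ 2 * ℓ) / (τ + ℓ) ^ 4 := by
      field_simp
      ring
    rw [e, abs_div, abs_of_pos (by positivity : 0 < (τ + ℓ) ^ 4)]
    have hb : |4 * τ * ℓ * (τ + ℓ) - 6 * τ ^ 2 * ℓ| ≤ 10 * ℓ * (τ + ℓ) ^ 2 := by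
      have a1 : 0 ≤ τ * ℓ ^ 2 := by positivity
      have a2 : 0 ≤ τ ^ 2 * ℓ := by positivity
      have a4 : 0 ≤ ℓ ^ 3 := by positivity
      rw [abs_le]; constructor <;> nlinarith
    have : |4 * τ * ℓ * (τ + ℓ) - 6 * τ ^ 2 * ℓ| / (τ + ℓ) ^ 4 ≤ 10 / ℓ := by
      rw [div_le_div_iff₀ (by positivity) hℓ]
      calc _ ≤ 10 * ℓ * (τ + ℓ) ^ 2 * ℓ := mul_le_mul_of_nonneg_right hb hℓ.le
        _ = 10 * (ℓ ^ 2 * (τ + ℓ) ^ 2) := by ring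
        _ ≤ 10 * ((τ + ℓ) ^ 2 * (τ + ℓ) ^ 2) := by gcongr; linarith
        _ = _ := by ring
    linarith

lemma cutAvg_const {ℓ τ a : ℝ} : cutAvg (fun _ => 1) (fun _ => a) ℓ τ =
    (Set.Ioi (ℓ * a)).indicator (fun _ => (1:ℝ)) τ := by
  unfold cutAvg
  simp

lemma cutAvg_id {ℓ τ : ℝ} (hℓ : 0 < ℓ) (hτ : 0 < τ) :
    cutAvg (fun _ => 1) (fun η => η) ℓ τ = min (τ / ℓ) 1 := by
  unfold cutAvg
  have : ∀ η : ℝ, 1 * (Set.Ioi (ℓ * η)).indicator (fun _ => (1:ℝ)) τ =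
      (Set.Iio (τ / ℓ)).indicator (fun _ => (1:ℝ)) η := by
    intro η
    have : ℓ * η < τ ↔ η < τ / ℓ := by rw [lt_div_iff₀ hℓ, mul_comm]
    by_cases h : η < τ / ℓ <;> simp [h, this]
  simp_rw [this]
  rw [setIntegral_indicator measurableSet_Iio, Set.Ioo_inter_Iio]
  have : 0 < τ / ℓ := by positivity
  simp [min_comm, this.le]

/-- The weight of the reciprocal cut-offs. -/
def rhoInv (η : ℝ) : ℝ := (3 / 2 + η) / 2

lemma cutAvg_inv {ℓ τ : ℝ} (hℓ : 0 < ℓ) (hτ : 0 < τ) :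
    cutAvg rhoInv (fun η => η⁻¹) ℓ τ =
      if ℓ < τ then (3 / 2 * (1 - ℓ / τ) + 1 / 2 * (1 - (ℓ / τ) ^ 2)) / 2 else 0 := by
  unfold cutAvg
  have h : ∀ η ∈ Set.Ioo (0:ℝ) 1, rhoInv η * (Set.Ioi (ℓ * η⁻¹)).indicator (fun _ => (1:ℝ)) τ =
      (Set.Ioi (ℓ / τ)).indicator rhoInv η := by
    intro η hη
    have : ℓ * η⁻¹ < τ ↔ ℓ / τ < η := by
      rw [← div_eq_mul_inv, div_lt_iff₀ hη.1, div_lt_iff₀ hτ, mul_comm]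
    by_cases h : ℓ / τ < η <;> simp [h, this]
  rw [setIntegral_congr_fun measurableSet_Ioo h, setIntegral_indicator measurableSet_Ioi]
  have hp : 0 < ℓ / τ := by positivity
  rw [Set.Ioo_inter_Ioi, max_eq_right hp.le]
  split_ifs with hlt
  · have hs : ℓ / τ ≤ 1 := by rw [div_le_one hτ]; exact hlt.le
    rw [← integral_Ioc_eq_integral_Ioo, ← intervalIntegral.integral_of_le hs]
    have : ∀ η ∈ Set.uIcc (ℓ / τ) 1, HasDerivAt (fun η : ℝ => (3 / 2 * η + η ^ 2 / 2) / 2) (rhoInv η) η := by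
      intro η _
      refine ((((hasDerivAt_id η).const_mul (3 / 2)).add ((hasDerivAt_pow 2 η).div_const 2)).div_const
        2).congr_deriv ?_
      unfold rhoInv
      push_cast; ring
    rw [intervalIntegral.integral_eq_sub_of_hasDerivAt this]
    · ring
    · exact Continuous.intervalIntegrable (by unfold rhoInv; fun_prop) _ _
  · rw [Set.Ioo_eq_empty]
    · simp
    · rw [not_lt, le_div_iff₀ hτ, one_mul]; exact not_lt.1 hlt

/-- The rough multiplier correcting the smooth cut-off `τ²/(τ+ℓ)²` on top of `uMul`. -/
def nMul (ℓ τ : ℝ) : ℝ :=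
  (-(1 / 2) * cutAvg (fun _ => 1) (fun _ => 0) ℓ τ + -(1 / 2) * cutAvg (fun _ => 1) (fun η => η) ℓ τ) +
    (4 * cutAvg (fun _ => 1) (fun _ => 1) ℓ τ + -2 * cutAvg rhoInv (fun η => η⁻¹) ℓ τ)

lemma sharp_cut_eq {ℓ τ : ℝ} (hℓ : 0 < ℓ) (hτ : 0 < τ) :
    τ ^ 2 / (τ + ℓ) ^ 2 + nMul ℓ τ * uMul ℓ τ = if ℓ < τ then 1 else 0 := by
  rw [nMul, cutAvg_const, cutAvg_const, cutAvg_id hℓ hτ, cutAvg_inv hℓ hτ, uMul]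
  split_ifs with h
  · rw [min_eq_right (by rw [le_div_iff₀ hℓ]; linarith)]
    simp only [mul_zero, mul_one, Set.indicator_of_mem (Set.mem_Ioi.2 hτ),
      Set.indicator_of_mem (Set.mem_Ioi.2 h)]
    field_simp
    ring
  · rw [min_eq_left (by rw [div_le_iff₀ hℓ]; linarith)]
    simp only [mul_zero, mul_one, Set.indicator_of_mem (Set.mem_Ioi.2 hτ),
      Set.indicator_of_notMem (by simpa using h : τ ∉ Set.Ioi ℓ)]
    field_simp
    ring

lemma mprof_uAmp {Φ : ℝ → ℂ} (h : C1Int Φ) (h0 : ∀ τ < 0, Φ τ = 0) {ℓ : ℝ} (hℓ : 0 < ℓ) :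
    mprof (uAmp ℓ) Φ = fun τ => (uMul ℓ τ : ℂ) * Φ τ := by
  have h00 : Φ 0 = 0 := by
    have hcl : Set.EqOn Φ 0 (closure (Set.Iio 0)) :=
      Set.EqOn.closure (fun τ hτ => h0 τ hτ) h.continuous continuous_const
    exact hcl (by simp)
  ext τ
  unfold mprof
  by_cases hτ : 0 < τ
  · rw [Set.indicator_of_mem (by exact hτ), mult_uAmp hℓ hτ]
  · rw [Set.indicator_of_notMem (by exact hτ)]
    rcases (not_lt.1 hτ).eq_or_lt with h | h
    · rw [h, h00, mul_zero]
    · rw [h0 τ h, mul_zero]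

lemma measurable_uAmp (ℓ : ℝ) : Measurable (uAmp ℓ) := by unfold uAmp; fun_prop

lemma uAmp_nonneg {ℓ w : ℝ} (hℓ : 0 < ℓ) (hw : 0 < w) : 0 ≤ uAmp ℓ w := by unfold uAmp; positivity

lemma lintegral_one_Ioo : ∫⁻ η in Set.Ioo (0:ℝ) 1, ENNReal.ofReal ((fun _ => 1 : ℝ → ℝ) η) = 1 := by
  simp

lemma lintegral_rhoInv : ∫⁻ η in Set.Ioo (0:ℝ) 1, ENNReal.ofReal (rhoInv η) = 1 := by
  have hc : Continuous rhoInv := by unfold rhoInv; fun_prop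
  rw [← ofReal_integral_eq_lintegral_ofReal]
  · rw [← integral_Ioc_eq_integral_Ioo, ← intervalIntegral.integral_of_le (by norm_num)]
    have : ∀ η ∈ Set.uIcc (0:ℝ) 1, HasDerivAt (fun η : ℝ => (3 / 2 * η + η ^ 2 / 2) / 2) (rhoInv η) η := by
      intro η _
      refine ((((hasDerivAt_id η).const_mul (3 / 2)).add ((hasDerivAt_pow 2 η).div_const 2)).div_const
        2).congr_deriv ?_
      unfold rhoInv
      push_cast; ring
    rw [intervalIntegral.integral_eq_sub_of_hasDerivAt this (hc.intervalIntegrable _ _)]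
    norm_num
  · exact (hc.continuousOn.integrableOn_compact (isCompact_Icc (a := 0) (b := 1))).mono_set
      Set.Ioo_subset_Icc_self
  · filter_upwards [ae_restrict_mem measurableSet_Ioo] with η hη
    have := hη.1
    unfold rhoInv
    simp only [Pi.zero_apply]
    positivity

lemma synE_nMul_le {ι J : Type*} [Fintype ι] [Fintype J] {Φ : ι → ℝ → ℂ} (hΦ : ∀ i, C1Int (Φ i))
    (h0 : ∀ i, ∀ τ < 0, Φ i τ = 0) {ℓ : J → ℝ} (hℓ : ∀ j, 0 < ℓ j) {p : ℝ} (hp1 : 1 < p) (hp2 : p < 2)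
    {O : ℝ} (hOp : 0 < O) (hO : ∀ w, 0 < w → ∑ j, uAmp (ℓ j) w ^ 2 ≤ O) :
    (∀ k : ι × J, Integrable fun τ => ((nMul (ℓ k.2) τ * uMul (ℓ k.2) τ : ℝ) : ℂ) * Φ k.1 τ) ∧
    synE p (fun (k : ι × J) τ => ((nMul (ℓ k.2) τ * uMul (ℓ k.2) τ : ℝ) : ℂ) * Φ k.1 τ) ≤
      256 * (ENNReal.ofReal (2 / (p - 1)) * (ENNReal.ofReal ((76 * Real.sqrt O) ^ p) * synE p Φ)) := by
  set Ψ : ι × J → ℝ → ℂ := fun k τ => (uMul (ℓ k.2) τ : ℂ) * Φ k.1 τ with hΨd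
  have hΨ : ∀ k, C1Int (Ψ k) := fun k => (hΦ k.1).uMul_mul (h0 k.1) (hℓ k.2)
  have hY : synE p Ψ ≤ ENNReal.ofReal ((76 * Real.sqrt O) ^ p) * synE p Φ := by
    have := lp_upper (a := fun j => uAmp (ℓ j)) (fun j => measurable_uAmp _)
      (fun j w hw => uAmp_nonneg (hℓ j) hw) hOp hO hΦ h0 hp1 hp2
    simp_rw [fun k : ι × J => mprof_uAmp (hΦ k.1) (h0 k.1) (hℓ k.2)] at this
    exact this
  set E := ENNReal.ofReal (2 / (p - 1)) * synE p Ψ with hE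
  have hm1 : Measurable fun _ : ℝ => (1:ℝ) := measurable_const
  have hp1' : ∀ᵐ η ∂(volume.restrict (Set.Ioo (0:ℝ) 1)), 0 ≤ (fun _ : ℝ => (1:ℝ)) η :=
    ae_of_all _ fun _ => zero_le_one
  have hm2 : Measurable rhoInv := by unfold rhoInv; fun_prop
  have hp2' : ∀ᵐ η ∂(volume.restrict (Set.Ioo (0:ℝ) 1)), 0 ≤ rhoInv η := by
    filter_upwards [ae_restrict_mem measurableSet_Ioo] with η hη
    have := hη.1
    unfold rhoInv
    positivity
  have avg : ∀ {ρ c : ℝ → ℝ} {s : ℝ}, Measurable ρ → Measurable c →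
      (∀ᵐ η ∂(volume.restrict (Set.Ioo (0:ℝ) 1)), 0 ≤ ρ η) →
      ∫⁻ η in Set.Ioo (0:ℝ) 1, ENNReal.ofReal (ρ η) = 1 → |s| ≤ 4 →
      (∀ k, Integrable fun τ => (s : ℂ) * ((cutAvg ρ c (ℓ k.2) τ : ℂ) * Ψ k τ)) ∧
      synE p (fun k τ => (s : ℂ) * ((cutAvg ρ c (ℓ k.2) τ : ℂ) * Ψ k τ)) ≤ 16 * E := by
    intro ρ c s hρ hc hρ0 h1 hs
    refine ⟨fun k => (integrable_cutAvg_mul hρ hc hρ0 h1 (ℓ k.2) (hΨ k).integrable).const_mul _, ?_⟩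
    refine (synE_const_mul_le hs hp1 hp2).trans (mul_le_mul_right ?_ _)
    exact riesz_avg hρ hc hρ0 h1 hΨ (fun k => ℓ k.2) hp1 hp2
  obtain ⟨i1, b1⟩ := avg (s := -(1 / 2)) (c := fun _ => 0) hm1 measurable_const hp1' lintegral_one_Ioo
    (by norm_num [abs_le])
  obtain ⟨i2, b2⟩ := avg (s := -(1 / 2)) (c := fun η => η) hm1 measurable_id hp1' lintegral_one_Ioo
    (by norm_num [abs_le])
  obtain ⟨i3, b3⟩ := avg (s := 4) (c := fun _ => 1) hm1 measurable_const hp1' lintegral_one_Ioo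
    (by norm_num [abs_le])
  obtain ⟨i4, b4⟩ := avg (s := -2) (c := fun η => η⁻¹) hm2 measurable_inv hp2' lintegral_rhoInv
    (by norm_num [abs_le])
  have e := (synE_add_le (fun k => (i1 k).add (i2 k)) (fun k => (i3 k).add (i4 k)) hp1 hp2).trans
    (mul_le_mul_right (add_le_add (synE_add_le i1 i2 hp1 hp2) (synE_add_le i3 i4 hp1 hp2)) 2)
  have e' := e.trans (mul_le_mul_right (add_le_add (mul_le_mul_right (add_le_add b1 b2) 2)
    (mul_le_mul_right (add_le_add b3 b4) 2)) 2)
  have eq : (fun (k : ι × J) τ => ((nMul (ℓ k.2) τ * uMul (ℓ k.2) τ : ℝ) : ℂ) * Φ k.1 τ) = fun k τ =>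
      (((-(1 / 2) : ℝ) : ℂ) * ((cutAvg (fun _ => 1) (fun _ => 0) (ℓ k.2) τ : ℂ) * Ψ k τ) +
      ((-(1 / 2) : ℝ) : ℂ) * ((cutAvg (fun _ => 1) (fun η => η) (ℓ k.2) τ : ℂ) * Ψ k τ)) +
      (((4 : ℝ) : ℂ) * ((cutAvg (fun _ => 1) (fun _ => 1) (ℓ k.2) τ : ℂ) * Ψ k τ) +
      ((-2 : ℝ) : ℂ) * ((cutAvg rhoInv (fun η => η⁻¹) (ℓ k.2) τ : ℂ) * Ψ k τ)) := by
    ext k τ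
    rw [hΨd, nMul]
    push_cast
    ring
  refine ⟨fun k => ?_, ?_⟩
  · rw [show (fun τ => ((nMul (ℓ k.2) τ * uMul (ℓ k.2) τ : ℝ) : ℂ) * Φ k.1 τ) = _ from congrFun eq k]
    exact ((i1 k).add (i2 k)).add ((i3 k).add (i4 k))
  · rw [eq]
    refine e'.trans ?_
    calc _ = 256 * E := by ring
      _ ≤ _ := mul_le_mul_right (mul_le_mul_right hY _) _

lemma sum_increments_le {g : ℤ → ℝ} (hg : ∀ m, 0 ≤ g m) (s : Finset ℤ) :
    Monotone g → ∀ M, (∀ m ∈ s, m ≤ M) → ∑ m ∈ s, (g m - g (m - 1)) ≤ g M := by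
  intro hm
  induction s using Finset.induction_on_max with
  | empty => intro M _; simpa using hg M
  | insert a s ha ih =>
    intro M hM
    rw [Finset.sum_insert fun h => lt_irrefl _ (ha a h)]
    have h1 := ih (a - 1) fun m hm => by have := ha m hm; omega
    have h2 := hm (hM a (Finset.mem_insert_self _ _))
    linarith

lemma sum_increments_le_one {g : ℤ → ℝ} (hg : ∀ m, 0 ≤ g m) (hg1 : ∀ m, g m ≤ 1) (hm : Monotone g)
    (s : Finset ℤ) : ∑ m ∈ s, (g m - g (m - 1)) ≤ 1 := by
  rcases s.eq_empty_or_nonempty with h | h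
  · simp [h]
  · exact (sum_increments_le hg s hm (s.max' h) fun m hm => s.le_max' m hm).trans (hg1 _)

lemma exp_diff_sq_sum_le {Λ : ℤ → ℝ} (hpos : ∀ j, 0 < Λ j) (hmono : StrictMono Λ) (s : Finset ℤ)
    {w : ℝ} (hw : 0 < w) :
    ∑ j ∈ s, (Real.exp (-2 * w * Λ (j - 1)) - Real.exp (-2 * w * Λ j)) ^ 2 ≤ 1 := by
  have hm : Monotone fun j => 1 - Real.exp (-2 * w * Λ j) := by
    intro i j hij
    have := hmono.monotone hij
    have : Real.exp (-2 * w * Λ j) ≤ Real.exp (-2 * w * Λ i) := Real.exp_le_exp.2 (by nlinarith)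
    simp only; linarith
  have h0 : ∀ j, 0 ≤ 1 - Real.exp (-2 * w * Λ j) := fun j => by
    have := Real.exp_le_one_iff.2 (show -2 * w * Λ j ≤ 0 by nlinarith [hpos j, mul_pos hw (hpos j)])
    linarith
  have h1 : ∀ j, 1 - Real.exp (-2 * w * Λ j) ≤ 1 := fun j => by
    have := Real.exp_pos (-2 * w * Λ j); linarith
  refine (Finset.sum_le_sum fun j _ => ?_).trans (sum_increments_le_one h0 h1 hm s)
  have a1 := hm (show j - 1 ≤ j by omega)
  have a2 := h0 (j - 1)
  have a3 := h1 j
  have a4 := h0 j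
  have a5 := h1 (j - 1)
  simp only at a1
  nlinarith

section lacunary
variable {Λ : ℤ → ℝ} (hpos : ∀ j, 0 < Λ j) (hmono : StrictMono Λ) (hbot : Tendsto Λ atBot (𝓝 0))
  (htop : Tendsto Λ atTop atTop)
  (hbdd : BddAbove {m : ℕ | ∃ j : ℤ, m = (Set.range Λ ∩ Set.Ico ((2:ℝ) ^ (j - 1)) ((2:ℝ) ^ j)).ncard})
include hpos hmono hbot htop

lemma finite_block (m : ℤ) : (Set.range Λ ∩ Set.Ico ((2:ℝ) ^ (m - 1)) ((2:ℝ) ^ m)).Finite := by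
  have h1 : ∀ᶠ j in atBot, Λ j < (2:ℝ) ^ (m - 1) := hbot.eventually_lt_const (by positivity)
  have h2 : ∀ᶠ j in atTop, (2:ℝ) ^ m ≤ Λ j := htop.eventually_ge_atTop _
  obtain ⟨a, ha⟩ := h1.exists
  obtain ⟨b, hb⟩ := h2.exists
  refine ((Set.finite_Icc a b).image Λ).subset ?_
  rintro _ ⟨⟨j, rfl⟩, hj⟩
  refine ⟨j, ⟨?_, ?_⟩, rfl⟩
  · exact (hmono.lt_iff_lt.1 (ha.trans_le hj.1)).le
  · exact (hmono.lt_iff_lt.1 (hj.2.trans_le hb)).le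

include hbdd

lemma card_block_le (s : Finset ℤ) (m : ℤ) :
    (s.filter fun j => Λ j ∈ Set.Ico ((2:ℝ) ^ (m - 1)) ((2:ℝ) ^ m)).card ≤ sigmaE Λ := by
  refine le_trans ?_ (le_csSup hbdd ⟨m, rfl⟩)
  rw [← Finset.card_image_of_injective _ hmono.injective, ← Set.ncard_coe_finset]
  refine Set.ncard_le_ncard ?_ (finite_block hpos hmono hbot htop m)
  intro x hx
  simp only [Finset.coe_image, Set.mem_image, Finset.mem_coe, Finset.mem_filter] at hx
  obtain ⟨j, ⟨_, hj⟩, rfl⟩ := hx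
  exact ⟨⟨j, rfl⟩, hj⟩

lemma log_block (j : ℤ) : Λ j ∈ Set.Ico ((2:ℝ) ^ (Int.log 2 (Λ j) + 1 - 1)) ((2:ℝ) ^ (Int.log 2 (Λ j) + 1)) := by
  constructor
  · have := Int.zpow_log_le_self (b := 2) (by norm_num) (hpos j)
    simpa using this
  · have := Int.lt_zpow_succ_log_self (b := 2) (by norm_num) (Λ j)
    exact_mod_cast this

lemma one_le_sigmaE : 1 ≤ sigmaE Λ := by
  have := card_block_le hpos hmono hbot htop hbdd {0} (Int.log 2 (Λ 0) + 1)
  rwa [Finset.filter_singleton, if_pos (log_block hpos hmono hbot htop hbdd 0), Finset.card_singleton] at this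

omit hpos hmono hbot htop hbdd in
lemma uAmp_sq_le {t u : ℝ} (h1 : u / 2 ≤ t) (h2 : t < u) :
    (2 * t * Real.exp (-2 * t)) ^ 2 ≤ 16 * (u / (1 + u) - (u / 2) / (1 + u / 2)) := by
  have hu : 0 < u := by linarith
  have ht : 0 < t := by linarith
  have e1 : u / (1 + u) - (u / 2) / (1 + u / 2) = (u / 2) / ((1 + u) * (1 + u / 2)) := by
    field_simp
    ring
  have e2 : (t / 2) / ((1 + 2 * t) * (1 + t)) ≤ (u / 2) / ((1 + u) * (1 + u / 2)) := by
    gcongr <;> linarith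
  have e3 : (1 + t) ^ 3 ≤ Real.exp (4 * t) := by
    have : 1 + t ≤ Real.exp t := by linarith [Real.add_one_le_exp t]
    calc (1 + t) ^ 3 ≤ Real.exp t ^ 3 := pow_le_pow_left₀ (by positivity) this 3
      _ = Real.exp (3 * t) := by rw [← Real.exp_nat_mul]; norm_num
      _ ≤ _ := Real.exp_le_exp.2 (by linarith)
  have e4 : (2 * t * Real.exp (-2 * t)) ^ 2 = 4 * t ^ 2 / Real.exp (4 * t) := by
    rw [mul_pow, ← Real.exp_nat_mul, show ((2:ℕ):ℝ) * (-2 * t) = -(4 * t) by push_cast; ring,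
      Real.exp_neg]
    field_simp
    norm_num
  rw [e1, e4]
  calc 4 * t ^ 2 / Real.exp (4 * t) ≤ 4 * t ^ 2 / (1 + t) ^ 3 := by gcongr
    _ ≤ 16 * ((t / 2) / ((1 + 2 * t) * (1 + t))) := by
        rw [div_le_iff₀ (by positivity)]
        have : 16 * ((t / 2) / ((1 + 2 * t) * (1 + t))) * (1 + t) ^ 3 =
            8 * t * (1 + t) ^ 2 / (1 + 2 * t) := by field_simp; ring
        rw [this, le_div_iff₀ (by positivity)]
        nlinarith [mul_pos ht ht, mul_pos (mul_pos ht ht) ht]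
    _ ≤ _ := by gcongr

lemma uAmp_sq_sum_le (s : Finset ℤ) {w : ℝ} (hw : 0 < w) :
    ∑ j ∈ s, uAmp (Λ j) w ^ 2 ≤ 16 * sigmaE Λ := by
  set g : ℤ → ℝ := fun m => (w * 2 ^ m) / (1 + w * 2 ^ m) with hg
  have hg0 : ∀ m, 0 ≤ g m := fun m => by rw [hg]; positivity
  have hg1 : ∀ m, g m ≤ 1 := fun m => by
    rw [hg]; simp only
    rw [div_le_one (by positivity)]; linarith
  have hgm : Monotone g := by
    intro m n hmn
    rw [hg]; simp only
    have : (2:ℝ) ^ m ≤ 2 ^ n := zpow_le_zpow_right₀ (by norm_num) hmn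
    rw [div_le_div_iff₀ (by positivity) (by positivity)]
    nlinarith [mul_le_mul_of_nonneg_left this hw.le]
  set b : ℤ → ℤ := fun j => Int.log 2 (Λ j) + 1 with hb
  have h1 : ∀ j, uAmp (Λ j) w ^ 2 ≤ 16 * (g (b j) - g (b j - 1)) := by
    intro j
    have hj := log_block hpos hmono hbot htop hbdd j
    have e : (2:ℝ) ^ (b j - 1) = 2 ^ (b j) / 2 := by rw [zpow_sub_one₀ (by norm_num)]; ring
    have := uAmp_sq_le (t := w * Λ j) (u := w * 2 ^ (b j))
      (by
        have := mul_le_mul_of_nonneg_left hj.1 hw.le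
        rw [e] at this
        linarith) (mul_lt_mul_of_pos_left hj.2 hw)
    have e' : g (b j - 1) = (w * 2 ^ b j / 2) / (1 + w * 2 ^ b j / 2) := by
      rw [hg]; simp only
      rw [e]; ring_nf
    rw [e']
    refine le_trans (le_of_eq ?_) this
    unfold uAmp
    ring_nf
  calc ∑ j ∈ s, uAmp (Λ j) w ^ 2 ≤ ∑ j ∈ s, 16 * (g (b j) - g (b j - 1)) :=
        Finset.sum_le_sum fun j _ => h1 j
    _ = ∑ m ∈ s.image b, (s.filter fun j => b j = m).card • (16 * (g m - g (m - 1))) :=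
        Finset.sum_comp (fun m => 16 * (g m - g (m - 1))) b
    _ ≤ ∑ m ∈ s.image b, (sigmaE Λ : ℝ) * (16 * (g m - g (m - 1))) := by
        refine Finset.sum_le_sum fun m _ => ?_
        rw [nsmul_eq_mul]
        refine mul_le_mul_of_nonneg_right ?_ ?_
        · refine Nat.cast_le.2 (le_trans (Finset.card_le_card ?_)
            (card_block_le hpos hmono hbot htop hbdd s m))
          intro j hj
          rw [Finset.mem_filter] at hj ⊢
          refine ⟨hj.1, ?_⟩
          rw [← hj.2]
          exact log_block hpos hmono hbot htop hbdd j
        · have := hgm (show m - 1 ≤ m by omega); linarith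
    _ = 16 * sigmaE Λ * ∑ m ∈ s.image b, (g m - g (m - 1)) := by
        rw [Finset.mul_sum]; refine Finset.sum_congr rfl fun m _ => ?_; ring
    _ ≤ 16 * sigmaE Λ * 1 := mul_le_mul_of_nonneg_left (sum_increments_le_one hg0 hg1 hgm _) (by positivity)
    _ = _ := mul_one _

end lacunary

/-- The absolute constant of the one-parameter estimate. -/
def oneC : ℝ := 100000000

lemma ennreal_collect {S p : ℝ} (hp1 : 1 < p) (hp2 : p < 2) (hS : 1 ≤ S) {Y : ℝ≥0∞} :
    2 * (ENNReal.ofReal ((76 * Real.sqrt 1) ^ p) * Y + 2 *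
      (256 * (ENNReal.ofReal (2 / (p - 1)) * (ENNReal.ofReal ((76 * Real.sqrt (16 * S)) ^ p) * Y)) +
       16 * (256 * (ENNReal.ofReal (2 / (p - 1)) * (ENNReal.ofReal ((76 * Real.sqrt (16 * S)) ^ p) * Y))))) ≤
    ENNReal.ofReal ((oneC * Real.sqrt S / (p - 1)) ^ p) * Y := by
  have h1 : 0 < p - 1 := by linarith
  have h2 : 1 ≤ 1 / (p - 1) := by rw [le_div_iff₀ h1]; linarith
  set A := (76 * Real.sqrt 1) ^ p with hA
  set B := (76 * Real.sqrt (16 * S)) ^ p with hB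
  have hA0 : 0 ≤ A := by positivity
  have hB0 : 0 ≤ B := by positivity
  have hAB : A ≤ B := Real.rpow_le_rpow (by positivity)
    (mul_le_mul_of_nonneg_left (Real.sqrt_le_sqrt (by linarith)) (by norm_num)) (by linarith)
  have e : ∀ n : ℕ, [n.AtLeastTwo] → (OfNat.ofNat n : ℝ≥0∞) = ENNReal.ofReal (OfNat.ofNat n) := fun n _ => by simp
  have key : 2 * (ENNReal.ofReal A + 2 * (256 * (ENNReal.ofReal (2 / (p - 1)) * ENNReal.ofReal B) +
      16 * (256 * (ENNReal.ofReal (2 / (p - 1)) * ENNReal.ofReal B)))) ≤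
      ENNReal.ofReal ((oneC * Real.sqrt S / (p - 1)) ^ p) := by
    rw [e 2, e 256, e 16]
    have hd : 0 ≤ 2 / (p - 1) := by positivity
    rw [← ENNReal.ofReal_mul hd, ← ENNReal.ofReal_mul (by norm_num), ← ENNReal.ofReal_mul (by norm_num),
      ← ENNReal.ofReal_add (by positivity) (by positivity), ← ENNReal.ofReal_mul (by norm_num),
      ← ENNReal.ofReal_add (by positivity) (by positivity), ← ENNReal.ofReal_mul (by norm_num)]
    refine ENNReal.ofReal_le_ofReal ?_
    have hM : 1 ≤ 40000 / (p - 1) := by rw [le_div_iff₀ h1]; linarith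
    have e16 : Real.sqrt (16 * S) = 4 * Real.sqrt S := by
      rw [Real.sqrt_mul (by norm_num), show (16:ℝ) = 4 ^ 2 by norm_num, Real.sqrt_sq (by norm_num)]
    calc _ ≤ 40000 / (p - 1) * B := by
          have : B ≤ 1 / (p - 1) * B := le_mul_of_one_le_left hB0 h2
          have e1 : 2 / (p - 1) * B = 2 * (1 / (p - 1) * B) := by ring
          have e2 : 40000 / (p - 1) * B = 40000 * (1 / (p - 1) * B) := by ring
          rw [e1, e2]
          linarith
      _ ≤ (40000 / (p - 1)) ^ p * B := by
          refine mul_le_mul_of_nonneg_right ?_ hB0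
          exact Real.self_le_rpow_of_one_le hM hp1.le
      _ = (40000 / (p - 1) * (76 * Real.sqrt (16 * S))) ^ p :=
          (Real.mul_rpow (by positivity) (by positivity)).symm
      _ ≤ _ := by
          refine Real.rpow_le_rpow (by positivity) ?_ (by linarith)
          rw [e16, oneC, div_mul_eq_mul_div]
          refine div_le_div_of_nonneg_right ?_ h1.le
          have := Real.sqrt_nonneg S
          linarith
  calc _ = 2 * (ENNReal.ofReal A + 2 * (256 * (ENNReal.ofReal (2 / (p - 1)) * ENNReal.ofReal B) +
      16 * (256 * (ENNReal.ofReal (2 / (p - 1)) * ENNReal.ofReal B)))) * Y := by ring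
    _ ≤ _ := mul_le_mul_left key _

lemma symInd_of_pos {Λ : ℤ → ℝ} (hpos : ∀ j, 0 < Λ j) (hmono : StrictMono Λ) {j : ℤ} {τ : ℝ}
    (hτ : 0 < τ) (h1 : τ ≠ Λ j) (h2 : τ ≠ Λ (j - 1)) :
    symInd Λ j τ = (if Λ (j - 1) < τ then 1 else 0) - if Λ j < τ then 1 else 0 := by
  have hj := hmono (show j - 1 < j by omega)
  have := hpos (j - 1)
  unfold symInd
  have h3 : ¬ (-(Λ j) < τ ∧ τ ≤ -(Λ (j - 1))) := fun h => by linarith [h.2]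
  rcases lt_or_gt_of_ne h1 with h | h <;> rcases lt_or_gt_of_ne h2 with h' | h'
  · simp [h3, not_le.2 h', not_lt.2 h'.le, not_lt.2 h.le]
  · simp [h3, h'.le, h', h, not_lt.2 h.le]
  · linarith
  · simp [h3, h'.le, h', h, not_lt.2 h.le]

lemma measurable_symInd (Λ : ℤ → ℝ) (j : ℤ) : Measurable (symInd Λ j) := by
  unfold symInd
  refine Measurable.ite ?_ measurable_const measurable_const
  exact ((measurableSet_Ico (a := Λ (j - 1)) (b := Λ j))).union
    (measurableSet_Ioc (a := -(Λ j)) (b := -(Λ (j - 1))))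

lemma abs_symInd_le (Λ : ℤ → ℝ) (j : ℤ) (τ : ℝ) : |symInd Λ j τ| ≤ 1 := by
  unfold symInd; split_ifs <;> simp

lemma one_parameter {Λ : ℤ → ℝ} (hpos : ∀ j, 0 < Λ j) (hmono : StrictMono Λ)
    (hbot : Tendsto Λ atBot (𝓝 0)) (htop : Tendsto Λ atTop atTop)
    (hbdd : BddAbove {m : ℕ | ∃ j : ℤ, m = (Set.range Λ ∩ Set.Ico ((2:ℝ) ^ (j - 1)) ((2:ℝ) ^ j)).ncard})
    {ι : Type*} [Fintype ι] {Φ : ι → ℝ → ℂ} (hΦ : ∀ i, C1Int (Φ i)) (h0 : ∀ i, ∀ τ < 0, Φ i τ = 0)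
    {p : ℝ} (hp1 : 1 < p) (hp2 : p < 2) (s : Finset ℤ) :
    synE p (fun (k : ι × s) τ => (symInd Λ k.2 τ : ℂ) * Φ k.1 τ) ≤
      ENNReal.ofReal ((oneC * Real.sqrt (sigmaE Λ) / (p - 1)) ^ p) * synE p Φ := by
  have hσ : (1:ℝ) ≤ sigmaE Λ := by exact_mod_cast one_le_sigmaE hpos hmono hbot htop hbdd
  set a : s → ℝ → ℝ := fun j w => Real.exp (-2 * w * Λ (j - 1)) - Real.exp (-2 * w * Λ j) with ha
  have ham : ∀ j, Measurable (a j) := fun j => by rw [ha]; fun_prop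
  have ha0 : ∀ j w, 0 < w → 0 ≤ a j w := fun j w hw => by
    have := hmono (show (j:ℤ) - 1 < j by omega)
    rw [ha]
    exact sub_nonneg.2 (Real.exp_le_exp.2 (by nlinarith))
  have haO : ∀ w, 0 < w → ∑ j, a j w ^ 2 ≤ 1 := fun w hw => by
    have := exp_diff_sq_sum_le hpos hmono s hw
    rwa [← Finset.sum_coe_sort] at this
  have haA : ∀ j w, 0 < w → |a j w| ≤ 1 := fun j w hw => by
    rw [← Real.sqrt_one]
    exact Real.abs_le_sqrt ((Finset.single_le_sum (f := fun j => a j w ^ 2)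
      (fun j _ => sq_nonneg _) (Finset.mem_univ j)).trans (haO w hw))
  have hM := lp_upper ham ha0 one_pos haO hΦ h0 hp1 hp2
  have hMi : ∀ k : ι × s, Integrable (mprof (a k.2) (Φ k.1)) := fun k =>
    integrable_mprof (ham k.2) (haA k.2) (hΦ k.1).integrable
  obtain ⟨i1, b1⟩ := synE_nMul_le hΦ h0 (ℓ := fun j : s => Λ j) (fun j => hpos _) hp1 hp2
    (O := 16 * sigmaE Λ) (by positivity) (fun w hw => by
      have := uAmp_sq_sum_le hpos hmono hbot htop hbdd s hw
      rwa [← Finset.sum_coe_sort] at this)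
  obtain ⟨i2, b2⟩ := synE_nMul_le hΦ h0 (ℓ := fun j : s => Λ (j - 1)) (fun j => hpos _) hp1 hp2
    (O := 16 * sigmaE Λ) (by positivity) (fun w hw => by
      have := uAmp_sq_sum_le hpos hmono hbot htop hbdd (s.image fun j => j - 1) hw
      rw [Finset.sum_image fun x _ y _ h => by simpa using h] at this
      rwa [← Finset.sum_coe_sort] at this)
  set N1 : ι × s → ℝ → ℂ := fun k τ => ((nMul (Λ k.2) τ * uMul (Λ k.2) τ : ℝ) : ℂ) * Φ k.1 τ with hN1
  set N2 : ι × s → ℝ → ℂ :=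
    fun k τ => ((nMul (Λ (k.2 - 1)) τ * uMul (Λ (k.2 - 1)) τ : ℝ) : ℂ) * Φ k.1 τ with hN2
  have i1' : ∀ k, Integrable (fun τ => ((-1 : ℝ) : ℂ) * N1 k τ) := fun k => (i1 k).const_mul _
  have b1' := (synE_const_mul_le (α := N1) (c := -1) (by norm_num) hp1 hp2).trans (mul_le_mul_right b1 16)
  have hsum := (synE_add_le hMi (fun k => (i2 k).add (i1' k)) hp1 hp2).trans
    (mul_le_mul_right (add_le_add hM ((synE_add_le i2 i1' hp1 hp2).trans
      (mul_le_mul_right (add_le_add b2 b1') 2))) 2)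
  refine le_trans (le_of_eq (synE_congr fun k => ?_)) (hsum.trans (ennreal_collect hp1 hp2 hσ))
  have hne : ∀ c : ℝ, ∀ᵐ τ : ℝ, τ ≠ c := fun c => by
    simp [ae_iff]
  filter_upwards [hne 0, hne (Λ k.2), hne (Λ (k.2 - 1))] with τ t0 t1 t2
  rcases lt_or_gt_of_ne t0 with hτ | hτ
  · have : mprof (a k.2) (Φ k.1) τ = 0 :=
      Set.indicator_of_notMem (by simpa using hτ.le) _
    simp [h0 k.1 τ hτ, hN1, this]
  · have e1 := sharp_cut_eq (hpos k.2) hτ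
    have e2 := sharp_cut_eq (hpos (k.2 - 1)) hτ
    have em : mult (a k.2) τ = τ ^ 2 / (τ + Λ (k.2 - 1)) ^ 2 - τ ^ 2 / (τ + Λ k.2) ^ 2 := by
      rw [← mult_exp (hpos _) hτ, ← mult_exp (hpos _) hτ]
      unfold mult
      rw [← integral_sub]
      · congr 1; ext w; rw [ha]; ring
      all_goals
        refine integrableOn_kern_mul (A := 1) (by fun_prop) (fun w hw => ?_) hτ
        rw [abs_of_pos (Real.exp_pos _), Real.exp_le_one_iff]
      · nlinarith [mul_pos hw (hpos (k.2 - 1))]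
      · nlinarith [mul_pos hw (hpos k.2)]
    rw [symInd_of_pos hpos hmono hτ t1 t2, ← e1, ← e2]
    simp only [Pi.add_apply, mprof, hN1]
    rw [Set.indicator_of_mem (Set.mem_Ioi.2 hτ), em]
    push_cast
    ring

open scoped FourierTransform in
lemma exists_schwartz_FTd {d : ℕ} (f : SchwartzMap (Fin d → ℝ) ℂ) :
    ∃ φ : SchwartzMap (Fin d → ℝ) ℂ, (∀ ξ, φ ξ = FTd f ξ) ∧
      ∀ x, f x = (((2 * π) ^ d)⁻¹ : ℝ) • ∫ ξ : Fin d → ℝ, φ ξ *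
        Complex.exp (Complex.I * ((∑ k, x k * ξ k : ℝ) : ℂ)) := by
  have h2 : (2 * π)⁻¹ ≠ 0 := by positivity
  let e : EuclideanSpace ℝ (Fin d) ≃L[ℝ] (Fin d → ℝ) := EuclideanSpace.equiv (Fin d) ℝ
  let sc : (Fin d → ℝ) ≃L[ℝ] (Fin d → ℝ) := ContinuousLinearEquiv.smulLeft (Units.mk0 _ h2)
  let g : SchwartzMap (EuclideanSpace ℝ (Fin d)) ℂ :=
    SchwartzMap.compCLMOfContinuousLinearEquiv ℂ e f
  let φ : SchwartzMap (Fin d → ℝ) ℂ :=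
    SchwartzMap.compCLMOfContinuousLinearEquiv ℂ (sc.trans e.symm) (𝓕 g)
  have hφ : ∀ ξ, φ ξ = (𝓕 g) (WithLp.toLp 2 ((2 * π)⁻¹ • ξ)) := fun ξ => rfl
  refine ⟨φ, fun ξ => ?_, fun x => ?_⟩
  · rw [hφ, SchwartzMap.fourier_coe, Real.fourier_eq', FTd,
      ← (PiLp.volume_preserving_toLp (Fin d)).integral_comp
        (MeasurableEquiv.toLp 2 (Fin d → ℝ)).measurableEmbedding]
    congr 1
    ext x
    have : g (WithLp.toLp 2 x) = f x := rfl
    rw [this, smul_eq_mul]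
    congr 2
    rw [PiLp.inner_apply]
    simp only [RCLike.inner_apply, conj_trivial, Pi.smul_apply, smul_eq_mul]
    have : (∑ k, (2 * π)⁻¹ * ξ k * x k) = (2 * π)⁻¹ * ∑ k, x k * ξ k := by
      rw [Finset.mul_sum]; exact Finset.sum_congr rfl fun k _ => by ring
    rw [this]
    push_cast
    field_simp
  · have hinv : 𝓕⁻ (𝓕 g) = g := FourierTransform.fourierInv_fourier_eq g
    have : f x = (𝓕⁻ (𝓕 g)) (WithLp.toLp 2 x) := by rw [hinv]; rfl
    rw [this, SchwartzMap.fourierInv_coe, Real.fourierInv_eq',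
      ← (PiLp.volume_preserving_toLp (Fin d)).integral_comp
        (MeasurableEquiv.toLp 2 (Fin d → ℝ)).measurableEmbedding]
    have h3 := Measure.integral_comp_inv_smul (volume : Measure (Fin d → ℝ)) (fun ξ : Fin d → ℝ =>
      Complex.exp (((2 * π * inner ℝ (WithLp.toLp 2 ξ) (WithLp.toLp 2 x : EuclideanSpace ℝ (Fin d)) : ℝ) : ℂ)
        * Complex.I) • (𝓕 g) (WithLp.toLp 2 ξ)) (2 * π)
    simp only [Module.finrank_fintype_fun_eq_card, Fintype.card_fin] at h3
    rw [abs_of_pos (by positivity)] at h3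
    have h4 : (∫ ξ : Fin d → ℝ, φ ξ * Complex.exp (Complex.I * ((∑ k, x k * ξ k : ℝ) : ℂ))) =
        ∫ ξ : Fin d → ℝ, Complex.exp (((2 * π * inner ℝ (WithLp.toLp 2 ((2 * π)⁻¹ • ξ))
          (WithLp.toLp 2 x : EuclideanSpace ℝ (Fin d)) : ℝ) : ℂ)
        * Complex.I) • (𝓕 g) (WithLp.toLp 2 ((2 * π)⁻¹ • ξ)) := by
      congr 1
      ext ξ
      rw [hφ, smul_eq_mul, mul_comm]
      congr 2
      rw [PiLp.inner_apply]
      simp only [RCLike.inner_apply, conj_trivial, Pi.smul_apply, smul_eq_mul]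
      have : (∑ k, x k * ((2 * π)⁻¹ * ξ k)) = (2 * π)⁻¹ * ∑ k, x k * ξ k := by
        rw [Finset.mul_sum]; exact Finset.sum_congr rfl fun k _ => by ring
      rw [this]
      push_cast
      field_simp
    rw [h4, h3, smul_smul, inv_mul_cancel₀ (by positivity), one_smul]

lemma SchwartzMap.exists_norm_le_rpow {d : ℕ} (φ : SchwartzMap (Fin d → ℝ) ℂ) (m : ℕ) :
    ∃ C : ℝ, ∀ ξ, ‖φ ξ‖ ≤ C * (1 + ‖ξ‖) ^ (-(m : ℝ)) := by
  obtain ⟨C, h⟩ : ∃ C : ℝ, ∀ ξ, (1 + ‖ξ‖) ^ m * ‖φ ξ‖ ≤ C := by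
    have h := SchwartzMap.one_add_le_sup_seminorm_apply (𝕜 := ℝ) (m := (m, 0)) (k := m) (n := 0)
      le_rfl le_rfl φ
    simp only [norm_iteratedFDeriv_zero] at h
    exact ⟨_, h⟩
  refine ⟨C, fun ξ => ?_⟩
  rw [Real.rpow_neg (by positivity), Real.rpow_natCast, ← div_eq_mul_inv, le_div_iff₀ (by positivity),
    mul_comm]
  exact h ξ

section slice

lemma integrable_decay_pi (n : ℕ) :
    Integrable (fun η : Fin n → ℝ => (1 + ‖η‖) ^ (-((n + 1 : ℕ) : ℝ))) :=
  integrable_one_add_norm (by simp)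

variable {n : ℕ} (k : Fin (n + 1))

lemma measurePreserving_insertNth : MeasurePreserving
    (MeasurableEquiv.piFinSuccAbove (fun _ : Fin (n + 1) => ℝ) k).symm volume volume :=
  (volume_preserving_piFinSuccAbove (fun _ => ℝ) k).symm

lemma piFinSuccAbove_symm_eq (z : ℝ × (Fin n → ℝ)) :
    (MeasurableEquiv.piFinSuccAbove (fun _ : Fin (n + 1) => ℝ) k).symm z =
      (k.insertNth z.1 z.2 : Fin (n + 1) → ℝ) := rfl

lemma norm_le_norm_insertNth (τ : ℝ) (η : Fin n → ℝ) :
    ‖η‖ ≤ ‖(k.insertNth τ η : Fin (n + 1) → ℝ)‖ := by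
  refine (pi_norm_le_iff_of_nonneg (norm_nonneg _)).2 fun l => ?_
  simpa using norm_le_pi_norm (k.insertNth τ η : Fin (n + 1) → ℝ) (k.succAbove l)

lemma continuous_insertNth : Continuous (fun z : ℝ × (Fin n → ℝ) =>
    (k.insertNth z.1 z.2 : Fin (n + 1) → ℝ)) :=
  Continuous.finInsertNth (A := fun _ => ℝ) k continuous_fst continuous_snd

lemma hasDerivAt_insertNth (η : Fin n → ℝ) (τ : ℝ) :
    HasDerivAt (fun τ : ℝ => (k.insertNth τ η : Fin (n + 1) → ℝ)) (Pi.single k 1) τ := by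
  refine hasDerivAt_pi.2 fun l => ?_
  induction l using Fin.succAboveCases k with
  | x => simpa using hasDerivAt_id' τ
  | p l => simpa using hasDerivAt_const τ (η l)

variable {M : (Fin n → ℝ) → ℝ} (hM : Measurable M) (hM1 : ∀ η, |M η| ≤ 1)
  (φ : SchwartzMap (Fin (n + 1) → ℝ) ℂ) (y : Fin n → ℝ)

/-- The frequency profile in the variable `k` of a function on `ℝ^{n+1}` with the remaining
physical variables frozen at `y`. -/
def sliceProf (M : (Fin n → ℝ) → ℝ) (τ : ℝ) : ℂ :=
  ∫ η : Fin n → ℝ, (M η : ℂ) * φ (k.insertNth τ η) *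
    Complex.exp (Complex.I * ((∑ l, y l * η l : ℝ) : ℂ))

include hM hM1

lemma integrable_slice_bdd {X : Type*} [MeasurableSpace X] {μ : Measure X} {G : X → ℂ}
    (hG : Integrable G μ) {π' : X → (Fin n → ℝ)} (hπ : Measurable π') :
    Integrable (fun z => (M (π' z) : ℂ) * G z *
      Complex.exp (Complex.I * ((∑ l, y l * π' z l : ℝ) : ℂ))) μ := by
  refine Integrable.mul_bdd (c := 1) (hG.bdd_mul (c := 1) ?_ (ae_of_all _ fun z => ?_)) ?_
    (ae_of_all _ fun z => (Complex.norm_exp_I_mul_ofReal _).le)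
  · exact (Complex.measurable_ofReal.comp (hM.comp hπ)).aestronglyMeasurable
  · simpa using hM1 (π' z)
  · have : Measurable fun z => ∑ l, y l * π' z l :=
      Finset.measurable_sum _ fun l _ => ((measurable_pi_apply l).comp hπ).const_mul _
    exact (Complex.measurable_exp.comp
      ((Complex.measurable_ofReal.comp this).const_mul _)).aestronglyMeasurable

lemma integrable_slice_prod : Integrable (fun z : ℝ × (Fin n → ℝ) => (M z.2 : ℂ) *
    φ (k.insertNth z.1 z.2) * Complex.exp (Complex.I * ((∑ l, y l * z.2 l : ℝ) : ℂ)))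
    (volume.prod volume) := by
  refine integrable_slice_bdd hM hM1 y (π' := Prod.snd) ?_ measurable_snd
  exact ((measurePreserving_insertNth k).integrable_comp_emb
    (MeasurableEquiv.measurableEmbedding _)).2 (φ.integrable (μ := volume))

lemma integrable_sliceProf : Integrable (sliceProf k φ y M) :=
  (integrable_slice_prod k hM hM1 φ y).integral_prod_left

lemma norm_slice_le {φ : SchwartzMap (Fin (n + 1) → ℝ) ℂ} {C : ℝ}
    (hC : ∀ ξ, ‖φ ξ‖ ≤ C * (1 + ‖ξ‖) ^ (-((n + 1 : ℕ) : ℝ))) (τ : ℝ) (η : Fin n → ℝ) :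
    ‖(M η : ℂ) * φ (k.insertNth τ η) * Complex.exp (Complex.I * ((∑ l, y l * η l : ℝ) : ℂ))‖ ≤
      C * (1 + ‖η‖) ^ (-((n + 1 : ℕ) : ℝ)) := by
  have hC0 : 0 ≤ C := by
    have := (norm_nonneg _).trans (hC 0); simpa using this
  rw [norm_mul, norm_mul, Complex.norm_exp_I_mul_ofReal, mul_one, Complex.norm_real, Real.norm_eq_abs]
  refine (mul_le_of_le_one_left (norm_nonneg _) (hM1 η)).trans ((hC _).trans ?_)
  refine mul_le_mul_of_nonneg_left ?_ hC0
  exact Real.rpow_le_rpow_of_nonpos (by positivity)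
    (by gcongr; exact norm_le_norm_insertNth k τ η) (neg_nonpos.2 (Nat.cast_nonneg _))

open scoped LineDeriv in
lemma c1Int_sliceProf : C1Int (sliceProf k φ y M) := by
  let φ' : SchwartzMap (Fin (n + 1) → ℝ) ℂ := ∂_{(Pi.single k 1 : Fin (n + 1) → ℝ)} φ
  have hφ' : ∀ ξ, φ' ξ = fderiv ℝ φ ξ (Pi.single k 1) := fun ξ =>
    SchwartzMap.lineDerivOp_apply_eq_fderiv _ _ _
  obtain ⟨C, hC⟩ := φ.exists_norm_le_rpow (n + 1)
  obtain ⟨C', hC'⟩ := φ'.exists_norm_le_rpow (n + 1)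
  have hmeas : ∀ (ψ : SchwartzMap (Fin (n + 1) → ℝ) ℂ) (τ : ℝ), AEStronglyMeasurable
      (fun η : Fin n → ℝ => (M η : ℂ) * ψ (k.insertNth τ η) *
        Complex.exp (Complex.I * ((∑ l, y l * η l : ℝ) : ℂ))) volume := fun ψ τ => by
    refine AEStronglyMeasurable.mul (AEStronglyMeasurable.mul
      (Complex.measurable_ofReal.comp hM).aestronglyMeasurable
      (Continuous.aestronglyMeasurable ?_)) (Continuous.aestronglyMeasurable (by fun_prop))
    exact ψ.continuous.comp ((continuous_insertNth k).comp (by fun_prop : Continuous fun η => (τ, η)))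
  refine ⟨sliceProf k φ' y M, fun τ => ?_, integrable_sliceProf k hM hM1 φ y,
    integrable_sliceProf k hM hM1 φ' y⟩
  refine (hasDerivAt_integral_of_dominated_loc_of_deriv_le (s := Set.univ) univ_mem
    (bound := fun η => C' * (1 + ‖η‖) ^ (-((n + 1 : ℕ) : ℝ)))
    (Eventually.of_forall fun τ => hmeas φ τ) ?_ (hmeas φ' τ)
    (ae_of_all _ fun η τ _ => norm_slice_le k hM hM1 y hC' τ η)
    ((integrable_decay_pi n).const_mul C') (ae_of_all _ fun η τ _ => ?_)).2
  · exact Integrable.mono' ((integrable_decay_pi n).const_mul C) (hmeas φ τ)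
      (ae_of_all _ fun η => norm_slice_le k hM hM1 y hC τ η)
  · rw [hφ']
    have h1 := (φ.hasFDerivAt (k.insertNth τ η)).comp_hasDerivAt τ (hasDerivAt_insertNth k η τ)
    exact (h1.const_mul _).mul_const _

end slice

/-- The function on `ℝ^d` with frequency profile `Ψ`. -/
def synPi {d : ℕ} (Ψ : (Fin d → ℝ) → ℂ) (x : Fin d → ℝ) : ℂ :=
  ∫ ξ : Fin d → ℝ, Ψ ξ * Complex.exp (Complex.I * ((∑ k, x k * ξ k : ℝ) : ℂ))

lemma integrable_synPi {d : ℕ} {Ψ : (Fin d → ℝ) → ℂ} (h : Integrable Ψ) (x : Fin d → ℝ) :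
    Integrable (fun ξ : Fin d → ℝ =>
      Ψ ξ * Complex.exp (Complex.I * ((∑ k, x k * ξ k : ℝ) : ℂ))) :=
  h.mul_bdd (c := 1) (Continuous.aestronglyMeasurable (by fun_prop))
    (ae_of_all _ fun ξ => (Complex.norm_exp_I_mul_ofReal _).le)

lemma continuous_synPi {d : ℕ} {Ψ : (Fin d → ℝ) → ℂ} (h : Integrable Ψ) :
    Continuous (synPi Ψ) := by
  refine continuous_of_dominated (bound := fun ξ => ‖Ψ ξ‖) (fun x => (integrable_synPi h x).1)
    (fun x => ae_of_all _ fun ξ => ?_) h.norm (ae_of_all _ fun ξ => by fun_prop)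
  rw [norm_mul, Complex.norm_exp_I_mul_ofReal, mul_one]

lemma integrable_symbol_mul {d : ℕ} {m : (Fin d → ℝ) → ℝ} (hm : Measurable m)
    (hm1 : ∀ ξ, |m ξ| ≤ 1) (φ : SchwartzMap (Fin d → ℝ) ℂ) :
    Integrable (fun ξ => (m ξ : ℂ) * φ ξ) :=
  (φ.integrable (μ := volume)).bdd_mul (c := 1)
    (Complex.measurable_ofReal.comp hm).aestronglyMeasurable
    (ae_of_all _ fun ξ => by simpa using hm1 ξ)

section step

variable {n : ℕ} (k : Fin (n + 1))

lemma synPi_insertNth {m : (Fin (n + 1) → ℝ) → ℝ} (hm : Measurable m) (hm1 : ∀ ξ, |m ξ| ≤ 1)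
    {a : ℝ → ℝ} {M : (Fin n → ℝ) → ℝ} (hmM : ∀ τ η, m (k.insertNth τ η) = a τ * M η)
    (φ : SchwartzMap (Fin (n + 1) → ℝ) ℂ) (t : ℝ) (y : Fin n → ℝ) :
    synPi (fun ξ => (m ξ : ℂ) * φ ξ) (k.insertNth t y) =
      syn (fun τ => (a τ : ℂ) * sliceProf k φ y M τ) t := by
  have hI := integrable_synPi (integrable_symbol_mul hm hm1 φ) (k.insertNth t y)
  have hI' := ((measurePreserving_insertNth k).integrable_comp_emb
    (MeasurableEquiv.measurableEmbedding _)).2 hI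
  unfold synPi syn
  rw [← (measurePreserving_insertNth k).integral_comp (MeasurableEquiv.measurableEmbedding _)]
  refine (integral_prod _ hI').trans ?_
  congr 1
  ext τ
  simp only [sliceProf]
  rw [← integral_const_mul, ← integral_mul_const]
  congr 1
  ext η
  rw [Function.comp_apply, piFinSuccAbove_symm_eq, hmM]
  have : Complex.exp (Complex.I * ((∑ l, (k.insertNth t y : Fin (n + 1) → ℝ) l *
      (k.insertNth τ η : Fin (n + 1) → ℝ) l : ℝ) : ℂ)) =
      Complex.exp (Complex.I * ((∑ l, y l * η l : ℝ) : ℂ)) * Complex.exp (Complex.I * t * τ) := by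
    rw [← Complex.exp_add, Fin.sum_univ_succAbove _ k]
    simp only [Fin.insertNth_apply_same, Fin.insertNth_apply_succAbove]
    congr 1
    push_cast
    ring
  simp only [] at this ⊢
  rw [this]
  push_cast
  ring

lemma lintegral_synPi_insertNth {κ : Type*} [Fintype κ] {m : κ → (Fin (n + 1) → ℝ) → ℝ}
    (hm : ∀ q, Measurable (m q)) (hm1 : ∀ q ξ, |m q ξ| ≤ 1)
    {a : κ → ℝ → ℝ} {M : κ → (Fin n → ℝ) → ℝ}
    (hmM : ∀ q τ η, m q (k.insertNth τ η) = a q τ * M q η)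
    (φ : SchwartzMap (Fin (n + 1) → ℝ) ℂ) (p : ℝ) :
    ∫⁻ x, ENNReal.ofReal ((∑ q, ‖synPi (fun ξ => (m q ξ : ℂ) * φ ξ) x‖ ^ 2) ^ (p / 2)) =
      ∫⁻ y, synE p (fun q τ => (a q τ : ℂ) * sliceProf k φ y (M q) τ) := by
  have hmeas : Measurable fun x => ENNReal.ofReal
      ((∑ q, ‖synPi (fun ξ => (m q ξ : ℂ) * φ ξ) x‖ ^ 2) ^ (p / 2)) := by
    refine ENNReal.measurable_ofReal.comp (Measurable.pow_const (Finset.measurable_sum _ fun q _ =>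
      (Measurable.pow_const (continuous_synPi (integrable_symbol_mul (hm q) (hm1 q) φ)).measurable.norm 2)) _)
  rw [← (measurePreserving_insertNth k).lintegral_comp hmeas]
  refine (lintegral_prod_symm _ (hmeas.comp (MeasurableEquiv.measurable _)).aemeasurable).trans ?_
  refine lintegral_congr fun y => lintegral_congr fun t => ?_
  simp only [Function.comp_apply, piFinSuccAbove_symm_eq, synPi_insertNth k (hm _) (hm1 _) (hmM _) φ t y]

lemma lintegral_step {Λ : ℤ → ℝ} (hpos : ∀ j, 0 < Λ j) (hmono : StrictMono Λ)
    (hbot : Tendsto Λ atBot (𝓝 0)) (htop : Tendsto Λ atTop atTop)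
    (hbdd : BddAbove {m : ℕ | ∃ j : ℤ,
      m = (Set.range Λ ∩ Set.Ico ((2:ℝ) ^ (j - 1)) ((2:ℝ) ^ j)).ncard})
    {ι : Type*} [Fintype ι] {m : ι → (Fin (n + 1) → ℝ) → ℝ}
    (hm : ∀ q, Measurable (m q)) (hm1 : ∀ q ξ, |m q ξ| ≤ 1)
    (hmk : ∀ q τ η, m q (k.insertNth τ η) = m q (k.insertNth 0 η))
    {φ : SchwartzMap (Fin (n + 1) → ℝ) ℂ} (h0 : ∀ ξ, ξ k < 0 → φ ξ = 0)
    {p : ℝ} (hp1 : 1 < p) (hp2 : p < 2) (s : Finset ℤ) :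
    ∫⁻ x, ENNReal.ofReal ((∑ q : ι × s, ‖synPi (fun ξ =>
        ((symInd Λ q.2 (ξ k) * m q.1 ξ : ℝ) : ℂ) * φ ξ) x‖ ^ 2) ^ (p / 2)) ≤
      ENNReal.ofReal ((oneC * Real.sqrt (sigmaE Λ) / (p - 1)) ^ p) *
        ∫⁻ x, ENNReal.ofReal ((∑ i, ‖synPi (fun ξ => (m i ξ : ℂ) * φ ξ) x‖ ^ 2) ^ (p / 2)) := by
  have hM : ∀ q, Measurable fun η => m q (k.insertNth 0 η) := fun q =>
    (hm q).comp ((continuous_insertNth k).comp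
      (by fun_prop : Continuous fun η : Fin n → ℝ => ((0 : ℝ), η))).measurable
  have hM1 : ∀ q η, |m q (k.insertNth 0 η)| ≤ 1 := fun q η => hm1 q _
  rw [lintegral_synPi_insertNth k (κ := ι × s) (a := fun q => symInd Λ q.2)
      (M := fun q η => m q.1 (k.insertNth 0 η)) _ _ _ φ p,
    lintegral_synPi_insertNth k (a := fun _ _ => 1)
      (M := fun q η => m q (k.insertNth 0 η)) hm hm1 (fun q τ η => by rw [hmk, one_mul]) φ p,
    ← lintegral_const_mul' _ _ ENNReal.ofReal_ne_top]
  · refine lintegral_mono fun y => ?_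
    simp only [Complex.ofReal_one, one_mul]
    refine one_parameter hpos hmono hbot htop hbdd
      (Φ := fun i => sliceProf k φ y (fun η => m i (k.insertNth 0 η)))
      (fun i => c1Int_sliceProf k (hM i) (hM1 i) φ y) (fun i τ hτ => ?_) hp1 hp2 s
    rw [sliceProf]
    simp [h0 (k.insertNth τ _) (by simpa using hτ)]
  · exact fun q => ((measurable_symInd Λ q.2).comp (measurable_pi_apply k)).mul (hm q.1)
  · intro q ξ
    rw [abs_mul]
    exact mul_le_one₀ (abs_symInd_le _ _ _) (abs_nonneg _) (hm1 _ _)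
  · intro q τ η
    rw [hmk, Fin.insertNth_apply_same]

end step

/-- The box of indices with coordinates in `F` along `S` and zero elsewhere. -/
def boxOn {d : ℕ} (F : Finset ℤ) (S : Finset (Fin d)) : Finset (Fin d → ℤ) :=
  Fintype.piFinset fun k => if k ∈ S then F else {0}

lemma sum_boxOn_insert {d : ℕ} (F : Finset ℤ) {S : Finset (Fin d)} {k : Fin d} (hk : k ∉ S)
    (g : (Fin d → ℤ) → ℝ) :
    ∑ j ∈ boxOn F (insert k S), g j =
      ∑ q : boxOn F S × F, g (Function.update q.1.1 k q.2.1) := by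
  have : ∑ q : boxOn F S × F, g (Function.update q.1.1 k q.2.1) =
      ∑ q ∈ boxOn F S ×ˢ F, g (Function.update q.1 k q.2) := by
    rw [Fintype.sum_prod_type, Finset.sum_product,
      ← Finset.sum_coe_sort (boxOn F S)]
    refine Finset.sum_congr rfl fun i _ => ?_
    rw [← Finset.sum_coe_sort F]
  rw [this]
  refine Finset.sum_bij' (fun j _ => (Function.update j k 0, j k))
    (fun q _ => Function.update q.1 k q.2) ?_ ?_ ?_ ?_ ?_
  · intro j hj
    simp only [boxOn, Fintype.mem_piFinset, Finset.mem_product] at hj ⊢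
    refine ⟨fun l => ?_, by simpa using hj k⟩
    by_cases hl : l = k
    · subst hl; simp [hk]
    · simpa [hl] using hj l
  · intro q hq
    simp only [boxOn, Fintype.mem_piFinset, Finset.mem_product] at hq ⊢
    intro l
    by_cases hl : l = k
    · subst hl; simpa using hq.2
    · simpa [hl] using hq.1 l
  · intro j hj; simp
  · intro q hq
    simp only [boxOn, Fintype.mem_piFinset, Finset.mem_product] at hq
    have : q.1 k = 0 := by simpa [hk] using hq.1 k
    ext1 <;> simp [← this]
  · intro j hj; simp

/-- The product symbol over the coordinates in `S`. -/
def symOn {d : ℕ} (Λs : Fin d → ℤ → ℝ) (S : Finset (Fin d)) (j : Fin d → ℤ) (ξ : Fin d → ℝ) : ℝ :=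
  ∏ k ∈ S, symInd (Λs k) (j k) (ξ k)

lemma measurable_symOn {d : ℕ} (Λs : Fin d → ℤ → ℝ) (S : Finset (Fin d)) (j : Fin d → ℤ) :
    Measurable (symOn Λs S j) :=
  Finset.measurable_prod _ fun k _ => (measurable_symInd (Λs k) (j k)).comp (measurable_pi_apply k)

lemma abs_symOn_le {d : ℕ} (Λs : Fin d → ℤ → ℝ) (S : Finset (Fin d)) (j : Fin d → ℤ)
    (ξ : Fin d → ℝ) : |symOn Λs S j ξ| ≤ 1 := by
  rw [symOn, Finset.abs_prod]
  exact Finset.prod_le_one (fun _ _ => abs_nonneg _) fun k _ => abs_symInd_le _ _ _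

lemma symOn_insert_update {d : ℕ} (Λs : Fin d → ℤ → ℝ) {S : Finset (Fin d)} {k : Fin d}
    (hk : k ∉ S) (j : Fin d → ℤ) (i : ℤ) (ξ : Fin d → ℝ) :
    symOn Λs (insert k S) (Function.update j k i) ξ = symInd (Λs k) i (ξ k) * symOn Λs S j ξ := by
  rw [symOn, Finset.prod_insert hk, Function.update_self, symOn]
  congr 1
  refine Finset.prod_congr rfl fun l hl => ?_
  rw [Function.update_of_ne (by rintro rfl; exact hk hl)]

lemma symOn_insertNth {n : ℕ} (Λs : Fin (n + 1) → ℤ → ℝ) {S : Finset (Fin (n + 1))}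
    {k : Fin (n + 1)} (hk : k ∉ S) (j : Fin (n + 1) → ℤ) (τ : ℝ) (η : Fin n → ℝ) :
    symOn Λs S j (k.insertNth τ η) = symOn Λs S j (k.insertNth 0 η) := by
  refine Finset.prod_congr rfl fun l hl => ?_
  obtain ⟨l, rfl⟩ := Fin.exists_succAbove_eq (show l ≠ k by rintro rfl; exact hk hl)
  simp

section iterate

variable {n : ℕ} {Λs : Fin (n + 1) → ℤ → ℝ} (hpos : ∀ k, ∀ j, 0 < Λs k j)
  (hmono : ∀ k, StrictMono (Λs k)) (hbot : ∀ k, Tendsto (Λs k) atBot (𝓝 0))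
  (htop : ∀ k, Tendsto (Λs k) atTop atTop)
  (hbdd : ∀ k, BddAbove {m : ℕ | ∃ j : ℤ,
      m = (Set.range (Λs k) ∩ Set.Ico ((2:ℝ) ^ (j - 1)) ((2:ℝ) ^ j)).ncard})
  {φ : SchwartzMap (Fin (n + 1) → ℝ) ℂ} (h0 : ∀ ξ, (∃ k, ξ k < 0) → φ ξ = 0)
  {p : ℝ} (hp1 : 1 < p) (hp2 : p < 2) (F : Finset ℤ)

include hpos hmono hbot htop hbdd h0 hp1 hp2

lemma lintegral_boxOn_le (S : Finset (Fin (n + 1))) :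
    ∫⁻ x, ENNReal.ofReal ((∑ j ∈ boxOn F S,
        ‖synPi (fun ξ => (symOn Λs S j ξ : ℂ) * φ ξ) x‖ ^ 2) ^ (p / 2)) ≤
      (∏ k ∈ S, ENNReal.ofReal ((oneC * Real.sqrt (sigmaE (Λs k)) / (p - 1)) ^ p)) *
        ∫⁻ x, ENNReal.ofReal ((‖synPi φ x‖ ^ 2) ^ (p / 2)) := by
  induction S using Finset.induction_on with
  | empty => simp [boxOn, symOn]
  | insert k S hk ih =>
    rw [Finset.prod_insert hk, mul_assoc]
    refine le_trans ?_ (mul_le_mul_right ih _)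
    have h := lintegral_step k (hpos k) (hmono k) (hbot k) (htop k) (hbdd k)
      (m := fun q : boxOn F S => symOn Λs S q.1) (fun q => measurable_symOn _ _ _)
      (fun q => abs_symOn_le _ _ _) (fun q => symOn_insertNth Λs hk q.1)
      (fun ξ hξ => h0 ξ ⟨k, hξ⟩) hp1 hp2 F
    refine le_trans (le_of_eq ?_) (h.trans (le_of_eq ?_))
    · simp only [sum_boxOn_insert F hk, symOn_insert_update Λs hk]
    · congr 1
      refine lintegral_congr fun x => ?_
      rw [← Finset.sum_coe_sort (boxOn F S)]

end iterate

lemma ofReal_tsum_rpow_le {ι : Type*} {a : ι → ℝ} {s : ℕ → Finset ι}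
    (hs : Tendsto s atTop atTop) {q : ℝ} (hq : 0 < q) :
    ENNReal.ofReal ((∑' i, a i) ^ q) ≤ ⨆ N, ENNReal.ofReal ((∑ i ∈ s N, a i) ^ q) := by
  by_cases h : Summable a
  · have h1 : Tendsto (fun N => ENNReal.ofReal ((∑ i ∈ s N, a i) ^ q)) atTop
        (𝓝 (ENNReal.ofReal ((∑' i, a i) ^ q))) :=
      (ENNReal.continuous_ofReal.tendsto _).comp
        (((Real.continuous_rpow_const hq.le).tendsto _).comp (h.hasSum.comp hs))
    exact le_of_tendsto' h1 fun N => le_iSup (fun N => ENNReal.ofReal ((∑ i ∈ s N, a i) ^ q)) N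
  · rw [tsum_eq_zero_of_not_summable h, Real.zero_rpow hq.ne']
    simp

lemma monotone_box (d : ℕ) :
    Monotone fun N : ℕ => boxOn (d := d) (Finset.Icc (-(N : ℤ)) N) Finset.univ := by
  intro N N' h j hj
  simp only [boxOn, Fintype.mem_piFinset, Finset.mem_univ, if_true, Finset.mem_Icc] at hj ⊢
  exact fun k => ⟨by have := hj k; omega, by have := hj k; omega⟩

lemma tendsto_box (d : ℕ) :
    Tendsto (fun N : ℕ => boxOn (d := d) (Finset.Icc (-(N : ℤ)) N) Finset.univ) atTop atTop := by
  refine tendsto_atTop_finset_of_monotone (monotone_box d) fun j => ?_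
  refine ⟨∑ k, (j k).natAbs, ?_⟩
  simp only [boxOn, Fintype.mem_piFinset, Finset.mem_univ, if_true, Finset.mem_Icc]
  intro k
  have := Finset.single_le_sum (f := fun k => (j k).natAbs) (fun _ _ => Nat.zero_le _)
    (Finset.mem_univ k)
  omega

lemma ofReal_sqrt_rpow_enorm {a p : ℝ} (ha : 0 ≤ a) (hp : 0 < p) :
    ‖Real.sqrt a‖ₑ ^ p = ENNReal.ofReal (a ^ (p / 2)) := by
  rw [Real.enorm_eq_ofReal (Real.sqrt_nonneg a), ENNReal.ofReal_rpow_of_nonneg (Real.sqrt_nonneg a) hp.le,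
    Real.sqrt_eq_rpow, ← Real.rpow_mul ha]
  congr 2
  ring

lemma PpiecePi_eq_synPi {d : ℕ} {Λs : Fin d → ℤ → ℝ} {f φ : SchwartzMap (Fin d → ℝ) ℂ}
    (hφ : ∀ ξ, φ ξ = FTd f ξ) (j : Fin d → ℤ) (x : Fin d → ℝ) :
    PpiecePi Λs j f x = synPi (fun ξ => (symOn Λs Finset.univ j ξ : ℂ) *
      (((((2 * π) ^ d)⁻¹ : ℝ) • φ : SchwartzMap (Fin d → ℝ) ℂ) ξ)) x := by
  rw [PpiecePi, synPi, ← integral_smul]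
  congr 1
  ext ξ
  rw [smul_apply, ← hφ, symOn, Complex.real_smul, Complex.real_smul]
  ring

theorem eLpNorm_LPsqE_le {n : ℕ} {Λs : Fin (n + 1) → ℤ → ℝ} (hpos : ∀ k, ∀ j, 0 < Λs k j)
    (hmono : ∀ k, StrictMono (Λs k)) (hbot : ∀ k, Tendsto (Λs k) atBot (𝓝 0))
    (htop : ∀ k, Tendsto (Λs k) atTop atTop)
    (hbdd : ∀ k, BddAbove {m : ℕ | ∃ j : ℤ,
      m = (Set.range (Λs k) ∩ Set.Ico ((2:ℝ) ^ (j - 1)) ((2:ℝ) ^ j)).ncard})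
    {p : ℝ} (hp1 : 1 < p) (hp2 : p < 2) (f : SchwartzMap (Fin (n + 1) → ℝ) ℂ)
    (hf : ∀ ξ : Fin (n + 1) → ℝ, (∃ k, ξ k < 0) → FTd f ξ = 0) :
    eLpNorm (LPsqE Λs f) (ENNReal.ofReal p) volume ≤
      ENNReal.ofReal (∏ k, oneC * Real.sqrt (sigmaE (Λs k)) / (p - 1)) *
        eLpNorm f (ENNReal.ofReal p) volume := by
  have hp0 : 0 < p := by linarith
  have hne : ENNReal.ofReal p ≠ 0 := by simpa using hp0
  obtain ⟨φ, hφ, hinv⟩ := exists_schwartz_FTd f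
  set ψ : SchwartzMap (Fin (n + 1) → ℝ) ℂ := (((2 * π) ^ (n + 1))⁻¹ : ℝ) • φ with hψ
  have hψ0 : ∀ ξ, (∃ k, ξ k < 0) → ψ ξ = 0 := fun ξ hξ => by
    rw [hψ, smul_apply, hφ, hf ξ hξ, smul_zero]
  have hfψ : ∀ x, synPi ψ x = f x := fun x => by
    rw [hinv, synPi, ← integral_smul]
    congr 1
    ext ξ
    rw [hψ, smul_apply, Complex.real_smul, Complex.real_smul]
    ring
  have hP : ∀ j x, PpiecePi Λs j f x =
      synPi (fun ξ => (symOn Λs Finset.univ j ξ : ℂ) * ψ ξ) x := PpiecePi_eq_synPi hφ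
  have hA : ∀ k, 0 ≤ oneC * Real.sqrt (sigmaE (Λs k)) / (p - 1) := fun k =>
    div_nonneg (mul_nonneg (by norm_num [oneC]) (Real.sqrt_nonneg _)) (by linarith)
  set s : ℕ → Finset (Fin (n + 1) → ℤ) := fun N => boxOn (Finset.Icc (-(N : ℤ)) N) Finset.univ
    with hs
  have hmeas : ∀ N, Measurable fun x => ENNReal.ofReal ((∑ j ∈ s N,
      ‖synPi (fun ξ => (symOn Λs Finset.univ j ξ : ℂ) * ψ ξ) x‖ ^ 2) ^ (p / 2)) := fun N =>
    ENNReal.measurable_ofReal.comp (Measurable.pow_const (Finset.measurable_sum _ fun j _ =>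
      (Measurable.pow_const (continuous_synPi (integrable_symbol_mul
        (measurable_symOn Λs _ j) (abs_symOn_le Λs _ j) ψ)).measurable.norm 2)) _)
  have key : ∫⁻ x, ‖LPsqE Λs f x‖ₑ ^ p ≤
      ENNReal.ofReal (∏ k, oneC * Real.sqrt (sigmaE (Λs k)) / (p - 1)) ^ p *
        ∫⁻ x, ‖f x‖ₑ ^ p := by
    calc ∫⁻ x, ‖LPsqE Λs f x‖ₑ ^ p
        ≤ ∫⁻ x, ⨆ N, ENNReal.ofReal ((∑ j ∈ s N,
            ‖synPi (fun ξ => (symOn Λs Finset.univ j ξ : ℂ) * ψ ξ) x‖ ^ 2) ^ (p / 2)) := by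
          refine lintegral_mono fun x => ?_
          simp only [LPsqE]
          rw [ofReal_sqrt_rpow_enorm (tsum_nonneg fun j => by positivity) hp0]
          simp only [hP]
          exact ofReal_tsum_rpow_le (tendsto_box _) (by linarith)
      _ = ⨆ N, ∫⁻ x, ENNReal.ofReal ((∑ j ∈ s N,
            ‖synPi (fun ξ => (symOn Λs Finset.univ j ξ : ℂ) * ψ ξ) x‖ ^ 2) ^ (p / 2)) := by
          refine lintegral_iSup hmeas fun N N' h x => ?_
          refine ENNReal.ofReal_le_ofReal (Real.rpow_le_rpow (by positivity) ?_ (by linarith))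
          exact Finset.sum_le_sum_of_subset_of_nonneg (monotone_box _ h)
            fun _ _ _ => by positivity
      _ ≤ (∏ k, ENNReal.ofReal ((oneC * Real.sqrt (sigmaE (Λs k)) / (p - 1)) ^ p)) *
            ∫⁻ x, ENNReal.ofReal ((‖synPi ψ x‖ ^ 2) ^ (p / 2)) :=
          iSup_le fun N => lintegral_boxOn_le hpos hmono hbot htop hbdd hψ0 hp1 hp2 _ _
      _ = _ := by
          congr 1
          · rw [← ENNReal.ofReal_prod_of_nonneg fun k _ => Real.rpow_nonneg (hA k) p,
              Real.finsetProd_rpow _ _ (fun k _ => hA k),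
              ENNReal.ofReal_rpow_of_nonneg (Finset.prod_nonneg fun k _ => hA k) hp0.le]
          · refine lintegral_congr fun x => ?_
            rw [← ofReal_sqrt_rpow_enorm (by positivity) hp0, hfψ, Real.sqrt_sq (norm_nonneg _),
              enorm_norm]
  rw [eLpNorm_eq_lintegral_rpow_enorm_toReal hne ENNReal.ofReal_ne_top,
    eLpNorm_eq_lintegral_rpow_enorm_toReal hne ENNReal.ofReal_ne_top, ENNReal.toReal_ofReal hp0.le]
  refine (ENNReal.rpow_le_rpow key (by positivity)).trans (le_of_eq ?_)
  rw [ENNReal.mul_rpow_of_nonneg _ _ (by positivity), ← ENNReal.rpow_mul,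
    mul_one_div_cancel hp0.ne', ENNReal.rpow_one]

/-- For every `d ≥ 1` there is `C_d > 0` such that for all Littlewood–Paley sequences
`Λ₁,…,Λ_d` on `ℝ` with `σ_{Λ_n} < ∞`, every `1 < p < 2` and every Schwartz function `f`
on `ℝ^d` whose Fourier transform is supported in `[0,∞)^d`,
`‖S^{(Λ₁,…,Λ_d)}_{ℝ^d} f‖_p ≤ C_d (p-1)^{-d} (Π_n σ_{Λ_n}^{1/2}) ‖f‖_p`. -/
theorem statement17 (d : ℕ) (hd : 0 < d) :
    ∃ C : ℝ, 0 < C ∧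
      ∀ Λs : Fin d → ℤ → ℝ,
        (∀ n, ∀ j : ℤ, 0 < Λs n j) →
        (∀ n, StrictMono (Λs n)) →
        (∀ n, Tendsto (Λs n) atBot (𝓝 0)) →
        (∀ n, Tendsto (Λs n) atTop atTop) →
        (∀ n, BddAbove {m : ℕ | ∃ j : ℤ,
          m = (Set.range (Λs n) ∩ Set.Ico ((2:ℝ) ^ (j - 1)) ((2:ℝ) ^ j)).ncard}) →
        ∀ (p : ℝ), 1 < p → p < 2 →
        ∀ f : SchwartzMap (Fin d → ℝ) ℂ,
          (∀ ξ : Fin d → ℝ, (∃ k, ξ k < 0) → FTd (⇑f) ξ = 0) →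
          eLpNorm (LPsqE Λs (⇑f)) (ENNReal.ofReal p) volume ≤
            ENNReal.ofReal (C * (p - 1) ^ (-(d:ℝ)) * ∏ n, Real.sqrt (sigmaE (Λs n))) *
              eLpNorm (⇑f) (ENNReal.ofReal p) volume := by
  obtain ⟨n, rfl⟩ : ∃ n, d = n + 1 := ⟨d - 1, by omega⟩
  refine ⟨oneC ^ (n + 1), by norm_num [oneC], ?_⟩
  intro Λs hpos hmono hbot htop hbdd p hp1 hp2 f hf
  refine (eLpNorm_LPsqE_le hpos hmono hbot htop hbdd hp1 hp2 f hf).trans (le_of_eq ?_)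
  congr 2
  rw [Real.rpow_neg (by linarith), Real.rpow_natCast, Finset.prod_div_distrib,
    Finset.prod_mul_distrib, Finset.prod_const, Finset.prod_const, Finset.card_univ,
    Fintype.card_fin]
  generalize (p - 1) ^ (n + 1) = b
  ring

end
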